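/- Let L be a cubic symmetric lamination that has a periodic infinite gap of degree greater than 1 (a hyperbolic lamination). Then L has two critical infinite gaps of degree greater than 1 that are antipodal images of each other (gaps G and −G), and L is a q-lamination. -/

import Mathlib

noncomputable section

open Set Metric

instance : Fact ((0:ℝ) < 1) := ⟨one_pos⟩

/-- The circle `S = ℝ/ℤ`. -/
abbrev S1 : Type := AddCircle (1 : ℝ)

/-- The tripling map `σ₃ : x ↦ 3x (mod 1)`. -/
def s3 : S1 → S1 := fun x => (3 : ℕ) • x

/-- The antipodal map `x ↦ x + 1/2` (denoted `−x` in the paper). -/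
def antip : S1 → S1 := fun x => x + (((1:ℝ)/2 : ℝ) : S1)

/-- A chord of the circle: an unordered pair of points of `S1`. -/
abbrev Chord : Type := Sym2 S1

/-- The image chord of a chord under a circle map. -/
def cmap (f : S1 → S1) (ℓ : Chord) : Chord := Sym2.map f ℓ

/-- The length of a chord `{a,b}`: the shorter of the two arcs joining `a` and `b`
(the natural norm on `ℝ/ℤ`). -/
def chordLen : Chord → ℝ :=
  Sym2.lift ⟨fun a b => ‖a - b‖, fun a b => norm_sub_rev a b⟩

/-- The standard embedding of the circle `ℝ/ℤ` into `ℂ` (onto the unit circle). -/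
def toC (x : S1) : ℂ :=
  Complex.exp (2 * Real.pi * Complex.I * (((AddCircle.equivIco 1 0 x : Set.Ico (0:ℝ) (0+1)) : ℝ) : ℂ))

/-- The geometric chord in the closed unit disk of `ℂ` determined by an
unordered pair of circle points. -/
def chordSet : Chord → Set ℂ :=
  Sym2.lift ⟨fun a b => segment ℝ (toC a) (toC b), fun a b => segment_symm ℝ _ _⟩

/-- Two chords cross if their endpoints strictly alternate on the circle. -/
def Crosses (ℓ₁ ℓ₂ : Chord) : Prop :=
  (∃ a b c d : ℝ, a < b ∧ b < c ∧ c < d ∧ d < a + 1 ∧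
    ℓ₁ = s(((a : ℝ) : S1), ((c : ℝ) : S1)) ∧ ℓ₂ = s(((b : ℝ) : S1), ((d : ℝ) : S1))) ∨
  (∃ a b c d : ℝ, a < b ∧ b < c ∧ c < d ∧ d < a + 1 ∧
    ℓ₂ = s(((a : ℝ) : S1), ((c : ℝ) : S1)) ∧ ℓ₁ = s(((b : ℝ) : S1), ((d : ℝ) : S1)))

/-- A critical chord: nondegenerate with degenerate `σ₃`-image. -/
def IsCritical (ℓ : Chord) : Prop := ¬ ℓ.IsDiag ∧ (cmap s3 ℓ).IsDiag

/-- The union in `ℂ` of all the chords of a family. -/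
def unionSet (L : Set Chord) : Set ℂ := ⋃ ℓ ∈ L, chordSet ℓ

def openDisk : Set ℂ := Metric.ball (0:ℂ) 1
def closedDisk : Set ℂ := Metric.closedBall (0:ℂ) 1

/-- A lamination: a family of pairwise non-crossing chords whose union is closed. -/
structure IsLamination (L : Set Chord) : Prop where
  nocross : ∀ ℓ₁ ∈ L, ∀ ℓ₂ ∈ L, ¬ Crosses ℓ₁ ℓ₂
  closed : IsClosed (unionSet L)

/-- A sibling collection: three pairwise disjoint chords with the same
nondegenerate `σ₃`-image. -/
def IsSiblingCollection (ℓ₁ ℓ₂ ℓ₃ : Chord) : Prop :=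
  Disjoint (chordSet ℓ₁) (chordSet ℓ₂) ∧ Disjoint (chordSet ℓ₁) (chordSet ℓ₃) ∧
  Disjoint (chordSet ℓ₂) (chordSet ℓ₃) ∧
  ¬ (cmap s3 ℓ₁).IsDiag ∧ cmap s3 ℓ₂ = cmap s3 ℓ₁ ∧ cmap s3 ℓ₃ = cmap s3 ℓ₁

/-- A `σ₃`-invariant lamination. -/
structure IsInvLam (L : Set Chord) extends IsLamination L : Prop where
  forward : ∀ ℓ ∈ L, cmap s3 ℓ ∈ L ∨ (cmap s3 ℓ).IsDiag
  backward : ∀ ℓ ∈ L, ∃ ℓ' ∈ L, cmap s3 ℓ' = ℓ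
  siblings : ∀ ℓ ∈ L, ¬ (cmap s3 ℓ).IsDiag →
    ∃ ℓ₂ ∈ L, ∃ ℓ₃ ∈ L, IsSiblingCollection ℓ ℓ₂ ℓ₃

/-- A cubic symmetric lamination. -/
structure IsCubicSymLam (L : Set Chord) extends IsInvLam L : Prop where
  symm : ∀ ℓ ∈ L, cmap antip ℓ ∈ L

/-- A major: a leaf whose length is closest to `1/3` among all leaves. -/
def IsMajor (L : Set Chord) (M : Chord) : Prop :=
  M ∈ L ∧ ∀ ℓ ∈ L, |1/3 - chordLen M| ≤ |1/3 - chordLen ℓ|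

/-- A minor: the `σ₃`-image of a major. -/
def IsMinor (L : Set Chord) (m : Chord) : Prop := ∃ M, IsMajor L M ∧ m = cmap s3 M

/-- A comajor: a short (or degenerate) sibling of a major, disjoint from all majors. -/
def IsComajor (L : Set Chord) (c : Chord) : Prop :=
  (chordLen c < 1/6 ∨ c.IsDiag) ∧ (¬ c.IsDiag → c ∈ L) ∧
  (∃ M, IsMajor L M ∧ cmap s3 c = cmap s3 M) ∧
  (∀ M, IsMajor L M → Disjoint (chordSet c) (chordSet M))

/-- The cubic symmetric comajor lamination: all comajors of all cubic symmetric
laminations. -/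
def CsCL : Set Chord := {c | ∃ L, IsCubicSymLam L ∧ IsComajor L c}

/-- A chord is periodic if some positive iterate of `σ₃` fixes it. -/
def ChordPeriodic (c : Chord) : Prop := ∃ p, 1 ≤ p ∧ cmap (s3^[p]) c = c

/-- A comajor is co-periodic if its image is periodic but it is not. -/
def CoPeriodic (c : Chord) : Prop := ChordPeriodic (cmap s3 c) ∧ ¬ ChordPeriodic c

/-- The point of the unit circle in `ℂ` with argument `2πt`. -/
def circPt (t : ℝ) : ℂ := toC ((t : ℝ) : S1)

/-- The (closed) arc of the circle in `ℂ` from angle `u` to angle `v` (traversed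
positively), as a subset of `ℂ`. -/
def arcSet (u v : ℝ) : Set ℂ := circPt '' Set.Icc u v

/-- The unordered arc between angles `u` and `v`. -/
def arcSetU (u v : ℝ) : Set ℂ := circPt '' Set.uIcc u v

/-- The closed region `R(n)` bounded by the chord from angle `a` to angle `a+t`
(with `t` the length of the chord) and the corresponding (shorter) arc `H(n)`:
the convex hull of that arc. -/
def regionUnder (a t : ℝ) : Set ℂ := convexHull ℝ (arcSet a (a + t))

/-- `Under m n` (`m ≺ n`): `m` is contained in the region `R(n)`. -/
def Under (m n : Chord) : Prop :=
  ∃ a t : ℝ, 0 ≤ t ∧ t < 1/2 ∧ t = chordLen n ∧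
    n = s(((a : ℝ) : S1), ((a + t : ℝ) : S1)) ∧ chordSet m ⊆ regionUnder a t

/-- The (closed) strip `C(ℓ)` between the medium/long chord `ℓ` from angle `a` to
angle `a+t` (with `1/6 < t ≤ 1/2` its length) and its medium/long sibling
`ℓ' = {a+1/3, a+t-1/3}`. -/
def stripSet (a t : ℝ) : Set ℂ :=
  convexHull ℝ (arcSetU (a + t) (a + 1/3) ∪ arcSetU (a + t - 1/3) a)

/-- The short strips `SH(ℓ) = C(ℓ) ∪ −C(ℓ)`. -/
def SHSet (a t : ℝ) : Set ℂ := stripSet a t ∪ stripSet (a + 1/2) t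

/-- For a short chord `c` from angle `a` to angle `a+t` (`0 ≤ t < 1/6`), the strip
`C(M_c)` between the two medium/long chords `M_c = {a+2/3, a+t+1/3}` and
`M'_c = {a+1/3, a+t+2/3}` having the same `σ₃`-image as `c`. -/
def QStrip (a t : ℝ) : Set ℂ :=
  convexHull ℝ (arcSet (a + 1/3) (a + t + 1/3) ∪ arcSet (a + 2/3) (a + t + 2/3))

/-- A legal (symmetric) pair `{c, −c}`. -/
def IsLegalPair (c : Chord) : Prop :=
  c.IsDiag ∨
  ∃ a t : ℝ, 0 < t ∧ t < 1/6 ∧ t = chordLen c ∧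
    c = s(((a : ℝ) : S1), ((a + t : ℝ) : S1)) ∧
    (∀ i j : ℕ,
      ¬ Crosses (cmap (s3^[i]) c) (cmap (s3^[j]) c) ∧
      ¬ Crosses (cmap (s3^[i]) c) (cmap (s3^[j]) (cmap antip c)) ∧
      ¬ Crosses (cmap (s3^[i]) (cmap antip c)) (cmap (s3^[j]) (cmap antip c))) ∧
    (∀ i : ℕ, 1 ≤ i →
      chordSet (cmap (s3^[i]) c) ∩ interior (QStrip a t ∪ QStrip (a + 1/2) t) = ∅)

/-- A gap of a lamination: the closure of a connected component of the complement,
in the open unit disk, of the union of the leaves. -/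
def IsGapOf (L : Set Chord) (G : Set ℂ) : Prop :=
  ∃ z ∈ openDisk \ unionSet L, G = closure (connectedComponentIn (openDisk \ unionSet L) z)

/-- The vertices of a gap: its points on the circle. -/
def gapVerts (G : Set ℂ) : Set S1 := {x : S1 | toC x ∈ G}

/-- The image of a gap: the convex hull of the `σ₃`-image of its vertex set. -/
def gapImage (G : Set ℂ) : Set ℂ := convexHull ℝ (toC '' (s3 '' gapVerts G))

/-- Iterated gap images. -/
def gapIter (n : ℕ) (G : Set ℂ) : Set ℂ := gapImage^[n] G

/-- An edge of a gap: a nondegenerate chord contained in its boundary. -/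
def IsEdgeOf (G : Set ℂ) (ℓ : Chord) : Prop := ¬ ℓ.IsDiag ∧ chordSet ℓ ⊆ frontier G

/-- The (first return) map `σ₃^p` on the gap `G` has degree greater than one:
some edge of the image gap has (at least) two disjoint preimage edges in `G`. -/
def GapDegreeGE2 (G : Set ℂ) (p : ℕ) : Prop :=
  ∃ m e₁ e₂ : Chord, IsEdgeOf (gapIter p G) m ∧ e₁ ≠ e₂ ∧
    IsEdgeOf G e₁ ∧ IsEdgeOf G e₂ ∧ Disjoint (chordSet e₁) (chordSet e₂) ∧
    cmap (s3^[p]) e₁ = m ∧ cmap (s3^[p]) e₂ = m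

/-- `L` has a periodic infinite gap of degree greater than one (hyperbolicity). -/
def HasHyperbolicGap (L : Set Chord) : Prop :=
  ∃ G p, IsGapOf L G ∧ (gapVerts G).Infinite ∧ 1 ≤ p ∧ gapIter p G = G ∧ GapDegreeGE2 G p

/-- Two circle points are joined by a finite concatenation of leaves of `L`. -/
def ChainJoined (L : Set Chord) : S1 → S1 → Prop :=
  Relation.ReflTransGen (fun x y => ∃ ℓ ∈ L, x ∈ ℓ ∧ y ∈ ℓ)

/-- A q-lamination: points joined by finite concatenations of leaves are vertices of
a single leaf or finite gap. -/
def IsQLam (L : Set Chord) : Prop :=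
  ∀ x y : S1, ChainJoined L x y →
    x = y ∨ (∃ ℓ ∈ L, x ∈ ℓ ∧ y ∈ ℓ) ∨
    (∃ G, IsGapOf L G ∧ (gapVerts G).Finite ∧ toC x ∈ G ∧ toC y ∈ G)

/-- A periodic point of `σ₃`. -/
def PerPt (x : S1) : Prop := ∃ p, 1 ≤ p ∧ s3^[p] x = x

/-- An eventually periodic point of `σ₃`. -/
def EvPerPt (x : S1) : Prop := ∃ k, PerPt (s3^[k] x)

/-- `x` is strictly preperiodic of preperiod `k ≥ 1` and period `p`. -/
def StrictPreper (x : S1) (k p : ℕ) : Prop :=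
  1 ≤ k ∧ 1 ≤ p ∧ s3^[p] (s3^[k] x) = s3^[k] x ∧
  (∀ j < k, ¬ PerPt (s3^[j] x)) ∧
  (∀ q, 1 ≤ q → s3^[q] (s3^[k] x) = s3^[k] x → p ≤ q)

/-- A periodic point of type B: of period `2n` with `σ₃ⁿ(x) = −x`. -/
def TypeB (x : S1) : Prop :=
  ∃ n, 1 ≤ n ∧ Function.minimalPeriod s3 x = 2 * n ∧ s3^[n] x = antip x

/-- `c` is a two-sided limit of chords of the family `A`: within every complementary
component of the disk minus `c` there are chords of `A` converging to `c`. -/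
def TwoSidedLimitOf (A : Set Chord) (c : Chord) : Prop :=
  ∀ z ∈ closedDisk \ chordSet c, ∀ ε : ℝ, 0 < ε →
    ∃ d ∈ A, d ≠ c ∧ chordSet d ⊆ connectedComponentIn (closedDisk \ chordSet c) z ∧
      Metric.hausdorffDist (chordSet d) (chordSet c) < ε

/-- The chord `n` weakly separates the chords `ℓ₁` and `ℓ₂`. -/
def WeaklySep (n ℓ₁ ℓ₂ : Chord) : Prop :=
  ∃ z₁ ∈ chordSet ℓ₁ \ chordSet n, ∃ z₂ ∈ chordSet ℓ₂ \ chordSet n,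
    chordSet ℓ₁ \ chordSet n ⊆ connectedComponentIn (closedDisk \ chordSet n) z₁ ∧
    chordSet ℓ₂ \ chordSet n ⊆ connectedComponentIn (closedDisk \ chordSet n) z₂ ∧
    connectedComponentIn (closedDisk \ chordSet n) z₁ ≠
      connectedComponentIn (closedDisk \ chordSet n) z₂

/-- The (non-diameter, non-fixed) chord `ℓ` moves in under the circle map `h`. -/
def MovesIn (h : S1 → S1) (ℓ : Chord) : Prop := cmap h ℓ ≠ ℓ ∧ Under (cmap h ℓ) ℓ

/-- The chord `ℓ` moves out under the circle map `h`. -/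
def MovesOut (h : S1 → S1) (ℓ : Chord) : Prop := cmap h ℓ ≠ ℓ ∧ ¬ Under (cmap h ℓ) ℓ

lemma toC_coe (t : ℝ) :
    toC (t : S1) = ⟨Real.cos (2 * Real.pi * t), Real.sin (2 * Real.pi * t)⟩ := by
  have h : (2 * Real.pi * Complex.I * ((Int.fract t : ℝ) : ℂ)) =
      (2 * Real.pi * Complex.I * (t : ℂ)) - ((⌊t⌋ : ℤ) : ℂ) * (2 * Real.pi * Complex.I) := by
    rw [Int.fract]; push_cast; ring
  have h2 : (2 * Real.pi * Complex.I * (t : ℂ)) = ((2 * Real.pi * t : ℝ) : ℂ) * Complex.I := by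
    push_cast; ring
  unfold toC
  rw [AddCircle.coe_equivIco_mk_apply]
  simp only [div_one, mul_one]
  rw [h, Complex.exp_periodic.sub_int_mul_eq, h2]
  apply Complex.ext
  · exact Complex.exp_ofReal_mul_I_re _
  · exact Complex.exp_ofReal_mul_I_im _

lemma continuous_circPt : Continuous circPt := by
  have : circPt = fun t : ℝ => Complex.exp (((2 * Real.pi * t : ℝ) : ℂ) * Complex.I) := by
    funext t
    rw [circPt, toC_coe]
    apply Complex.ext
    · exact (Complex.exp_ofReal_mul_I_re _).symm
    · exact (Complex.exp_ofReal_mul_I_im _).symm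
  rw [this]
  fun_prop

lemma norm_toC (x : S1) : ‖toC x‖ = 1 := by
  induction x using QuotientAddGroup.induction_on with
  | H t =>
    rw [toC_coe, Complex.norm_def, Complex.normSq_mk]
    rw [← sq, ← sq, Real.cos_sq_add_sin_sq, Real.sqrt_one]

lemma antip_coe (t : ℝ) : antip (t : S1) = ((t + 1/2 : ℝ) : S1) := by
  simp [antip]

lemma s3_coe (t : ℝ) : s3 (t : S1) = ((3 * t : ℝ) : S1) := by
  unfold s3
  rw [← AddCircle.coe_nsmul]
  simp

lemma toC_antip (x : S1) : toC (antip x) = - toC x := by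
  induction x using QuotientAddGroup.induction_on with
  | H t =>
    rw [antip_coe, toC_coe, toC_coe]
    have : 2 * Real.pi * (t + 1/2) = 2 * Real.pi * t + Real.pi := by ring
    rw [this, Real.cos_add_pi, Real.sin_add_pi]
    rfl

lemma coe_eq_iff {x y : ℝ} : (x : S1) = (y : S1) ↔ ∃ n : ℤ, x = y + n := by
  rw [← sub_eq_zero, ← AddCircle.coe_sub, AddCircle.coe_eq_zero_iff]
  simp only [zsmul_eq_mul, mul_one]
  constructor
  · rintro ⟨n, hn⟩; exact ⟨n, by linarith⟩
  · rintro ⟨n, hn⟩; exact ⟨n, by linarith⟩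

lemma coe_add_one (x : ℝ) : ((x + 1 : ℝ) : S1) = (x : S1) :=
  coe_eq_iff.2 ⟨1, by push_cast; ring⟩

lemma coe_ne_of_lt {x y : ℝ} (h : x < y) (h' : y < x + 1) : (x : S1) ≠ (y : S1) := by
  intro e
  obtain ⟨n, hn⟩ := coe_eq_iff.1 e
  have h1 : (n : ℝ) < 0 := by linarith
  have h2 : (-1 : ℝ) < n := by linarith
  have h1' : n < 0 := by exact_mod_cast h1
  have h2' : -1 < n := by exact_mod_cast h2
  omega

lemma exists_lift (x : S1) (a : ℝ) : ∃ t : ℝ, a ≤ t ∧ t < a + 1 ∧ (t : S1) = x := by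
  have : x ∈ ((↑) : ℝ → S1) '' Ico a (a + 1) := by
    rw [AddCircle.coe_image_Ico_eq]; trivial
  obtain ⟨t, ht, rfl⟩ := this
  exact ⟨t, ht.1, ht.2, rfl⟩

lemma exists_lift_Ioo (x : S1) (a : ℝ) (h : (a : S1) ≠ x) :
    ∃ t : ℝ, a < t ∧ t < a + 1 ∧ (t : S1) = x := by
  obtain ⟨t, h1, h2, rfl⟩ := exists_lift x a
  refine ⟨t, lt_of_le_of_ne h1 ?_, h2, rfl⟩
  rintro rfl
  exact h rfl

/-- A nondegenerate leaf, given by lifts of its endpoints to the line. -/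
def Lf (L : Set Chord) (p q : ℝ) : Prop := s((p : S1), (q : S1)) ∈ L ∧ (p : S1) ≠ (q : S1)

lemma Lf.symm {L : Set Chord} {p q : ℝ} (h : Lf L p q) : Lf L q p :=
  ⟨by rw [Sym2.eq_swap]; exact h.1, h.2.symm⟩

lemma Lf.congr {L : Set Chord} {p q p' q' : ℝ} (h : Lf L p q) (hp : (p' : S1) = p)
    (hq : (q' : S1) = q) : Lf L p' q' := by
  unfold Lf; rw [hp, hq]; exact h

/-- No leaf strictly separates two points of `B`. -/
def Unl (L : Set Chord) (B : Set S1) : Prop :=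
  ∀ p x q y : ℝ, Lf L p q → (x : S1) ∈ B → (y : S1) ∈ B →
    p < x → x < q → q < y → y < p + 1 → False

/-- The affine function vanishing on the chord from angle `p` to angle `q`, positive on the
arc `(p, q)`. -/
def sideFn (p q : ℝ) (z : ℂ) : ℝ :=
  z.re * Real.cos (Real.pi * (p + q)) + z.im * Real.sin (Real.pi * (p + q))
    - Real.cos (Real.pi * (q - p))

lemma sideFn_toC (p q x : ℝ) :
    sideFn p q (toC x) = 2 * Real.sin (Real.pi * (x - p)) * Real.sin (Real.pi * (q - x)) := by
  rw [toC_coe, sideFn]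
  simp only
  rw [← Real.cos_sub,
    show Real.pi * (q - p) = Real.pi * (x - p) + Real.pi * (q - x) by ring,
    show 2 * Real.pi * x - Real.pi * (p + q) = Real.pi * (x - p) - Real.pi * (q - x) by ring,
    Real.cos_add, Real.cos_sub]
  ring

lemma continuous_sideFn (p q : ℝ) : Continuous (sideFn p q) := by
  unfold sideFn; fun_prop

lemma sideFn_comb (p q : ℝ) (z w : ℂ) {a b : ℝ} (h : a + b = 1) :
    sideFn p q (a • z + b • w) = a * sideFn p q z + b * sideFn p q w := by
  unfold sideFn
  simp only [Complex.add_re, Complex.add_im, Complex.real_smul, Complex.mul_re, Complex.mul_im,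
    Complex.ofReal_re, Complex.ofReal_im]
  have : b = 1 - a := by linarith
  subst this
  ring

lemma sideFn_pos {p q x : ℝ} (h1 : p < x) (h2 : x < q) (h3 : q < p + 1) :
    0 < sideFn p q (toC x) := by
  rw [sideFn_toC]
  have hpi := Real.pi_pos
  have a := Real.sin_pos_of_pos_of_lt_pi (x := Real.pi * (x - p)) (by apply mul_pos <;> linarith)
    (by nlinarith)
  have b := Real.sin_pos_of_pos_of_lt_pi (x := Real.pi * (q - x)) (by apply mul_pos <;> linarith)
    (by nlinarith)
  positivity

lemma sideFn_neg {p q x : ℝ} (h1 : p < q) (h2 : q < x) (h3 : x < p + 1) :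
    sideFn p q (toC x) < 0 := by
  rw [sideFn_toC]
  have hpi := Real.pi_pos
  have a := Real.sin_pos_of_pos_of_lt_pi (x := Real.pi * (x - p)) (by apply mul_pos <;> linarith)
    (by nlinarith)
  have b := Real.sin_pos_of_pos_of_lt_pi (x := Real.pi * (x - q)) (by apply mul_pos <;> linarith)
    (by nlinarith)
  rw [show Real.pi * (q - x) = -(Real.pi * (x - q)) by ring, Real.sin_neg]
  nlinarith [mul_pos a b]

lemma sideFn_zero_left (p q : ℝ) : sideFn p q (toC p) = 0 := by
  rw [sideFn_toC]; simp

lemma sideFn_zero_right (p q : ℝ) : sideFn p q (toC q) = 0 := by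
  rw [sideFn_toC]; simp

lemma toC_injective : Function.Injective toC := by
  intro x y h
  by_contra hne
  obtain ⟨t, -, -, rfl⟩ := exists_lift x 0
  obtain ⟨u, h1, h2, rfl⟩ := exists_lift_Ioo y t hne
  have h3 := sideFn_pos (p := t) (q := (u + (t + 1)) / 2) (x := u) h1 (by linarith) (by linarith)
  rw [← h, sideFn_zero_left] at h3
  exact lt_irrefl _ h3

/-- Position of a circle point relative to a chord. -/
lemma lift_trichotomy (p q : ℝ) (h1 : p < q) (b : S1) :
    b = (p : S1) ∨ b = (q : S1) ∨ (∃ x : ℝ, (x : S1) = b ∧ p < x ∧ x < q) ∨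
      (∃ x : ℝ, (x : S1) = b ∧ q < x ∧ x < p + 1) := by
  obtain ⟨t, h3, h4, rfl⟩ := exists_lift b p
  rcases h3.eq_or_lt with rfl | h3
  · exact Or.inl rfl
  rcases lt_trichotomy t q with h | rfl | h
  · exact Or.inr (Or.inr (Or.inl ⟨t, rfl, h3, h⟩))
  · exact Or.inr (Or.inl rfl)
  · exact Or.inr (Or.inr (Or.inr ⟨t, rfl, h, h4⟩))

lemma exists_of_sideFn_pos {p q : ℝ} (h1 : p < q) {b : S1}
    (hb : 0 < sideFn p q (toC b)) : ∃ x : ℝ, (x : S1) = b ∧ p < x ∧ x < q := by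
  rcases lift_trichotomy p q h1 b with rfl | rfl | h | ⟨x, rfl, h3, h4⟩
  · rw [sideFn_zero_left] at hb; exact absurd hb (lt_irrefl _)
  · rw [sideFn_zero_right] at hb; exact absurd hb (lt_irrefl _)
  · exact h
  · exact absurd hb (sideFn_neg h1 h3 h4).not_gt

lemma exists_of_sideFn_neg {p q : ℝ} (h1 : p < q) {b : S1}
    (hb : sideFn p q (toC b) < 0) (h2 : q < p + 1) :
    ∃ x : ℝ, (x : S1) = b ∧ q < x ∧ x < p + 1 := by
  rcases lift_trichotomy p q h1 b with rfl | rfl | ⟨x, rfl, h3, h4⟩ | h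
  · rw [sideFn_zero_left] at hb; exact absurd hb (lt_irrefl _)
  · rw [sideFn_zero_right] at hb; exact absurd hb (lt_irrefl _)
  · exact absurd hb (sideFn_pos h3 h4 h2).not_gt
  · exact h

lemma eq_of_sideFn_eq_zero {p q : ℝ} (h1 : p < q) {b : S1}
    (hb : sideFn p q (toC b) = 0) (h2 : q < p + 1) : b = (p : S1) ∨ b = (q : S1) := by
  rcases lift_trichotomy p q h1 b with h | h | ⟨x, rfl, h3, h4⟩ | ⟨x, rfl, h3, h4⟩
  · exact Or.inl h
  · exact Or.inr h
  · exact absurd hb (sideFn_pos h3 h4 h2).ne'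
  · exact absurd hb (sideFn_neg h1 h3 h4).ne

lemma chordSet_mk (a b : S1) : chordSet s(a, b) = segment ℝ (toC a) (toC b) := rfl

lemma mem_segment_of_sideFn_eq_zero {p q : ℝ} (h1 : p < q) (h2 : q < p + 1) {z : ℂ}
    (hz : ‖z‖ ≤ 1) (h : sideFn p q z = 0) : z ∈ segment ℝ (toC (p : S1)) (toC (q : S1)) := by
  have hs : 0 < Real.sin (Real.pi * (q - p)) := by
    have hpi := Real.pi_pos
    exact Real.sin_pos_of_pos_of_lt_pi (by apply mul_pos <;> linarith) (by nlinarith)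
  set c := Real.cos (Real.pi * (p + q)) with hc
  set s := Real.sin (Real.pi * (p + q)) with hs'
  set C := Real.cos (Real.pi * (q - p)) with hC
  set S := Real.sin (Real.pi * (q - p)) with hS
  have hcs : c ^ 2 + s ^ 2 = 1 := Real.cos_sq_add_sin_sq _
  have hCS : C ^ 2 + S ^ 2 = 1 := Real.cos_sq_add_sin_sq _
  have h0 : z.re * c + z.im * s = C := by
    have := h; unfold sideFn at this; linarith
  set b := z.im * c - z.re * s with hb
  have hn : z.re ^ 2 + z.im ^ 2 ≤ 1 := by
    have : ‖z‖ ^ 2 ≤ 1 := by nlinarith [norm_nonneg z]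
    rw [Complex.sq_norm, Complex.normSq_apply] at this
    nlinarith
  have hbS : b ^ 2 ≤ S ^ 2 := by
    have : (z.re * c + z.im * s) ^ 2 + b ^ 2 = (z.re ^ 2 + z.im ^ 2) * (c ^ 2 + s ^ 2) := by
      rw [hb]; ring
    rw [h0, hcs] at this
    nlinarith
  have habs := abs_le_of_sq_le_sq' hbS hs.le
  have hre : z.re = C * c - b * s := by
    rw [← h0, hb]
    have : z.re = z.re * (c ^ 2 + s ^ 2) := by rw [hcs, mul_one]
    nlinarith
  have him : z.im = C * s + b * c := by
    rw [← h0, hb]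
    have : z.im = z.im * (c ^ 2 + s ^ 2) := by rw [hcs, mul_one]
    nlinarith
  have ep : toC (p : S1) = ⟨c * C + s * S, s * C - c * S⟩ := by
    rw [toC_coe]
    rw [show 2 * Real.pi * p = Real.pi * (p + q) - Real.pi * (q - p) by ring, Real.cos_sub,
      Real.sin_sub]
  have eq : toC (q : S1) = ⟨c * C - s * S, s * C + c * S⟩ := by
    rw [toC_coe]
    rw [show 2 * Real.pi * q = Real.pi * (p + q) + Real.pi * (q - p) by ring, Real.cos_add,
      Real.sin_add]
  refine ⟨(1 - b / S) / 2, (1 + b / S) / 2, ?_, ?_, by ring, ?_⟩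
  · have : b / S ≤ 1 := (div_le_one hs).2 habs.2
    linarith
  · have : -1 ≤ b / S := by rw [le_div_iff₀ hs]; linarith
    linarith
  · have hbs : b / S * S = b := div_mul_cancel₀ _ hs.ne'
    rw [ep, eq]
    apply Complex.ext
    · simp only [Complex.add_re, Complex.real_smul, Complex.mul_re, Complex.ofReal_re,
        Complex.ofReal_im]
      rw [hre]; linear_combination (-s) * hbs
    · simp only [Complex.add_im, Complex.real_smul, Complex.mul_im, Complex.ofReal_re,
        Complex.ofReal_im]
      rw [him]; linear_combination (c) * hbs

lemma sideFn_eq_zero_of_mem_segment {p q : ℝ} {z : ℂ}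
    (h : z ∈ segment ℝ (toC (p : S1)) (toC (q : S1))) : sideFn p q z = 0 := by
  obtain ⟨a, b, -, -, hab, rfl⟩ := h
  rw [sideFn_comb p q _ _ hab, sideFn_zero_left, sideFn_zero_right]; simp

lemma convex_sideFn_nonneg (p q : ℝ) : Convex ℝ {z | 0 ≤ sideFn p q z} := by
  intro z hz w hw a b ha hb hab
  simp only [mem_ofPred_eq] at *
  rw [sideFn_comb p q _ _ hab]; positivity

lemma convex_sideFn_nonpos (p q : ℝ) : Convex ℝ {z | sideFn p q z ≤ 0} := by
  intro z hz w hw a b ha hb hab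
  simp only [mem_ofPred_eq] at *
  rw [sideFn_comb p q _ _ hab]
  nlinarith

/-- A nondegenerate chord has lifts `p < q < p + 1`. -/
lemma exists_lifts_of_not_isDiag {ℓ : Chord} (h : ¬ ℓ.IsDiag) :
    ∃ p q : ℝ, p < q ∧ q < p + 1 ∧ ℓ = s((p : S1), (q : S1)) := by
  induction ℓ using Sym2.inductionOn with
  | hf a b =>
    rw [Sym2.mk_isDiag_iff] at h
    obtain ⟨p, -, -, rfl⟩ := exists_lift a 0
    obtain ⟨q, h1, h2, rfl⟩ := exists_lift_Ioo b p h
    exact ⟨p, q, h1, h2, rfl⟩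

lemma not_mem_chordSet_of_isDiag {ℓ : Chord} (h : ℓ.IsDiag) {z : ℂ} (hz : ‖z‖ < 1) :
    z ∉ chordSet ℓ := by
  induction ℓ using Sym2.inductionOn with
  | hf a b =>
    rw [Sym2.mk_isDiag_iff] at h
    subst h
    rw [chordSet_mk, segment_same]
    rintro rfl
    rw [norm_toC] at hz
    exact lt_irrefl _ hz

lemma sideFn_ne_zero_of_mem {L : Set Chord} {p q : ℝ} (h : Lf L p q) (h1 : p < q)
    (h2 : q < p + 1) {z : ℂ} (hz : z ∈ openDisk \ unionSet L) : sideFn p q z ≠ 0 := by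
  intro h0
  apply hz.2
  have hz1 : ‖z‖ < 1 := by simpa [openDisk] using hz.1
  exact mem_biUnion h.1 (mem_segment_of_sideFn_eq_zero h1 h2 hz1.le h0)

/-- A gap lies on one closed side of every leaf. -/
lemma gap_side {L : Set Chord} {G : Set ℂ} (hG : IsGapOf L G) {p q : ℝ} (h : Lf L p q)
    (h1 : p < q) (h2 : q < p + 1) :
    (∀ z ∈ G, 0 ≤ sideFn p q z) ∨ (∀ z ∈ G, sideFn p q z ≤ 0) := by
  obtain ⟨z₀, hz₀, rfl⟩ := hG
  set C := connectedComponentIn (openDisk \ unionSet L) z₀ with hC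
  have hpre : IsPreconnected C := isPreconnected_connectedComponentIn
  have hne : ∀ z ∈ C, sideFn p q z ≠ 0 := fun z hz =>
    sideFn_ne_zero_of_mem h h1 h2 (connectedComponentIn_subset _ _ hz)
  have himg := hpre.image _ (continuous_sideFn p q).continuousOn
  have hcl0 : IsClosed {z | 0 ≤ sideFn p q z} :=
    isClosed_le continuous_const (continuous_sideFn p q)
  have hcl1 : IsClosed {z | sideFn p q z ≤ 0} :=
    isClosed_le (continuous_sideFn p q) continuous_const
  by_cases hex : ∃ z ∈ C, sideFn p q z < 0
  · right
    obtain ⟨w, hw, hw0⟩ := hex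
    have : C ⊆ {z | sideFn p q z ≤ 0} := by
      intro z hz
      by_contra hcon
      simp only [mem_ofPred_eq, not_le] at hcon
      have : (0 : ℝ) ∈ sideFn p q '' C :=
        himg.ordConnected.out ⟨w, hw, rfl⟩ ⟨z, hz, rfl⟩ ⟨hw0.le, hcon.le⟩
      obtain ⟨v, hv, hv0⟩ := this
      exact hne v hv hv0
    intro z hz
    exact closure_minimal this hcl1 hz
  · left
    push Not at hex
    intro z hz
    exact closure_minimal (s := C) (t := {z | 0 ≤ sideFn p q z}) hex hcl0 hz

lemma unl_of_side {L : Set Chord} {B : Set S1}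
    (h : ∀ p q : ℝ, Lf L p q → p < q → q < p + 1 →
      (∀ b ∈ B, 0 ≤ sideFn p q (toC b)) ∨ (∀ b ∈ B, sideFn p q (toC b) ≤ 0)) : Unl L B := by
  intro p x q y hl hx hy h1 h2 h3 h4
  rcases h p q hl (h1.trans h2) (h3.trans h4) with h | h
  · exact absurd (h _ hy) (sideFn_neg (h1.trans h2) h3 h4).not_ge
  · exact absurd (h _ hx) (sideFn_pos h1 h2 (h3.trans h4)).not_ge

lemma Unl.side {L : Set Chord} {B : Set S1} (hB : Unl L B) {p q : ℝ} (h : Lf L p q)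
    (h1 : p < q) (h2 : q < p + 1) :
    (∀ b ∈ B, 0 ≤ sideFn p q (toC b)) ∨ (∀ b ∈ B, sideFn p q (toC b) ≤ 0) := by
  by_contra hcon
  push Not at hcon
  obtain ⟨⟨y, hy, hy0⟩, x, hx, hx0⟩ := hcon
  obtain ⟨u, rfl, hu1, hu2⟩ := exists_of_sideFn_pos h1 hx0
  obtain ⟨v, rfl, hv1, hv2⟩ := exists_of_sideFn_neg h1 hy0 h2
  exact hB p u q v h hx hy hu1 hu2 hv1 hv2

lemma unl_gapVerts {L : Set Chord} {G : Set ℂ} (hG : IsGapOf L G) : Unl L (gapVerts G) := by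
  apply unl_of_side
  intro p q h h1 h2
  rcases gap_side hG h h1 h2 with h | h
  · exact Or.inl fun b hb => h _ hb
  · exact Or.inr fun b hb => h _ hb

/-- The convex hull of an unseparated set lies on one side of each leaf. -/
lemma Unl.hull_side {L : Set Chord} {B : Set S1} (hB : Unl L B) {p q : ℝ} (h : Lf L p q)
    (h1 : p < q) (h2 : q < p + 1) :
    (∀ z ∈ convexHull ℝ (toC '' B), 0 ≤ sideFn p q z) ∨
      (∀ z ∈ convexHull ℝ (toC '' B), sideFn p q z ≤ 0) := by
  rcases hB.side h h1 h2 with h | h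
  · left
    have : convexHull ℝ (toC '' B) ⊆ {z | 0 ≤ sideFn p q z} := by
      apply convexHull_min _ (convex_sideFn_nonneg p q)
      rintro _ ⟨b, hb, rfl⟩
      exact h b hb
    exact fun z hz => this hz
  · right
    have : convexHull ℝ (toC '' B) ⊆ {z | sideFn p q z ≤ 0} := by
      apply convexHull_min _ (convex_sideFn_nonpos p q)
      rintro _ ⟨b, hb, rfl⟩
      exact h b hb
    exact fun z hz => this hz

lemma sideFn_ray (p q : ℝ) (z : ℂ) (r : ℝ) :
    sideFn p q (z + r • (⟨Real.cos (Real.pi * (p + q)), Real.sin (Real.pi * (p + q))⟩ : ℂ)) =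
      sideFn p q z + r := by
  unfold sideFn
  simp only [Complex.add_re, Complex.add_im, Complex.real_smul, Complex.mul_re, Complex.mul_im,
    Complex.ofReal_re, Complex.ofReal_im]
  linear_combination r * Real.cos_sq_add_sin_sq (Real.pi * (p + q))

lemma sideFn_ne_zero_of_mem_interior {p q : ℝ} {X : Set ℂ}
    (hX : (∀ z ∈ X, 0 ≤ sideFn p q z) ∨ (∀ z ∈ X, sideFn p q z ≤ 0)) {z : ℂ}
    (hz : z ∈ interior X) : sideFn p q z ≠ 0 := by
  intro h0
  set u : ℂ := ⟨Real.cos (Real.pi * (p + q)), Real.sin (Real.pi * (p + q))⟩ with hu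
  have hc : Continuous fun r : ℝ => z + r • u := by fun_prop
  have hopen : IsOpen ((fun r : ℝ => z + r • u) ⁻¹' interior X) := isOpen_interior.preimage hc
  obtain ⟨ε, hε, hball⟩ := Metric.isOpen_iff.1 hopen 0 (by simpa using hz)
  have h1 : z + (ε / 2) • u ∈ X := interior_subset (hball (by
    rw [Metric.mem_ball, Real.dist_eq, sub_zero, abs_of_pos (by linarith)]; linarith))
  have h2 : z + (-(ε / 2)) • u ∈ X := interior_subset (hball (by
    rw [Metric.mem_ball, Real.dist_eq, sub_zero, abs_neg, abs_of_pos (by linarith)]; linarith))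
  have e1 := sideFn_ray p q z (ε / 2)
  have e2 := sideFn_ray p q z (-(ε / 2))
  rcases hX with h | h
  · have := h _ h2; rw [← hu] at e2; linarith
  · have := h _ h1; rw [← hu] at e1; linarith

lemma isEdgeOf_of_side {X : Set ℂ} {p q : ℝ} (hne : (p : S1) ≠ q)
    (hX : (∀ z ∈ X, 0 ≤ sideFn p q z) ∨ (∀ z ∈ X, sideFn p q z ≤ 0))
    (hsub : segment ℝ (toC (p : S1)) (toC (q : S1)) ⊆ X) : IsEdgeOf X s((p : S1), (q : S1)) := by
  refine ⟨by rwa [Sym2.mk_isDiag_iff], fun z hz => ⟨subset_closure (hsub hz), fun hi => ?_⟩⟩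
  exact sideFn_ne_zero_of_mem_interior hX hi (sideFn_eq_zero_of_mem_segment hz)

lemma norm_sub_lt_of_segment {p q : ℝ} (hne : (p : S1) ≠ q) :
    ‖(1/2 : ℝ) • toC (p : S1) + (1/2 : ℝ) • toC (q : S1)‖ < 1 := by
  have := (strictConvex_closedBall ℝ (0 : ℂ) 1) (x := toC (p : S1)) (by simp [norm_toC])
    (y := toC (q : S1)) (by simp [norm_toC]) (fun h => hne (toC_injective h))
    (a := 1/2) (b := 1/2) (by norm_num) (by norm_num) (by norm_num)
  rw [interior_closedBall _ one_ne_zero] at this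
  simpa using this

lemma mem_of_isEdgeOf {L : Set Chord} (hL : IsLamination L) {G : Set ℂ} (hG : IsGapOf L G)
    {ℓ : Chord} (h : IsEdgeOf G ℓ) : ℓ ∈ L ∧ ∀ x ∈ ℓ, x ∈ gapVerts G := by
  have hGcl : IsClosed G := by obtain ⟨z, -, rfl⟩ := hG; exact isClosed_closure
  obtain ⟨hdiag, hfr⟩ := h
  obtain ⟨p, q, h1, h2, rfl⟩ := exists_lifts_of_not_isDiag hdiag
  have hpq : (p : S1) ≠ q := by rwa [Sym2.mk_isDiag_iff] at hdiag
  rw [chordSet_mk] at hfr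
  have hsub : segment ℝ (toC (p : S1)) (toC (q : S1)) ⊆ G := fun z hz =>
    hGcl.frontier_subset (hfr hz)
  have hp : toC (p : S1) ∈ G := hsub (left_mem_segment ℝ _ _)
  have hq : toC (q : S1) ∈ G := hsub (right_mem_segment ℝ _ _)
  refine ⟨?_, ?_⟩
  swap
  · intro x hx
    rcases Sym2.mem_iff.1 hx with rfl | rfl
    · exact hp
    · exact hq
  set μ : ℂ := (1/2 : ℝ) • toC (p : S1) + (1/2 : ℝ) • toC (q : S1) with hμ
  have hμseg : μ ∈ segment ℝ (toC (p : S1)) (toC (q : S1)) :=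
    ⟨1/2, 1/2, by norm_num, by norm_num, by norm_num, rfl⟩
  have hμ1 : ‖μ‖ < 1 := norm_sub_lt_of_segment hpq
  have hμU : μ ∈ unionSet L := by
    by_contra hU
    have hmem : μ ∈ openDisk \ unionSet L := ⟨by simpa [openDisk] using hμ1, hU⟩
    have hop : IsOpen (openDisk \ unionSet L) := Metric.isOpen_ball.sdiff hL.closed
    obtain ⟨z, hz, rfl⟩ := hG
    have hμop := hop.connectedComponentIn (x := μ)
    have hμin := mem_connectedComponentIn hmem
    obtain ⟨w, hw1, hw2⟩ := mem_closure_iff.1 (hsub hμseg) _ hμop hμin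
    have e1 := connectedComponentIn_eq hw1
    have e2 := connectedComponentIn_eq hw2
    apply (hfr hμseg).2
    rw [mem_interior]
    refine ⟨_, subset_closure, ?_, ?_⟩
    · rw [e2, ← e1]; exact hμop
    · rw [e2, ← e1]; exact hμin
  rw [unionSet, mem_iUnion₂] at hμU
  obtain ⟨ℓ', hℓ', hμℓ'⟩ := hμU
  have hd' : ¬ ℓ'.IsDiag := fun hd => not_mem_chordSet_of_isDiag hd hμ1 hμℓ'
  obtain ⟨p', q', h1', h2', rfl⟩ := exists_lifts_of_not_isDiag hd'
  have hpq' : (p' : S1) ≠ q' := by rwa [Sym2.mk_isDiag_iff] at hd'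
  rw [chordSet_mk] at hμℓ'
  have h0 := sideFn_eq_zero_of_mem_segment hμℓ'
  rw [hμ, sideFn_comb _ _ _ _ (by norm_num)] at h0
  have hz : sideFn p' q' (toC (p : S1)) = 0 ∧ sideFn p' q' (toC (q : S1)) = 0 := by
    rcases gap_side hG ⟨hℓ', hpq'⟩ h1' h2' with h | h <;>
    · have a := h _ hp
      have b := h _ hq
      constructor <;> linarith
  have a := eq_of_sideFn_eq_zero h1' hz.1 h2'
  have b := eq_of_sideFn_eq_zero h1' hz.2 h2'
  rcases a with a | a <;> rcases b with b | b
  · exact absurd (a.trans b.symm) hpq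
  · rw [a, b]; exact hℓ'
  · rw [a, b, Sym2.eq_swap]; exact hℓ'
  · exact absurd (a.trans b.symm) hpq

lemma interior_hull_nonempty {B : Set S1} {a b c : S1} (ha : a ∈ B) (hb : b ∈ B) (hc : c ∈ B)
    (hab : a ≠ b) (hac : a ≠ c) (hbc : b ≠ c) :
    (interior (convexHull ℝ (toC '' B))).Nonempty := by
  have hcos : EuclideanGeometry.Cospherical ({toC a, toC b, toC c} : Set ℂ) := by
    refine ⟨0, 1, ?_⟩
    intro p hp
    simp only [mem_insert_iff, mem_singleton_iff] at hp
    rcases hp with rfl | rfl | rfl <;> simp [norm_toC]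
  have hind := hcos.affineIndependent_of_ne (fun h => hab (toC_injective h))
    (fun h => hac (toC_injective h)) (fun h => hbc (toC_injective h))
  have htop : affineSpan ℝ (Set.range ![toC a, toC b, toC c]) = ⊤ := by
    rw [hind.affineSpan_eq_top_iff_card_eq_finrank_add_one]
    simp
  rw [interior_convexHull_nonempty_iff_affineSpan_eq_top]
  apply top_unique
  rw [← htop]
  apply affineSpan_mono
  rintro _ ⟨i, rfl⟩
  fin_cases i
  · exact ⟨a, ha, rfl⟩
  · exact ⟨b, hb, rfl⟩
  · exact ⟨c, hc, rfl⟩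

/-- An unseparated set with at least three points spans part of a gap. -/
lemma Unl.exists_gap {L : Set Chord} {B : Set S1} (hB : Unl L B) {a b c : S1} (ha : a ∈ B)
    (hb : b ∈ B) (hc : c ∈ B) (hab : a ≠ b) (hac : a ≠ c) (hbc : b ≠ c) :
    ∃ G, IsGapOf L G ∧ convexHull ℝ (toC '' B) ⊆ G := by
  obtain ⟨z, hz⟩ := interior_hull_nonempty ha hb hc hab hac hbc
  set K := convexHull ℝ (toC '' B) with hK
  have hcK : Convex ℝ K := convex_convexHull ℝ _
  have hball : interior K ⊆ openDisk := by
    have : K ⊆ Metric.closedBall 0 1 := by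
      apply convexHull_min _ (convex_closedBall _ _)
      rintro _ ⟨b, -, rfl⟩
      simp [norm_toC]
    have h2 := interior_mono this
    rwa [interior_closedBall _ one_ne_zero] at h2
  have hmiss : interior K ⊆ openDisk \ unionSet L := by
    intro w hw
    refine ⟨hball hw, fun hU => ?_⟩
    rw [unionSet, mem_iUnion₂] at hU
    obtain ⟨ℓ, hℓ, hwℓ⟩ := hU
    have hw1 : ‖w‖ < 1 := by simpa [openDisk] using hball hw
    have hd : ¬ ℓ.IsDiag := fun hd => not_mem_chordSet_of_isDiag hd hw1 hwℓ
    obtain ⟨p, q, h1, h2, rfl⟩ := exists_lifts_of_not_isDiag hd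
    rw [Sym2.mk_isDiag_iff] at hd
    exact sideFn_ne_zero_of_mem_interior (hB.hull_side ⟨hℓ, hd⟩ h1 h2) hw
      (sideFn_eq_zero_of_mem_segment hwℓ)
  refine ⟨_, ⟨z, hmiss hz, rfl⟩, ?_⟩
  have hpre : IsPreconnected (interior K) := hcK.interior.isPreconnected
  have h3 := closure_mono (hpre.subset_connectedComponentIn hz hmiss)
  rw [hcK.closure_interior_eq_closure_of_nonempty_interior ⟨z, hz⟩] at h3
  exact subset_closure.trans h3

lemma subset_gapVerts {B : Set S1} {G : Set ℂ} (h : convexHull ℝ (toC '' B) ⊆ G) :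
    B ⊆ gapVerts G := fun b hb => h (subset_convexHull ℝ _ ⟨b, hb, rfl⟩)

lemma segment_subset_hull {B : Set S1} {a b : S1} (ha : a ∈ B) (hb : b ∈ B) :
    segment ℝ (toC a) (toC b) ⊆ convexHull ℝ (toC '' B) :=
  (convex_convexHull ℝ _).segment_subset (subset_convexHull ℝ _ ⟨a, ha, rfl⟩)
    (subset_convexHull ℝ _ ⟨b, hb, rfl⟩)

lemma isEdgeOf_gap {L : Set Chord} {G : Set ℂ} (hG : IsGapOf L G) {B : Set S1}
    (h : convexHull ℝ (toC '' B) ⊆ G) {ℓ : Chord} (hℓ : ℓ ∈ L) (hd : ¬ ℓ.IsDiag)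
    (hv : ∀ x ∈ ℓ, x ∈ B) : IsEdgeOf G ℓ := by
  obtain ⟨p, q, h1, h2, rfl⟩ := exists_lifts_of_not_isDiag hd
  have hpq : (p : S1) ≠ q := by rwa [Sym2.mk_isDiag_iff] at hd
  exact isEdgeOf_of_side hpq (gap_side hG ⟨hℓ, hpq⟩ h1 h2)
    ((segment_subset_hull (hv _ (Sym2.mem_mk_left _ _)) (hv _ (Sym2.mem_mk_right _ _))).trans h)

lemma Unl.isEdgeOf_hull {L : Set Chord} {B : Set S1} (hB : Unl L B) {ℓ : Chord} (hℓ : ℓ ∈ L)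
    (hd : ¬ ℓ.IsDiag) (hv : ∀ x ∈ ℓ, x ∈ B) : IsEdgeOf (convexHull ℝ (toC '' B)) ℓ := by
  obtain ⟨p, q, h1, h2, rfl⟩ := exists_lifts_of_not_isDiag hd
  have hpq : (p : S1) ≠ q := by rwa [Sym2.mk_isDiag_iff] at hd
  exact isEdgeOf_of_side hpq (hB.hull_side ⟨hℓ, hpq⟩ h1 h2)
    (segment_subset_hull (hv _ (Sym2.mem_mk_left _ _)) (hv _ (Sym2.mem_mk_right _ _)))

lemma Lf.noX {L : Set Chord} (hL : IsLamination L) {p q x y : ℝ} (h : Lf L p q) (h' : Lf L x y)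
    (h1 : p < x) (h2 : x < q) (h3 : q < y) (h4 : y < p + 1) : False :=
  hL.nocross _ h.1 _ h'.1 (Or.inl ⟨p, x, q, y, h1, h2, h3, h4, rfl, rfl⟩)

lemma unl_leaf {L : Set Chord} (hL : IsLamination L) {ℓ : Chord} (hℓ : ℓ ∈ L) :
    Unl L {x | x ∈ ℓ} := by
  intro p x q y hl hx hy h1 h2 h3 h4
  have hne : (x : S1) ≠ y := coe_ne_of_lt (by linarith) (by linarith)
  have : ℓ = s((x : S1), (y : S1)) := (Sym2.mem_and_mem_iff hne).1 ⟨hx, hy⟩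
  subst this
  exact hl.noX hL ⟨hℓ, hne⟩ h1 h2 h3 h4

/-- Two leaves without a common endpoint are disjoint. -/
lemma disjoint_chordSet {L : Set Chord} (hL : IsLamination L) {ℓ ℓ' : Chord} (h : ℓ ∈ L)
    (h' : ℓ' ∈ L) (hd : ¬ ℓ.IsDiag) (hn : ∀ x ∈ ℓ, x ∉ ℓ') :
    Disjoint (chordSet ℓ) (chordSet ℓ') := by
  obtain ⟨p, q, h1, h2, rfl⟩ := exists_lifts_of_not_isDiag hd
  rw [Sym2.mk_isDiag_iff] at hd
  rw [Set.disjoint_left]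
  intro z hz hz'
  have h0 := sideFn_eq_zero_of_mem_segment hz
  have hs := (unl_leaf hL h').side ⟨h, hd⟩ h1 h2
  induction ℓ' using Sym2.inductionOn with
  | hf a b =>
    have hz0 : ∀ c ∈ s(a, b), sideFn p q (toC c) ≠ 0 := by
      intro c hc h0
      rcases eq_of_sideFn_eq_zero h1 h0 h2 with rfl | rfl
      · exact hn _ (Sym2.mem_mk_left _ _) hc
      · exact hn _ (Sym2.mem_mk_right _ _) hc
    have ha := hz0 a (Sym2.mem_mk_left _ _)
    have hb := hz0 b (Sym2.mem_mk_right _ _)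
    obtain ⟨r, s, hr, hs', hrs, rfl⟩ := hz'
    rw [sideFn_comb _ _ _ _ hrs] at h0
    have key : ∀ A B : ℝ, 0 < A → 0 < B → r * A + s * B ≠ 0 := by
      intro A B hA hB e
      have h5 : r * A = 0 := by nlinarith [mul_nonneg hr hA.le, mul_nonneg hs' hB.le]
      have h6 : s * B = 0 := by nlinarith [mul_nonneg hr hA.le, mul_nonneg hs' hB.le]
      have h7 := (mul_eq_zero.1 h5).resolve_right hA.ne'
      have h8 := (mul_eq_zero.1 h6).resolve_right hB.ne'
      linarith
    rcases hs with hs | hs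
    · have h3 := lt_of_le_of_ne (hs a (Sym2.mem_mk_left _ _)) ha.symm
      have h4 := lt_of_le_of_ne (hs b (Sym2.mem_mk_right _ _)) hb.symm
      exact key _ _ h3 h4 h0
    · have h3 := lt_of_le_of_ne (hs a (Sym2.mem_mk_left _ _)) ha
      have h4 := lt_of_le_of_ne (hs b (Sym2.mem_mk_right _ _)) hb
      exact key _ _ (neg_pos.2 h3) (neg_pos.2 h4) (by linarith)

lemma not_mem_of_disjoint_chordSet {ℓ ℓ' : Chord} (h : Disjoint (chordSet ℓ) (chordSet ℓ'))
    {x : S1} (hx : x ∈ ℓ) : x ∉ ℓ' := by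
  have key : ∀ m : Chord, x ∈ m → toC x ∈ chordSet m := by
    intro m hm
    obtain ⟨y, rfl⟩ := hm
    rw [chordSet_mk]; exact left_mem_segment ℝ _ _
  intro hx'
  exact Set.disjoint_left.1 h (key _ hx) (key _ hx')

/-- Limits of leaves are leaves. -/
lemma Lf.of_approx {L : Set Chord} (hL : IsLamination L) {p q : ℝ} (hpq : (p : S1) ≠ q)
    (h : ∀ ε > 0, ∃ p' q' : ℝ, Lf L p' q' ∧ |p' - p| < ε ∧ |q' - q| < ε) : Lf L p q := by
  set mid : ℝ × ℝ → ℂ := fun t =>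
    (1/2 : ℝ) • toC ((t.1 : ℝ) : S1) + (1/2 : ℝ) • toC ((t.2 : ℝ) : S1) with hmid
  have hcont : Continuous mid := by
    have h1 : Continuous fun t : ℝ × ℝ => circPt t.1 := continuous_circPt.comp continuous_fst
    have h2 : Continuous fun t : ℝ × ℝ => circPt t.2 := continuous_circPt.comp continuous_snd
    exact (h1.const_smul (1/2 : ℝ)).add (h2.const_smul (1/2 : ℝ))
  have hcl : (p, q) ∈ closure {t : ℝ × ℝ | Lf L t.1 t.2} := by
    rw [Metric.mem_closure_iff]
    intro ε hε
    obtain ⟨p', q', hl, h1, h2⟩ := h ε hε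
    refine ⟨(p', q'), hl, ?_⟩
    rw [Prod.dist_eq, max_lt_iff, Real.dist_eq, Real.dist_eq, abs_sub_comm p, abs_sub_comm q]
    exact ⟨h1, h2⟩
  have hμU : mid (p, q) ∈ unionSet L := by
    have h1 : {t : ℝ × ℝ | Lf L t.1 t.2} ⊆ mid ⁻¹' unionSet L := by
      rintro ⟨a, b⟩ hab
      refine mem_biUnion hab.1 ?_
      exact ⟨1/2, 1/2, by norm_num, by norm_num, by norm_num, rfl⟩
    exact closure_minimal h1 (hL.closed.preimage hcont) hcl
  have hμ1 : ‖mid (p, q)‖ < 1 := norm_sub_lt_of_segment hpq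
  rw [unionSet, mem_iUnion₂] at hμU
  obtain ⟨ℓ', hℓ', hμℓ'⟩ := hμU
  have hd' : ¬ ℓ'.IsDiag := fun hd => not_mem_chordSet_of_isDiag hd hμ1 hμℓ'
  obtain ⟨p', q', h1', h2', rfl⟩ := exists_lifts_of_not_isDiag hd'
  have hpq' : (p' : S1) ≠ q' := by rwa [Sym2.mk_isDiag_iff] at hd'
  have h0 : sideFn p' q' (mid (p, q)) = 0 := sideFn_eq_zero_of_mem_segment hμℓ'
  simp only [hmid] at h0
  rw [sideFn_comb _ _ _ _ (by norm_num)] at h0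
  by_cases hz : sideFn p' q' (toC (p : S1)) = 0
  · have hz2 : sideFn p' q' (toC (q : S1)) = 0 := by rw [hz] at h0; linarith
    refine ⟨?_, hpq⟩
    have a := eq_of_sideFn_eq_zero h1' hz h2'
    have b := eq_of_sideFn_eq_zero h1' hz2 h2'
    rcases a with a | a <;> rcases b with b | b
    · exact absurd (a.trans b.symm) hpq
    · rw [a, b]; exact hℓ'
    · rw [a, b, Sym2.eq_swap]; exact hℓ'
    · exact absurd (a.trans b.symm) hpq
  · exfalso
    set prd : ℝ × ℝ → ℝ := fun t =>
      sideFn p' q' (toC ((t.1 : ℝ) : S1)) * sideFn p' q' (toC ((t.2 : ℝ) : S1)) with hprd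
    have hpc : Continuous prd := by
      have h1 : Continuous fun t : ℝ × ℝ => circPt t.1 := continuous_circPt.comp continuous_fst
      have h2 : Continuous fun t : ℝ × ℝ => circPt t.2 := continuous_circPt.comp continuous_snd
      exact ((continuous_sideFn p' q').comp h1).mul ((continuous_sideFn p' q').comp h2)
    have hneg : prd (p, q) < 0 := by
      simp only [hprd]
      have : sideFn p' q' (toC (q : S1)) = - sideFn p' q' (toC (p : S1)) := by linarith
      rw [this]
      have := mul_self_pos.2 hz
      linarith
    have hsub : {t : ℝ × ℝ | Lf L t.1 t.2} ⊆ {t | 0 ≤ prd t} := by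
      rintro ⟨a, b⟩ hab
      rcases (unl_leaf hL hab.1).side ⟨hℓ', hpq'⟩ h1' h2' with h | h
      · exact mul_nonneg (h _ (Sym2.mem_mk_left _ _)) (h _ (Sym2.mem_mk_right _ _))
      · exact mul_nonneg_of_nonpos_of_nonpos (h _ (Sym2.mem_mk_left _ _))
          (h _ (Sym2.mem_mk_right _ _))
    have := closure_minimal hsub (isClosed_le continuous_const hpc) hcl
    exact absurd this (not_le.2 hneg)

lemma antip_antip (x : S1) : antip (antip x) = x := by
  obtain ⟨t, -, -, rfl⟩ := exists_lift x 0
  rw [antip_coe, antip_coe]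
  exact coe_eq_iff.2 ⟨1, by push_cast; ring⟩

lemma neg_image_unionSet {L : Set Chord} (hL : IsCubicSymLam L) :
    (fun z : ℂ => -z) '' unionSet L = unionSet L := by
  have key : ∀ z ∈ unionSet L, -z ∈ unionSet L := by
    intro z hz
    rw [unionSet, mem_iUnion₂] at hz
    obtain ⟨ℓ, hℓ, hz⟩ := hz
    refine mem_biUnion (hL.symm ℓ hℓ) ?_
    induction ℓ using Sym2.inductionOn with
    | hf a b =>
      obtain ⟨r, s, hr, hs, hrs, rfl⟩ := hz
      refine ⟨r, s, hr, hs, hrs, ?_⟩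
      change r • toC (antip a) + s • toC (antip b) = -(r • toC a + s • toC b)
      rw [toC_antip, toC_antip, smul_neg, smul_neg, neg_add]
  ext z
  constructor
  · rintro ⟨w, hw, rfl⟩; exact key w hw
  · intro hz; exact ⟨-z, key z hz, neg_neg z⟩

lemma isGapOf_neg {L : Set Chord} (hL : IsCubicSymLam L) {G : Set ℂ} (hG : IsGapOf L G) :
    IsGapOf L ((fun z : ℂ => -z) '' G) := by
  obtain ⟨z, hz, rfl⟩ := hG
  have hU : (Homeomorph.neg ℂ) '' (openDisk \ unionSet L) = openDisk \ unionSet L := by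
    have e1 : (Homeomorph.neg ℂ : ℂ → ℂ) = fun z => -z := rfl
    rw [e1, Set.image_sdiff neg_injective, neg_image_unionSet hL]
    congr 1
    ext w
    simp only [openDisk, mem_image, mem_ball_zero_iff]
    constructor
    · rintro ⟨v, hv, rfl⟩; simpa using hv
    · intro h; exact ⟨-w, by simpa using h, neg_neg w⟩
  refine ⟨-z, ?_, ?_⟩
  · rw [← hU]; exact ⟨z, hz, rfl⟩
  · have h1 := (Homeomorph.neg ℂ).image_connectedComponentIn hz
    rw [hU] at h1
    have h2 := (Homeomorph.neg ℂ).image_closure (connectedComponentIn (openDisk \ unionSet L) z)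
    rw [h1] at h2
    exact h2

lemma iterate_mem_gapVerts {G : Set ℂ} (n : ℕ) {x : S1} (hx : x ∈ gapVerts G) :
    s3^[n] x ∈ gapVerts (gapIter n G) := by
  induction n with
  | zero => exact hx
  | succ n ih =>
    rw [Function.iterate_succ_apply']
    have : gapIter (n + 1) G = gapImage (gapIter n G) := by
      unfold gapIter; rw [Function.iterate_succ_apply']
    rw [this]
    exact subset_convexHull ℝ _ ⟨_, ⟨_, ih, rfl⟩, rfl⟩

lemma coe_three_eq_iff {x y : ℝ} : ((3 * x : ℝ) : S1) = ((3 * y : ℝ) : S1) ↔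
    (x : S1) = y ∨ (x : S1) = ((y + 1/3 : ℝ) : S1) ∨ (x : S1) = ((y + 2/3 : ℝ) : S1) := by
  constructor
  · intro h
    obtain ⟨n, hn⟩ := coe_eq_iff.1 h
    have h3 : n % 3 = 0 ∨ n % 3 = 1 ∨ n % 3 = 2 := by omega
    have h4 : ((n : ℤ) : ℝ) = 3 * ((n / 3 : ℤ) : ℝ) + ((n % 3 : ℤ) : ℝ) := by
      exact_mod_cast (Int.mul_ediv_add_emod n 3).symm
    rcases h3 with h3 | h3 | h3 <;> rw [h3] at h4
    · exact Or.inl (coe_eq_iff.2 ⟨n / 3, by push_cast at h4 ⊢; linarith⟩)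
    · exact Or.inr (Or.inl (coe_eq_iff.2 ⟨n / 3, by push_cast at h4 ⊢; linarith⟩))
    · exact Or.inr (Or.inr (coe_eq_iff.2 ⟨n / 3, by push_cast at h4 ⊢; linarith⟩))
  · rintro (h | h | h) <;> obtain ⟨n, hn⟩ := coe_eq_iff.1 h
    · exact coe_eq_iff.2 ⟨3 * n, by push_cast; linarith⟩
    · exact coe_eq_iff.2 ⟨3 * n + 1, by push_cast; linarith⟩
    · exact coe_eq_iff.2 ⟨3 * n + 2, by push_cast; linarith⟩

lemma cmap_mk (f : S1 → S1) (a b : S1) : cmap f s(a, b) = s(f a, f b) := rfl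

lemma Lf.three {L : Set Chord} (hL : IsInvLam L) {p q : ℝ} (h : Lf L p q)
    (hn : ((3 * p : ℝ) : S1) ≠ ((3 * q : ℝ) : S1)) : Lf L (3 * p) (3 * q) := by
  refine ⟨?_, hn⟩
  have := hL.forward _ h.1
  rw [cmap_mk, s3_coe, s3_coe, Sym2.mk_isDiag_iff] at this
  exact this.resolve_right hn

lemma Lf.half {L : Set Chord} (hL : IsCubicSymLam L) {p q : ℝ} (h : Lf L p q) :
    Lf L (p + 1/2) (q + 1/2) := by
  have := hL.symm _ h.1
  rw [cmap_mk, antip_coe, antip_coe] at this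
  refine ⟨this, fun e => h.2 ?_⟩
  have := congrArg antip e
  rwa [← antip_coe, ← antip_coe, antip_antip, antip_antip] at this

lemma Lf.back {L : Set Chord} (hL : IsInvLam L) {p q : ℝ} (h : Lf L p q) :
    ∃ p' q' : ℝ, Lf L p' q' ∧ ((3 * p' : ℝ) : S1) = p ∧ ((3 * q' : ℝ) : S1) = q := by
  obtain ⟨ℓ, hℓ, he⟩ := hL.backward _ h.1
  have hd : ¬ ℓ.IsDiag := by
    intro hd
    apply h.2
    rw [← Sym2.mk_isDiag_iff, ← he]
    induction ℓ using Sym2.inductionOn with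
    | hf a b => rw [Sym2.mk_isDiag_iff] at hd; subst hd; rw [cmap_mk, Sym2.mk_isDiag_iff]
  obtain ⟨p', q', -, -, rfl⟩ := exists_lifts_of_not_isDiag hd
  rw [Sym2.mk_isDiag_iff] at hd
  rw [cmap_mk, s3_coe, s3_coe, Sym2.eq_iff] at he
  rcases he with he | he
  · exact ⟨p', q', ⟨hℓ, hd⟩, he⟩
  · exact ⟨q', p', Lf.symm ⟨hℓ, hd⟩, he.2, he.1⟩

lemma exists_of_cmap_eq {ℓ : Chord} {p q : ℝ}
    (h : cmap s3 ℓ = cmap s3 s((p : S1), (q : S1))) :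
    ∃ a b : ℝ, ℓ = s((a : S1), (b : S1)) ∧ ((3 * a : ℝ) : S1) = ((3 * p : ℝ) : S1) ∧
      ((3 * b : ℝ) : S1) = ((3 * q : ℝ) : S1) := by
  induction ℓ using Sym2.inductionOn with
  | hf a b =>
    obtain ⟨a, -, -, rfl⟩ := exists_lift a 0
    obtain ⟨b, -, -, rfl⟩ := exists_lift b 0
    simp only [cmap_mk, s3_coe, Sym2.eq_iff] at h
    rcases h with h | h
    · exact ⟨a, b, rfl, h⟩
    · exact ⟨b, a, Sym2.eq_swap, h.2, h.1⟩

/-- The siblings of a leaf: they are obtained from it by rotations by `1/3`, or form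
the crossed pattern. -/
lemma Lf.sib {L : Set Chord} (hL : IsInvLam L) {p q : ℝ} (h : Lf L p q)
    (hn : ((3 * p : ℝ) : S1) ≠ ((3 * q : ℝ) : S1)) :
    (Lf L (p + 1/3) (q + 1/3) ∧ Lf L (p + 2/3) (q + 2/3)) ∨
      (Lf L (p + 1/3) (q + 2/3) ∧ Lf L (p + 2/3) (q + 1/3)) := by
  obtain ⟨ℓ₂, h2, ℓ₃, h3, d12, d13, d23, -, e2, e3⟩ := hL.siblings _ h.1 (by
    rw [cmap_mk, s3_coe, s3_coe, Sym2.mk_isDiag_iff]; exact hn)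
  obtain ⟨a, b, rfl, ha, hb⟩ := exists_of_cmap_eq e2
  obtain ⟨c, d, rfl, hc, hd⟩ := exists_of_cmap_eq e3
  have hab : (a : S1) ≠ b := by
    rintro e; apply hn; rw [← ha, ← hb, ← s3_coe, e, s3_coe]
  have hcd : (c : S1) ≠ d := by
    rintro e; apply hn; rw [← hc, ← hd, ← s3_coe, e, s3_coe]
  have m12 := fun x hx => not_mem_of_disjoint_chordSet d12 (x := x) hx
  have m13 := fun x hx => not_mem_of_disjoint_chordSet d13 (x := x) hx
  have m23 := fun x hx => not_mem_of_disjoint_chordSet d23 (x := x) hx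
  simp only [Sym2.mem_iff, forall_eq_or_imp, forall_eq, not_or] at m12 m13 m23
  have ha' := (coe_three_eq_iff.1 ha).resolve_left (Ne.symm m12.1.1)
  have hb' := (coe_three_eq_iff.1 hb).resolve_left (Ne.symm m12.2.2)
  have hc' := (coe_three_eq_iff.1 hc).resolve_left (Ne.symm m13.1.1)
  have hd' := (coe_three_eq_iff.1 hd).resolve_left (Ne.symm m13.2.2)
  have lab : Lf L a b := ⟨h2, hab⟩
  have lcd : Lf L c d := ⟨h3, hcd⟩
  have hac := m23.1.1
  have hbd := m23.2.2
  rcases ha' with ha' | ha' <;> rcases hb' with hb' | hb' <;> rcases hc' with hc' | hc' <;>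
    rcases hd' with hd' | hd' <;>
    first
    | exact absurd (ha'.trans hc'.symm) hac
    | exact absurd (hb'.trans hd'.symm) hbd
    | exact Or.inl ⟨lab.congr ha'.symm hb'.symm, lcd.congr hc'.symm hd'.symm⟩
    | exact Or.inl ⟨lcd.congr hc'.symm hd'.symm, lab.congr ha'.symm hb'.symm⟩
    | exact Or.inr ⟨lab.congr ha'.symm hb'.symm, lcd.congr hc'.symm hd'.symm⟩
    | exact Or.inr ⟨lcd.congr hc'.symm hd'.symm, lab.congr ha'.symm hb'.symm⟩

/-- Matching patterns between the `s3`-preimages of the endpoints of a leaf. -/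
lemma Lf.sib_perm {L : Set Chord} (hL : IsInvLam L) {p q a b : ℝ} (h : Lf L a b)
    (ha : ((3 * a : ℝ) : S1) = ((3 * p : ℝ) : S1)) (hb : ((3 * b : ℝ) : S1) = ((3 * q : ℝ) : S1))
    (hn : ((3 * p : ℝ) : S1) ≠ ((3 * q : ℝ) : S1)) :
    (Lf L p q ∧ Lf L (p + 1/3) (q + 1/3) ∧ Lf L (p + 2/3) (q + 2/3)) ∨
    (Lf L p (q + 1/3) ∧ Lf L (p + 1/3) (q + 2/3) ∧ Lf L (p + 2/3) q) ∨
    (Lf L p (q + 2/3) ∧ Lf L (p + 1/3) q ∧ Lf L (p + 2/3) (q + 1/3)) ∨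
    (Lf L p q ∧ Lf L (p + 1/3) (q + 2/3) ∧ Lf L (p + 2/3) (q + 1/3)) ∨
    (Lf L p (q + 1/3) ∧ Lf L (p + 1/3) q ∧ Lf L (p + 2/3) (q + 2/3)) ∨
    (Lf L p (q + 2/3) ∧ Lf L (p + 1/3) (q + 1/3) ∧ Lf L (p + 2/3) q) := by
  obtain ⟨P, hP⟩ : ∃ P : S1 → S1 → Prop, ∀ a b : ℝ, Lf L a b ↔ P a b :=
    ⟨fun u v => s(u, v) ∈ L ∧ u ≠ v, fun _ _ => Iff.rfl⟩
  have e0 : ∀ x : ℝ, ((x + 1/3 + 2/3 : ℝ) : S1) = x := fun x =>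
    coe_eq_iff.2 ⟨1, by push_cast; ring⟩
  have e1 : ∀ x : ℝ, ((x + 2/3 + 1/3 : ℝ) : S1) = x := fun x =>
    coe_eq_iff.2 ⟨1, by push_cast; ring⟩
  have e2 : ∀ x : ℝ, ((x + 2/3 + 2/3 : ℝ) : S1) = ((x + 1/3 : ℝ) : S1) := fun x =>
    coe_eq_iff.2 ⟨1, by push_cast; ring⟩
  have e3 : ∀ x : ℝ, ((x + 1/3 + 1/3 : ℝ) : S1) = ((x + 2/3 : ℝ) : S1) := fun x =>
    coe_eq_iff.2 ⟨0, by push_cast; ring⟩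
  have key : ∀ a b : ℝ, Lf L a b → ((3 * a : ℝ) : S1) = ((3 * p : ℝ) : S1) →
      ((3 * b : ℝ) : S1) = ((3 * q : ℝ) : S1) →
      (Lf L (a + 1/3) (b + 1/3) ∧ Lf L (a + 2/3) (b + 2/3)) ∨
      (Lf L (a + 1/3) (b + 2/3) ∧ Lf L (a + 2/3) (b + 1/3)) := fun a b h ha hb =>
    h.sib hL (by rw [ha, hb]; exact hn)
  have f1 : ∀ x : ℝ, ((3 * (x + 1/3) : ℝ) : S1) = ((3 * x : ℝ) : S1) := fun x =>
    coe_eq_iff.2 ⟨1, by push_cast; ring⟩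
  have f2 : ∀ x : ℝ, ((3 * (x + 2/3) : ℝ) : S1) = ((3 * x : ℝ) : S1) := fun x =>
    coe_eq_iff.2 ⟨2, by push_cast; ring⟩
  rcases coe_three_eq_iff.1 ha with ha | ha | ha <;> rcases coe_three_eq_iff.1 hb with hb | hb | hb
  all_goals
    have h' := h.congr ha.symm hb.symm
    have h'' := key _ _ h' (by simp only [f1, f2]) (by simp only [f1, f2])
    simp only [hP, e0, e1, e2, e3] at h' h'' ⊢
    rcases h'' with ⟨u, v⟩ | ⟨u, v⟩ <;> simp only [h', u, v, and_self, true_or, or_true]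

lemma Unl.iff_of_leaf {L : Set Chord} {B : Set S1} (hB : Unl L B) {p q x y : ℝ}
    (h : Lf L p q) (hx : (x : S1) ∈ B) (hy : (y : S1) ∈ B)
    (hp : x < p) (hp' : p < x + 1) (hq : x < q) (hq' : q < x + 1) (hyp : p ≠ y) (hyq : q ≠ y) : p < y ↔ q < y := by
  constructor
  · intro h1
    by_contra h2
    have h3 : y < q := lt_of_le_of_ne (not_lt.1 h2) hyq.symm
    exact hB p y q (x + 1) h hy (by rw [coe_add_one]; exact hx) h1 h3 hq' (by linarith)
  · intro h1
    by_contra h2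
    have h3 : y < p := lt_of_le_of_ne (not_lt.1 h2) hyp.symm
    exact hB q y p (x + 1) h.symm hy (by rw [coe_add_one]; exact hx) h1 h3 hp' (by linarith)

lemma iff_of_perm {a b c a' b' c' : Prop} (h1 : b → a) (h2 : c → b) (h1' : b' → a')
    (h2' : c' → b')
    (h : ((a ↔ b') ∧ (b ↔ c') ∧ (c ↔ a')) ∨ ((a ↔ c') ∧ (b ↔ a') ∧ (c ↔ b')) ∨
      ((a ↔ a') ∧ (b ↔ c') ∧ (c ↔ b')) ∨ ((a ↔ b') ∧ (b ↔ a') ∧ (c ↔ c')) ∨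
      ((a ↔ c') ∧ (b ↔ b') ∧ (c ↔ a'))) : (a ↔ a') ∧ (b ↔ b') ∧ (c ↔ c') := by
  grind

/-- Forward images of unseparated sets are unseparated. -/
lemma Unl.image {L : Set Chord} (hL : IsInvLam L) {B : Set S1} (hB : Unl L B) :
    Unl L (s3 '' B) := by
  intro P X' Q Y' hl hX hY h1 h2 h3 h4
  obtain ⟨x, hx, hxX⟩ := hX
  obtain ⟨y, hy, hyY⟩ := hY
  obtain ⟨X, -, -, rfl⟩ := exists_lift x 0
  obtain ⟨Y, hXY, hYX, rfl⟩ := exists_lift y X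
  rw [s3_coe] at hxX hyY
  obtain ⟨n, hn⟩ := coe_eq_iff.1 hxX
  obtain ⟨m, hm⟩ := coe_eq_iff.1 hyY
  have hnm : n ≤ m := by
    have : (n : ℝ) < m + 1 := by linarith
    have : n < m + 1 := by exact_mod_cast this
    omega
  have hmn : m ≤ n + 2 := by
    have : (m : ℝ) < n + 3 := by linarith
    have : m < n + 3 := by exact_mod_cast this
    omega
  have hXY' : X < Y := by
    rcases hXY.eq_or_lt with e | e
    · exfalso
      have : ((m : ℤ) : ℝ) < n := by rw [← e] at hm; linarith
      have : m < n := by exact_mod_cast this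
      omega
    · exact e
  obtain ⟨p', q', hl', hp', hq'⟩ := hl.back hL
  set p := (P + n + 1) / 3 with hp
  set q := (Q + n) / 3 with hq
  have ep : ((3 * p : ℝ) : S1) = (P : S1) := coe_eq_iff.2 ⟨n + 1, by rw [hp]; push_cast; ring⟩
  have eq : ((3 * q : ℝ) : S1) = (Q : S1) := coe_eq_iff.2 ⟨n, by rw [hq]; ring⟩
  have hperm := hl'.sib_perm hL (hp'.trans ep.symm) (hq'.trans eq.symm) (by
    rw [ep, eq]; exact hl.2)
  have bp : X < p ∧ p < X + 1/3 := by constructor <;> linarith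
  have bq : X < q ∧ q < X + 1/3 := by constructor <;> linarith
  have hne : ∀ k : ℤ, p + k / 3 ≠ Y ∧ q + k / 3 ≠ Y := by
    intro k
    constructor
    · intro e
      have a1 : ((k : ℤ) : ℝ) + n + 1 < m + 1 := by linarith
      have a2 : (m : ℝ) < k + n + 1 := by linarith
      have a1' : k + n + 1 < m + 1 := by exact_mod_cast a1
      have a2' : m < k + n + 1 := by exact_mod_cast a2
      omega
    · intro e
      have a1 : ((k : ℤ) : ℝ) + n < m + 1 := by linarith
      have a2 : (m : ℝ) < k + n := by linarith
      have a1' : k + n < m + 1 := by exact_mod_cast a1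
      have a2' : m < k + n := by exact_mod_cast a2
      omega
  have n0 := hne 0
  have n1 := hne 1
  have n2 := hne 2
  simp only [Int.cast_zero, zero_div, add_zero, Int.cast_one, Int.cast_ofNat] at n0 n1 n2
  have key : ∀ a b : ℝ, Lf L a b → X < a → a < X + 1 → X < b → b < X + 1 → a ≠ Y → b ≠ Y →
      (a < Y ↔ b < Y) := fun a b h h1 h2 h3 h4 h5 h6 =>
    hB.iff_of_leaf h hx hy h1 h2 h3 h4 h5 h6
  have i00 := fun h => key p q h (by linarith) (by linarith) (by linarith) (by linarith) n0.1 n0.2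
  have i01 := fun h => key p (q + 1/3) h (by linarith) (by linarith) (by linarith) (by linarith)
    n0.1 n1.2
  have i02 := fun h => key p (q + 2/3) h (by linarith) (by linarith) (by linarith) (by linarith)
    n0.1 n2.2
  have i10 := fun h => key (p + 1/3) q h (by linarith) (by linarith) (by linarith) (by linarith)
    n1.1 n0.2
  have i11 := fun h => key (p + 1/3) (q + 1/3) h (by linarith) (by linarith) (by linarith)
    (by linarith) n1.1 n1.2
  have i12 := fun h => key (p + 1/3) (q + 2/3) h (by linarith) (by linarith) (by linarith)
    (by linarith) n1.1 n2.2
  have i20 := fun h => key (p + 2/3) q h (by linarith) (by linarith) (by linarith) (by linarith)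
    n2.1 n0.2
  have i21 := fun h => key (p + 2/3) (q + 1/3) h (by linarith) (by linarith) (by linarith)
    (by linarith) n2.1 n1.2
  have i22 := fun h => key (p + 2/3) (q + 2/3) h (by linarith) (by linarith) (by linarith)
    (by linarith) n2.1 n2.2
  have mp1 : p + 1/3 < Y → p < Y := fun h => by linarith
  have mp2 : p + 2/3 < Y → p + 1/3 < Y := fun h => by linarith
  have mq1 : q + 1/3 < Y → q < Y := fun h => by linarith
  have mq2 : q + 2/3 < Y → q + 1/3 < Y := fun h => by linarith
  have hall : (p < Y ↔ q < Y) ∧ (p + 1/3 < Y ↔ q + 1/3 < Y) ∧ (p + 2/3 < Y ↔ q + 2/3 < Y) := by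
    rcases hperm with ⟨a, b, c⟩ | ⟨a, b, c⟩ | ⟨a, b, c⟩ | ⟨a, b, c⟩ | ⟨a, b, c⟩ | ⟨a, b, c⟩
    · exact ⟨i00 a, i11 b, i22 c⟩
    · exact iff_of_perm mp1 mp2 mq1 mq2 (Or.inl ⟨i01 a, i12 b, i20 c⟩)
    · exact iff_of_perm mp1 mp2 mq1 mq2 (Or.inr (Or.inl ⟨i02 a, i10 b, i21 c⟩))
    · exact iff_of_perm mp1 mp2 mq1 mq2 (Or.inr (Or.inr (Or.inl ⟨i00 a, i12 b, i21 c⟩)))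
    · exact iff_of_perm mp1 mp2 mq1 mq2 (Or.inr (Or.inr (Or.inr (Or.inl ⟨i01 a, i10 b, i22 c⟩))))
    · exact iff_of_perm mp1 mp2 mq1 mq2 (Or.inr (Or.inr (Or.inr (Or.inr ⟨i02 a, i11 b, i20 c⟩))))
  have hcase : m = n ∨ m = n + 1 ∨ m = n + 2 := by omega
  rcases hcase with rfl | rfl | rfl <;> push_cast at hm
  · have := hall.1.2 (by linarith); linarith
  · have := hall.2.1.2 (by linarith); linarith
  · have := hall.2.2.2 (by linarith); linarith

lemma Unl.mono {L : Set Chord} {A B : Set S1} (hB : Unl L B) (h : A ⊆ B) : Unl L A :=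
  fun p x q y hl hx hy => hB p x q y hl (h hx) (h hy)

lemma Unl.iterate {L : Set Chord} (hL : IsInvLam L) {B : Set S1} (hB : Unl L B) (n : ℕ) :
    Unl L (s3^[n] '' B) := by
  induction n with
  | zero => simpa using hB
  | succ n ih =>
    rw [Function.iterate_succ', image_comp]
    exact ih.image hL

lemma s3_fiber_finite (y : S1) : (s3 ⁻¹' {y}).Finite := by
  by_cases h : ∃ x : ℝ, s3 (x : S1) = y
  · obtain ⟨x, rfl⟩ := h
    apply Set.Finite.subset (s := {(x : S1), ((x + 1/3 : ℝ) : S1), ((x + 2/3 : ℝ) : S1)})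
    · exact Set.toFinite _
    · intro z hz
      obtain ⟨z, -, -, rfl⟩ := exists_lift z 0
      simp only [mem_preimage, mem_singleton_iff, s3_coe] at hz
      simpa using coe_three_eq_iff.1 hz
  · convert Set.finite_empty
    ext z
    obtain ⟨z, -, -, rfl⟩ := exists_lift z 0
    simp only [mem_preimage, mem_singleton_iff, mem_empty_iff_false, iff_false]
    exact fun hz => h ⟨z, hz⟩

lemma infinite_s3_image {B : Set S1} (h : B.Infinite) : (s3 '' B).Infinite := by
  intro hf
  apply h
  apply Set.Finite.subset (hf.biUnion (t := fun y => s3 ⁻¹' {y}) fun y _ => s3_fiber_finite y)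
  intro x hx
  exact mem_biUnion (mem_image_of_mem _ hx) rfl

lemma infinite_iterate_image {B : Set S1} (h : B.Infinite) (n : ℕ) : (s3^[n] '' B).Infinite := by
  induction n with
  | zero => simpa using h
  | succ n ih => rw [Function.iterate_succ', image_comp]; exact infinite_s3_image ih

/-- Two leaves at a vertex `y` of an infinite unseparated set cannot have the same
nondegenerate image. -/
lemma Unl.no_fold_aux {L : Set Chord} (hL : IsInvLam L) {B : Set S1} (hB : Unl L B)
    (hinf : B.Infinite) {x y : ℝ} (hx : (x : S1) ∈ B) (hy : (y : S1) ∈ B)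
    (hz : ((x + 1/3 : ℝ) : S1) ∈ B) (h1 : Lf L y x) (h2 : Lf L y (x + 1/3))
    (hn : ((3 * y : ℝ) : S1) ≠ ((3 * x : ℝ) : S1)) : False := by
  set S : Set S1 := {(x : S1), ((x + 1/3 : ℝ) : S1), ((x + 2/3 : ℝ) : S1), (y : S1),
    ((y + 1/3 : ℝ) : S1), ((y + 2/3 : ℝ) : S1)} with hS
  obtain ⟨w, hw, hwS⟩ := (hinf.sdiff (Set.toFinite S)).nonempty
  simp only [hS, mem_insert_iff, mem_singleton_iff, not_or] at hwS
  obtain ⟨w, -, -, rfl⟩ := exists_lift w 0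
  obtain ⟨w0, w1, w2, v0, v1, v2⟩ := hwS
  obtain ⟨x0, hx0, hx0', ex0⟩ := exists_lift_Ioo _ w w0
  obtain ⟨x1, hx1, hx1', ex1⟩ := exists_lift_Ioo _ w w1
  obtain ⟨x2, hx2, hx2', ex2⟩ := exists_lift_Ioo _ w w2
  obtain ⟨y0, hy0, hy0', ey0⟩ := exists_lift_Ioo _ w v0
  obtain ⟨y1, hy1, hy1', ey1⟩ := exists_lift_Ioo _ w v1
  obtain ⟨y2, hy2, hy2', ey2⟩ := exists_lift_Ioo _ w v2
  have hny : ∀ u : ℝ, ((3 * u : ℝ) : S1) = ((3 * x : ℝ) : S1) → ∀ a : ℝ, (a : S1) = u → a ≠ y0 := by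
    rintro u hu a ha rfl
    apply hn
    rw [← hu, ← s3_coe, ← s3_coe, ← ha, ← ey0]
  have f1 : ∀ x : ℝ, ((3 * (x + 1/3) : ℝ) : S1) = ((3 * x : ℝ) : S1) := fun x =>
    coe_eq_iff.2 ⟨1, by push_cast; ring⟩
  have f2 : ∀ x : ℝ, ((3 * (x + 2/3) : ℝ) : S1) = ((3 * x : ℝ) : S1) := fun x =>
    coe_eq_iff.2 ⟨2, by push_cast; ring⟩
  have nx0 := hny x rfl x0 ex0
  have nx1 := hny _ (f1 x) x1 ex1
  have nx2 := hny _ (f2 x) x2 ex2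
  have g : ∀ r : ℝ, 0 < r → r < 1 → ∀ u a b : ℝ, (a : S1) = ((u + r : ℝ) : S1) → (b : S1) = u →
      a ≠ b := by
    rintro r hr hr' u a b ha hb rfl
    exact coe_ne_of_lt (x := u) (y := u + r) (by linarith) (by linarith) (hb.symm.trans ha)
  have ny1 := g _ (by norm_num) (by norm_num) y y1 y0 ey1 ey0
  have ny2 := g _ (by norm_num) (by norm_num) y y2 y0 ey2 ey0
  have nx10 := g _ (by norm_num) (by norm_num) x x1 x0 ex1 ex0
  have A := (hB.iff_of_leaf (h2.congr ey0 ex1) hw (ex0 ▸ hx) hy0 hy0' hx1 hx1' nx0.symm nx10)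
  have C := (hB.iff_of_leaf (h1.congr ey0 ex0) hw (ex1 ▸ hz) hy0 hy0' hx0 hx0' nx1.symm nx10.symm)
  have D : x1 < y0 ↔ x0 < y0 := by
    have key : ∀ a b : ℝ, Lf L a b → w < a → a < w + 1 → w < b → b < w + 1 → a ≠ y0 → b ≠ y0 →
      (a < y0 ↔ b < y0) := fun a b h h1 h2 h3 h4 h5 h6 =>
      hB.iff_of_leaf h hw (ey0 ▸ hy) h1 h2 h3 h4 h5 h6
    have e0 : (x0 : S1) = ((x + 1/3 + 2/3 : ℝ) : S1) := ex0.trans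
      (coe_eq_iff.2 ⟨-1, by push_cast; ring⟩)
    have e2 : (x2 : S1) = ((x + 1/3 + 1/3 : ℝ) : S1) := ex2.trans
      (coe_eq_iff.2 ⟨0, by push_cast; ring⟩)
    rcases h1.sib hL hn with ⟨s1, s2⟩ | ⟨s1, s2⟩ <;>
      rcases h2.sib hL (by rw [f1]; exact hn) with ⟨t1, t2⟩ | ⟨t1, t2⟩
    · have k1 := key _ _ (s1.congr ey1 ex1) hy1 hy1' hx1 hx1' ny1 nx1
      have k2 := key _ _ (s2.congr ey2 ex2) hy2 hy2' hx2 hx2' ny2 nx2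
      have k3 := key _ _ (t1.congr ey1 e2) hy1 hy1' hx2 hx2' ny1 nx2
      have k4 := key _ _ (t2.congr ey2 e0) hy2 hy2' hx0 hx0' ny2 nx0
      exact k1.symm.trans (k3.trans (k2.symm.trans k4))
    · have k1 := key _ _ (s1.congr ey1 ex1) hy1 hy1' hx1 hx1' ny1 nx1
      have k3 := key _ _ (t1.congr ey1 e0) hy1 hy1' hx0 hx0' ny1 nx0
      exact k1.symm.trans k3
    · have k2 := key _ _ (s2.congr ey2 ex1) hy2 hy2' hx1 hx1' ny2 nx1
      have k4 := key _ _ (t2.congr ey2 e0) hy2 hy2' hx0 hx0' ny2 nx0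
      exact k2.symm.trans k4
    · have k1 := key _ _ (s1.congr ey1 ex2) hy1 hy1' hx2 hx2' ny1 nx2
      have k2 := key _ _ (s2.congr ey2 ex1) hy2 hy2' hx1 hx1' ny2 nx1
      have k3 := key _ _ (t1.congr ey1 e0) hy1 hy1' hx0 hx0' ny1 nx0
      have k4 := key _ _ (t2.congr ey2 e2) hy2 hy2' hx2 hx2' ny2 nx2
      exact k2.symm.trans (k4.trans (k1.symm.trans k3))
  rcases lt_or_gt_of_ne nx0 with a | a <;> rcases lt_or_gt_of_ne nx1 with b | b <;>
    rcases lt_or_gt_of_ne nx10.symm with c | c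
  · exact lt_asymm b (C.2 c)
  · exact lt_asymm a (A.2 c)
  · exact lt_asymm b (D.2 a)
  · exact lt_asymm b (D.2 a)
  · exact lt_asymm a (D.1 b)
  · exact lt_asymm a (D.1 b)
  · exact lt_asymm c (A.1 a)
  · exact lt_asymm c (C.1 b)

/-- Two leaves at a vertex of an infinite unseparated set, with vertices in the set, cannot
have the same nondegenerate image. -/
lemma Unl.no_fold {L : Set Chord} (hL : IsInvLam L) {B : Set S1} (hB : Unl L B)
    (hinf : B.Infinite) {x y z : ℝ} (hx : (x : S1) ∈ B) (hy : (y : S1) ∈ B)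
    (hz : (z : S1) ∈ B) (h1 : Lf L y x) (h2 : Lf L y z) (hxz : (x : S1) ≠ z)
    (h3 : ((3 * x : ℝ) : S1) = ((3 * z : ℝ) : S1))
    (hn : ((3 * y : ℝ) : S1) ≠ ((3 * x : ℝ) : S1)) : False := by
  rcases coe_three_eq_iff.1 h3 with h | h | h
  · exact hxz h
  · exact hB.no_fold_aux hL hinf (x := z) hz hy (h ▸ hx) h2 (h1.congr rfl h.symm) (h3 ▸ hn)
  · have e : (z : S1) = ((x + 1/3 : ℝ) : S1) := by
      obtain ⟨n, hn⟩ := coe_eq_iff.1 h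
      exact coe_eq_iff.2 ⟨-n - 1, by push_cast; linarith⟩
    exact hB.no_fold_aux hL hinf (x := x) hx hy (e ▸ hz) h1 (h2.congr rfl e.symm) hn

/-- Invariance of a set of circle points under the antipodal map. -/
def SymmSet (B : Set S1) : Prop := ∀ x : ℝ, (x : S1) ∈ B → ((x + 1/2 : ℝ) : S1) ∈ B

lemma SymmSet.image {B : Set S1} (h : SymmSet B) : SymmSet (s3 '' B) := by
  rintro x ⟨y, hy, hyx⟩
  obtain ⟨y, -, -, rfl⟩ := exists_lift y 0
  refine ⟨_, h y hy, ?_⟩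
  rw [s3_coe] at hyx ⊢
  obtain ⟨n, hn⟩ := coe_eq_iff.1 hyx
  exact coe_eq_iff.2 ⟨n + 1, by push_cast; linarith⟩

lemma coe_sub_half_mem {B : Set S1} (h : SymmSet B) {x : ℝ} (hx : (x : S1) ∈ B) :
    ((x - 1/2 : ℝ) : S1) ∈ B := by
  have := h x hx
  rwa [show ((x + 1/2 : ℝ) : S1) = ((x - 1/2 : ℝ) : S1) from
    coe_eq_iff.2 ⟨1, by push_cast; ring⟩] at this

lemma mem_shift {B : Set S1} {x y : ℝ} (hx : (x : S1) ∈ B) (n : ℤ) (h : y = x + n) :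
    (y : S1) ∈ B := by
  rwa [show (y : S1) = x from coe_eq_iff.2 ⟨n, h⟩]

/-- A symmetric unseparated set avoids the short side of each leaf. -/
lemma Unl.symm_short {L : Set Chord} {B : Set S1} (hB : Unl L B) (hs : SymmSet B) {p q x : ℝ}
    (h : Lf L p q) (hx : (x : S1) ∈ B) (h1 : p < x) (h2 : x < q) (h3 : q ≤ p + 1/2) : False :=
  hB p x q (x + 1/2) h hx (hs x hx) h1 h2 (by linarith) (by linarith)

lemma Unl.symm_no_diam {L : Set Chord} {B : Set S1} (hB : Unl L B) (hs : SymmSet B)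
    (hinf : B.Infinite) {p q : ℝ} (h : Lf L p q) (hq : q = p + 1/2) : False := by
  obtain ⟨w, hw, hwS⟩ := (hinf.sdiff (Set.toFinite {(p : S1), (q : S1)})).nonempty
  simp only [mem_insert_iff, mem_singleton_iff, not_or] at hwS
  obtain ⟨x, h1, h2, rfl⟩ := exists_lift_Ioo w p (Ne.symm hwS.1)
  rcases lt_trichotomy x q with h3 | rfl | h3
  · exact hB.symm_short hs h hw h1 h3 hq.le
  · exact hwS.2 rfl
  · exact hB.symm_short hs h (coe_sub_half_mem hs hw) (by linarith) (by linarith) hq.le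

lemma Unl.symm_no_middle {L : Set Chord} (hL : IsInvLam L) {B : Set S1} (hB : Unl L B)
    (hs : SymmSet B) (hinf : B.Infinite) {b a : ℝ} (h : Lf L b a) (hb : (b : S1) ∈ B)
    (h1 : b + 1/6 ≤ a) (h2 : a < b + 1/3) : False := by
  have hn : ((3 * b : ℝ) : S1) ≠ ((3 * a : ℝ) : S1) := coe_ne_of_lt (by linarith) (by linarith)
  have h3 := h.three hL hn
  rcases h1.eq_or_lt with e | h1
  · exact (hB.image hL).symm_no_diam hs.image (infinite_s3_image hinf) h3 (by linarith)
  have avoid : ∀ x : ℝ, (x : S1) ∈ B → ∀ k : ℤ, a + k / 3 < x → x < b + (k + 1) / 3 → False := by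
    intro x hx k hx1 hx2
    have hl : Lf L (3 * a) (3 * b + 1) := h3.symm.congr rfl (coe_add_one _)
    refine (hB.image hL).symm_short hs.image hl (x := 3 * x - k)
      ⟨x, hx, ?_⟩ (by linarith) (by linarith) (by linarith)
    rw [s3_coe]; exact coe_eq_iff.2 ⟨k, by ring⟩
  rcases h.sib hL hn with ⟨s1, s2⟩ | ⟨s1, -⟩
  · refine hinf (Set.Finite.subset (Set.toFinite {(b : S1), (a : S1), ((b + 1/3 : ℝ) : S1),
      ((a + 1/3 : ℝ) : S1), ((b + 2/3 : ℝ) : S1), ((a + 2/3 : ℝ) : S1)}) ?_)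
    intro x hx
    obtain ⟨x, hx1, hx2, rfl⟩ := exists_lift x b
    by_contra hcon
    simp only [mem_insert_iff, mem_singleton_iff, not_or] at hcon
    have ne : ∀ y : ℝ, ¬ (x : S1) = (y : S1) → x ≠ y := fun y hy e => hy (e ▸ rfl)
    obtain ⟨c1, c2, c3, c4, c5, c6⟩ := hcon
    have d1 := lt_of_le_of_ne hx1 (ne _ c1).symm
    rcases lt_or_gt_of_ne (ne _ c2) with e2 | e2
    · exact hB.symm_short hs h hx d1 e2 (by linarith)
    rcases lt_or_gt_of_ne (ne _ c3) with e3 | e3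
    · exact avoid x hx 0 (by simpa using e2) (by simpa using e3)
    rcases lt_or_gt_of_ne (ne _ c4) with e4 | e4
    · exact hB.symm_short hs s1 hx e3 e4 (by linarith)
    rcases lt_or_gt_of_ne (ne _ c5) with e5 | e5
    · exact avoid x hx 1 (by push_cast; linarith) (by push_cast; linarith)
    rcases lt_or_gt_of_ne (ne _ c6) with e6 | e6
    · exact hB.symm_short hs s2 hx e5 e6 (by linarith)
    · exact avoid x hx 2 (by push_cast; linarith) (by push_cast; linarith)
  · have hl : Lf L (a + 2/3) (b + 4/3) :=
      s1.symm.congr rfl (coe_eq_iff.2 ⟨1, by push_cast; ring⟩)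
    exact hB.symm_short hs hl (x := b + 1) (by rwa [coe_add_one]) (by linarith) (by linarith)
      (by linarith)

lemma Unl.symm_grow {L : Set Chord} (hL : IsInvLam L)
    (hlong : ∀ p q : ℝ, Lf L p q → p + 1/3 ≤ q → q < p + 1/2 → False) (k : ℕ) :
    ∀ (B : Set S1), Unl L B → SymmSet B → B.Infinite → ∀ b a : ℝ, Lf L b a → (b : S1) ∈ B →
      b < a → a < b + 1/2 → 1/6 ≤ 3 ^ k * (a - b) → False := by
  induction k with
  | zero =>
    intro B hB hs hinf b a h hb h1 h2 h3
    by_cases h4 : a < b + 1/3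
    · exact hB.symm_no_middle hL hs hinf h hb (by simp at h3; linarith) h4
    · exact hlong b a h (not_lt.1 h4) h2
  | succ k ih =>
    intro B hB hs hinf b a h hb h1 h2 h3
    by_cases h4 : a < b + 1/3
    · by_cases h5 : b + 1/6 ≤ a
      · exact hB.symm_no_middle hL hs hinf h hb h5 h4
      · refine ih (s3 '' B) (hB.image hL) hs.image (infinite_s3_image hinf) (3 * b) (3 * a)
          (h.three hL (coe_ne_of_lt (by linarith) (by linarith))) ⟨b, hb, s3_coe b⟩
          (by linarith) (by linarith) ?_
        rw [pow_succ] at h3; linarith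
    · exact hlong b a h (not_lt.1 h4) h2

lemma Unl.symm_no_translate {L : Set Chord} (hL : IsInvLam L) {B : Set S1} (hB : Unl L B)
    (hs : SymmSet B) (hinf : B.Infinite) {b a : ℝ} (h : Lf L b a) (hb : (b : S1) ∈ B)
    (ha : (a : S1) ∈ B) (hb' : ((b + 1/3 : ℝ) : S1) ∈ B)
    (h1 : b < a) (h2 : a < b + 1/6) : False := by
  have hlong : ∀ p q : ℝ, Lf L p q → p + 1/3 ≤ q → q < p + 1/2 → False := by
    intro p q hl h3 h4
    have av : ∀ x : ℝ, (x : S1) ∈ B → p < x → x < q → False := fun x hx hx1 hx2 =>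
      hB.symm_short hs hl hx hx1 hx2 h4.le
    obtain ⟨t, h5, h6, e⟩ := exists_lift (b : S1) p
    obtain ⟨n, hn⟩ := coe_eq_iff.1 e
    have tb : (t : S1) ∈ B := e ▸ hb
    have ta : ((t + (a - b) : ℝ) : S1) ∈ B := mem_shift ha n (by linarith)
    have tb1 : ((t - 2/3 : ℝ) : S1) ∈ B := mem_shift hb' (n - 1) (by push_cast; linarith)
    have tb2 : ((t - 1/2 : ℝ) : S1) ∈ B := coe_sub_half_mem hs tb
    have ta2 : ((t + (a - b) - 1/2 : ℝ) : S1) ∈ B := coe_sub_half_mem hs ta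
    have tb3 : ((t - 1/6 : ℝ) : S1) ∈ B := mem_shift (hs _ tb1) 0 (by push_cast; ring)
    rcases h5.eq_or_lt with rfl | h5
    · exact av _ ta (by linarith) (by linarith)
    by_cases h7 : t < q
    · exact av _ tb h5 h7
    by_cases h8 : q ≤ t - 1/2
    · exact av _ tb1 (by linarith) (by linarith)
    by_cases h9 : p < t - 1/2
    · exact av _ tb2 h9 (by linarith)
    by_cases h10 : t - 1/6 < q
    · exact av _ tb3 (by linarith) h10
    · exact av _ ta2 (by linarith) (by linarith)
  obtain ⟨k, hk⟩ := pow_unbounded_of_one_lt (1/6 / (a - b)) (by norm_num : (1:ℝ) < 3)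
  refine Unl.symm_grow hL hlong k B hB hs hinf b a h hb h1 (by linarith) ?_
  rw [div_lt_iff₀ (by linarith)] at hk
  exact hk.le

/-- Two leaves with vertices in a symmetric infinite unseparated set cannot have the same
nondegenerate image. -/
lemma Unl.symm_no_fold {L : Set Chord} (hL : IsInvLam L) {B : Set S1} (hB : Unl L B)
    (hs : SymmSet B) (hinf : B.Infinite) {b a b' a' : ℝ} (h : Lf L b a) (h' : Lf L b' a')
    (hb : (b : S1) ∈ B) (ha : (a : S1) ∈ B) (hb' : (b' : S1) ∈ B) (ha' : (a' : S1) ∈ B)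
    (hn : ((3 * b : ℝ) : S1) ≠ ((3 * a : ℝ) : S1))
    (hbb : (b' : S1) = ((b + 1/3 : ℝ) : S1) ∨ (b' : S1) = ((b + 2/3 : ℝ) : S1))
    (haa : (a' : S1) = ((a + 1/3 : ℝ) : S1) ∨ (a' : S1) = ((a + 2/3 : ℝ) : S1))
    (h1 : b < a) (h2 : a < b + 1/2) : False := by
  have av : ∀ p q x : ℝ, Lf L p q → (x : S1) ∈ B → p < x → x < q → q ≤ p + 1/2 → False :=
    fun p q x h hx hx1 hx2 hx3 => hB.symm_short hs h hx hx1 hx2 hx3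
  have ne3 : a ≠ b + 1/3 := by
    rintro rfl
    exact hn (coe_eq_iff.2 ⟨-1, by push_cast; ring⟩)
  have ne6 : a ≠ b + 1/6 := by
    rintro rfl
    exact (hB.image hL).symm_no_diam hs.image (infinite_s3_image hinf) (h.three hL hn) (by ring)
  have key6 : (b' : S1) = ((b + 2/3 : ℝ) : S1) → b + 1/6 < a → False := by
    intro e h3
    rw [e] at hb'
    exact av b a (b + 1/6) h (mem_shift (coe_sub_half_mem hs hb') 0 (by push_cast; ring))
      (by linarith) h3 h2.le
  rcases lt_or_gt_of_ne ne3 with h3 | h3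
  · rcases lt_or_gt_of_ne ne6 with h4 | h4
    · rcases hbb with e | e <;> rcases haa with e' | e'
      · rw [e] at hb'
        exact hB.symm_no_translate hL hs hinf h hb ha hb' h1 h4
      · exact av _ _ (b + 1/2) (h'.congr e.symm e'.symm) (hs b hb) (by linarith) (by linarith)
          (by linarith)
      · exact av _ _ (b + 1/2) (h'.congr e.symm e'.symm).symm (hs b hb) (by linarith)
          (by linarith) (by linarith)
      · rw [e] at hb'
        rw [e'] at ha'
        exact hB.symm_no_translate hL hs hinf (h'.congr e.symm e'.symm) hb' ha'
          (mem_shift hb 1 (by push_cast; ring)) (by linarith) (by linarith)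
    · rcases hbb with e | e
      · rcases haa with e' | e'
        · rw [e'] at ha'
          exact av b a (a - 1/6) h (mem_shift (coe_sub_half_mem hs ha') 0 (by push_cast; ring))
            (by linarith) (by linarith) h2.le
        · have hl : Lf L (a + 2/3) (b + 4/3) := h'.symm.congr e'.symm
            ((show ((b + 4/3 : ℝ) : S1) = ((b + 1/3 : ℝ) : S1) from
              coe_eq_iff.2 ⟨1, by push_cast; ring⟩).trans e.symm)
          exact av _ _ (b + 1) hl (by rwa [coe_add_one]) (by linarith) (by linarith) (by linarith)
      · exact key6 e h4
  · rcases hbb with e | e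
    · rw [e] at hb'
      exact av b a (b + 1/3) h hb' (by linarith) h3 h2.le
    · exact key6 e (by linarith)

/-- Data of a folding pair: two disjoint leaves with vertices in an infinite unseparated set
and with the same nondegenerate image. -/
structure Folding (L : Set Chord) (U : Set S1) (b a b' a' : ℝ) : Prop where
  unl : Unl L U
  inf : U.Infinite
  leaf : Lf L b a
  leaf' : Lf L b' a'
  hb : (b : S1) ∈ U
  ha : (a : S1) ∈ U
  hb' : (b' : S1) ∈ U
  ha' : (a' : S1) ∈ U
  ne : ((3 * b : ℝ) : S1) ≠ ((3 * a : ℝ) : S1)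
  hbb : (b' : S1) = ((b + 1/3 : ℝ) : S1) ∨ (b' : S1) = ((b + 2/3 : ℝ) : S1)
  haa : (a' : S1) = ((a + 1/3 : ℝ) : S1) ∨ (a' : S1) = ((a + 2/3 : ℝ) : S1)

lemma symmSet_union (U : Set S1) : SymmSet (U ∪ antip '' U) := by
  rintro x (hx | ⟨y, hy, hyx⟩)
  · right; exact ⟨x, hx, antip_coe x⟩
  · left
    rw [← antip_coe, ← hyx, antip_antip]; exact hy

lemma Folding.not_unl_union {L : Set Chord} (hL : IsInvLam L) {U : Set S1} {b a b' a' : ℝ}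
    (F : Folding L U b a b' a') : ¬ Unl L (U ∪ antip '' U) := by
  intro hB
  have hs := symmSet_union U
  have hinf : (U ∪ antip '' U).Infinite := F.inf.mono subset_union_left
  have shift : ∀ (r : ℝ) (n : ℤ) (u v : ℝ), (u : S1) = ((v + r : ℝ) : S1) →
      (u : S1) = ((v + n + r : ℝ) : S1) := fun r n u v h =>
    h.trans (coe_eq_iff.2 ⟨-n, by push_cast; ring⟩)
  obtain ⟨a₁, h1, h2, e⟩ := exists_lift_Ioo (a : S1) b F.leaf.2
  have e3 : ((3 * a₁ : ℝ) : S1) = ((3 * a : ℝ) : S1) := by rw [← s3_coe, e, s3_coe]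
  have haa : (a' : S1) = ((a₁ + 1/3 : ℝ) : S1) ∨ (a' : S1) = ((a₁ + 2/3 : ℝ) : S1) := by
    rw [AddCircle.coe_add, AddCircle.coe_add, e, ← AddCircle.coe_add, ← AddCircle.coe_add]
    exact F.haa
  have hl := F.leaf.congr rfl e
  have hne := F.ne
  rw [← e3] at hne
  have ha : (a₁ : S1) ∈ U ∪ antip '' U := Or.inl (e ▸ F.ha)
  rcases lt_trichotomy a₁ (b + 1/2) with h3 | h3 | h3
  · exact hB.symm_no_fold hL hs hinf hl F.leaf' (Or.inl F.hb) ha (Or.inl F.hb') (Or.inl F.ha')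
      hne F.hbb haa h1 h3
  · exact hB.symm_no_diam hs hinf hl h3
  · refine hB.symm_no_fold hL hs hinf (b := a₁ - 1) (a := b)
      (hl.symm.congr (coe_eq_iff.2 ⟨-1, by push_cast; ring⟩) rfl)
      F.leaf'.symm (mem_shift ha (-1) (by push_cast; ring)) (Or.inl F.hb) (Or.inl F.ha')
      (Or.inl F.hb') ?_ ?_ F.hbb (by linarith) (by linarith)
    · rw [show ((3 * (a₁ - 1) : ℝ) : S1) = ((3 * a₁ : ℝ) : S1) from
        coe_eq_iff.2 ⟨-3, by push_cast; ring⟩]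
      exact hne.symm
    · rcases haa with h | h
      · exact Or.inl (h.trans (coe_eq_iff.2 ⟨1, by push_cast; ring⟩))
      · exact Or.inr (h.trans (coe_eq_iff.2 ⟨1, by push_cast; ring⟩))

/-- Admissible leaves: of length at most `1/2`, with `U` on the short side. -/
def Adm (L : Set Chord) (U : Set S1) (d c : ℝ) : Prop :=
  Lf L d c ∧ d < c ∧ c ≤ d + 1/2 ∧ ∀ x : ℝ, (x : S1) ∈ U → c < x → x < d + 1 → False

lemma unl_antip {L : Set Chord} (hL : IsCubicSymLam L) {U : Set S1} (hU : Unl L U) :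
    Unl L (antip '' U) := by
  rintro p x q y hl ⟨x', hx, hxe⟩ ⟨y', hy, hye⟩ h1 h2 h3 h4
  refine hU (p + 1/2) (x + 1/2) (q + 1/2) (y + 1/2) (hl.half hL) ?_ ?_ (by linarith)
    (by linarith) (by linarith) (by linarith)
  · rw [← antip_coe, ← hxe, antip_antip]; exact hx
  · rw [← antip_coe, ← hye, antip_antip]; exact hy

lemma exists_adm {L : Set Chord} (hL : IsCubicSymLam L) {U : Set S1} (hU : Unl L U)
    (h : ¬ Unl L (U ∪ antip '' U)) : ∃ d c : ℝ, Adm L U d c := by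
  unfold Unl at h
  push Not at h
  obtain ⟨p, x, q, y, hl, hx, hy, h1, h2, h3, h4, -⟩ := h
  have key : ∀ p x q y : ℝ, Lf L p q → (x : S1) ∈ U → (y : S1) ∈ antip '' U → p < x → x < q →
      q < y → y < p + 1 → ∃ d c : ℝ, Adm L U d c := by
    intro p x q y hl hx hy h1 h2 h3 h4
    by_cases h5 : q ≤ p + 1/2
    · exact ⟨p, q, hl, by linarith, h5, fun z hz h6 h7 => hU p x q z hl hx hz h1 h2 h6 h7⟩
    · refine ⟨q - 1/2, p + 1/2, ?_, by linarith, by linarith, fun z hz h6 h7 => ?_⟩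
      · exact (hl.half hL).symm.congr (coe_eq_iff.2 ⟨-1, by push_cast; ring⟩) rfl
      · refine unl_antip hL hU p (z - 1/2) q y hl ?_ hy (by linarith) (by linarith) h3 h4
        refine ⟨z, hz, ?_⟩
        rw [antip_coe]; exact coe_eq_iff.2 ⟨1, by push_cast; ring⟩
  rcases hx with hx | hx <;> rcases hy with hy | hy
  · exact (hU p x q y hl hx hy h1 h2 h3 h4).elim
  · exact key p x q y hl hx hy h1 h2 h3 h4
  · exact key q y (p + 1) (x + 1) (hl.symm.congr rfl (coe_add_one p)) hy
      (by rwa [coe_add_one]) h3 h4 (by linarith) (by linarith)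
  · exact (unl_antip hL hU p x q y hl hx hy h1 h2 h3 h4).elim

lemma Adm.exists_third {L : Set Chord} {U : Set S1} {d c : ℝ} (h : Adm L U d c) {b b' : ℝ}
    (hb : (b : S1) ∈ U) (hb' : (b' : S1) ∈ U)
    (hbb : (b' : S1) = ((b + 1/3 : ℝ) : S1) ∨ (b' : S1) = ((b + 2/3 : ℝ) : S1)) :
    ∃ α : ℝ, d ≤ α ∧ α + 1/3 ≤ c ∧ (α : S1) ∈ U ∧ ((α + 1/3 : ℝ) : S1) ∈ U ∧
      ((3 * α : ℝ) : S1) = ((3 * b : ℝ) : S1) := by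
  obtain ⟨-, h1, h2, h3⟩ := h
  obtain ⟨t, h4, h5, e⟩ := exists_lift (b : S1) d
  obtain ⟨n, hn⟩ := coe_eq_iff.1 e
  have ht : (t : S1) ∈ U := e ▸ hb
  have h6 : t ≤ c := by
    by_contra h6
    exact h3 t ht (not_le.1 h6) h5
  rcases hbb with hh | hh <;> rw [hh] at hb'
  · have hm : ((t + 1/3 : ℝ) : S1) ∈ U := mem_shift hb' n (by linarith)
    refine ⟨t, h4, ?_, ht, hm, coe_eq_iff.2 ⟨3 * n, by push_cast; linarith⟩⟩
    by_contra h7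
    exact h3 _ hm (not_le.1 h7) (by linarith)
  · have hm : ((t - 1/3 : ℝ) : S1) ∈ U := mem_shift hb' (n - 1) (by push_cast; linarith)
    have hm' : ((t + 2/3 : ℝ) : S1) ∈ U := mem_shift hb' n (by linarith)
    refine ⟨t - 1/3, ?_, by linarith, hm, by rw [sub_add_cancel]; exact ht,
      coe_eq_iff.2 ⟨3 * n - 1, by push_cast; linarith⟩⟩
    by_contra h7
    exact h3 _ hm' (by linarith) (by linarith)

lemma Folding.exists_pair {L : Set Chord} {U : Set S1} {b a b' a' : ℝ}
    (F : Folding L U b a b' a') {d c : ℝ} (h : Adm L U d c) :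
    ∃ α β : ℝ, d ≤ α ∧ α < β ∧ β + 1/3 ≤ c ∧ (α : S1) ∈ U ∧ (β : S1) ∈ U ∧
      ((α + 1/3 : ℝ) : S1) ∈ U ∧ ((β + 1/3 : ℝ) : S1) ∈ U := by
  obtain ⟨α, a1, a2, a3, a4, a5⟩ := h.exists_third F.hb F.hb' F.hbb
  obtain ⟨β, b1, b2, b3, b4, b5⟩ := h.exists_third F.ha F.ha' F.haa
  rcases lt_trichotomy α β with h | rfl | h
  · exact ⟨α, β, a1, h, b2, a3, b3, a4, b4⟩
  · exact absurd (a5.symm.trans b5) F.ne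
  · exact ⟨β, α, b1, h, a2, b3, a3, b4, a4⟩

lemma Adm.shift {L : Set Chord} {U : Set S1} {d c : ℝ} (h : Adm L U d c) (n : ℤ) :
    Adm L U (d + n) (c + n) := by
  obtain ⟨h1, h2, h3, h4⟩ := h
  refine ⟨h1.congr (coe_eq_iff.2 ⟨n, rfl⟩) (coe_eq_iff.2 ⟨n, rfl⟩), by linarith, by linarith, ?_⟩
  intro x hx hx1 hx2
  exact h4 (x - n) (mem_shift hx (-n) (by push_cast; ring)) (by linarith) (by linarith)

/-- There is a shortest admissible leaf. -/
lemma Folding.exists_min {L : Set Chord} (hL : IsCubicSymLam L) {U : Set S1} {b a b' a' : ℝ}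
    (F : Folding L U b a b' a') : ∃ d c : ℝ, Adm L U d c ∧ 
      ∀ d' c' : ℝ, Adm L U d' c' → c - d ≤ c' - d' := by
  set T : Set (ℝ × ℝ) := {t | Adm L U t.1 t.2 ∧ 0 ≤ t.1 ∧ t.1 ≤ 1} with hT
  have hlen : ∀ d c : ℝ, Adm L U d c → d + 1/3 ≤ c := by
    intro d c h
    obtain ⟨α, β, h1, h2, h3, -⟩ := F.exists_pair h
    linarith
  have hfr : ∀ d c : ℝ, Adm L U d c → ∃ n : ℤ, (d + n, c + n) ∈ T := by
    intro d c h
    refine ⟨-⌊d⌋, h.shift _, ?_, ?_⟩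
    · push_cast; linarith [Int.floor_le d]
    · push_cast; linarith [Int.lt_floor_add_one d]
  have hne : T.Nonempty := by
    obtain ⟨d, c, h⟩ := exists_adm hL F.unl (F.not_unl_union hL.toIsInvLam)
    obtain ⟨n, hn⟩ := hfr d c h
    exact ⟨_, hn⟩
  have hclosed : IsClosed T := by
    rw [← closure_subset_iff_isClosed]
    rintro ⟨d, c⟩ ht
    have hmem : ∀ ε > 0, ∃ t ∈ T, |t.1 - d| < ε ∧ |t.2 - c| < ε := by
      intro ε hε
      obtain ⟨t, ht, hd⟩ := Metric.mem_closure_iff.1 ht ε hε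
      rw [Prod.dist_eq, max_lt_iff, Real.dist_eq, Real.dist_eq, abs_sub_comm, abs_sub_comm c] at hd
      exact ⟨t, ht, hd⟩
    set K : Set (ℝ × ℝ) := {t : ℝ × ℝ | t.1 + 1/3 ≤ t.2} ∩ {t : ℝ × ℝ | t.2 ≤ t.1 + 1/2} ∩
        {t : ℝ × ℝ | 0 ≤ t.1} ∩ {t : ℝ × ℝ | t.1 ≤ 1} with hK
    have k1 : IsClosed K :=
      (((isClosed_le (by fun_prop) (by fun_prop)).inter
        (isClosed_le (by fun_prop) (by fun_prop))).inter
        (isClosed_le (by fun_prop) (by fun_prop))).inter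
        (isClosed_le (by fun_prop) (by fun_prop))
    have k2 : T ⊆ K := fun t ht => ⟨⟨⟨hlen _ _ ht.1, ht.1.2.2.1⟩, ht.2.1⟩, ht.2.2⟩
    obtain ⟨⟨⟨k3, k4⟩, k5⟩, k6⟩ := closure_minimal k2 k1 ht
    simp only [mem_ofPred_eq] at k3 k4 k5 k6
    refine ⟨⟨?_, by simp only; linarith, k4, ?_⟩, k5, k6⟩
    · refine Lf.of_approx hL.toIsLamination (coe_ne_of_lt (by simp only; linarith)
        (by simp only; linarith)) ?_
      intro ε hε
      obtain ⟨t, ht, h1, h2⟩ := hmem ε hε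
      exact ⟨t.1, t.2, ht.1.1, h1, h2⟩
    · intro x hx hx1 hx2
      simp only at hx1 hx2
      obtain ⟨t, ht, h1, h2⟩ := hmem (min (x - c) (d + 1 - x)) (lt_min (by linarith) (by linarith))
      have h3 := lt_of_lt_of_le h1 (min_le_right _ _)
      have h4 := lt_of_lt_of_le h2 (min_le_left _ _)
      rw [abs_lt] at h3 h4
      exact ht.1.2.2.2 x hx (by linarith) (by linarith)
  have hcomp : IsCompact T := by
    refine IsCompact.of_isClosed_subset
      ((isCompact_Icc (a := (0:ℝ)) (b := 1)).prod (isCompact_Icc (a := (0:ℝ)) (b := 2))) hclosed ?_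
    rintro t ⟨⟨-, h1, h2, -⟩, h3, h4⟩
    exact ⟨⟨h3, h4⟩, by linarith, by linarith⟩
  obtain ⟨t, ht, hmin⟩ := hcomp.exists_isMinOn hne (f := fun t => t.2 - t.1) (by fun_prop)
  refine ⟨t.1, t.2, ht.1, fun d' c' h => ?_⟩
  obtain ⟨n, hn⟩ := hfr d' c' h
  have := isMinOn_iff.1 hmin _ hn
  simp only at this
  linarith

/-- The points that no leaf separates from the set `U`. -/
def unlHull (L : Set Chord) (U : Set S1) : Set S1 := {x | Unl L (insert x U)}

lemma subset_unlHull {L : Set Chord} {U : Set S1} (hU : Unl L U) : U ⊆ unlHull L U := by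
  intro x hx
  change Unl L (insert x U)
  rwa [insert_eq_of_mem hx]

lemma exists_off_leaf {U : Set S1} (hinf : U.Infinite) {p q : ℝ} (_ : p < q) :
    ∃ w : ℝ, (w : S1) ∈ U ∧ p < w ∧ w < p + 1 ∧ w ≠ q := by
  obtain ⟨w, hw, hwS⟩ := (hinf.sdiff (Set.toFinite {(p : S1), (q : S1)})).nonempty
  simp only [mem_insert_iff, mem_singleton_iff, not_or] at hwS
  obtain ⟨x, h1, h2, rfl⟩ := exists_lift_Ioo w p (Ne.symm hwS.1)
  exact ⟨x, hw, h1, h2, fun e => hwS.2 (by rw [e])⟩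

lemma Unl.of_two {L : Set Chord} {B V : Set S1} (hV : V.Infinite)
    (h : ∀ x ∈ B, Unl L (insert x V)) : Unl L B := by
  intro p x q y hl hx hy h1 h2 h3 h4
  obtain ⟨w, hw, h5, h6, h7⟩ := exists_off_leaf hV (h1.trans h2)
  rcases lt_or_gt_of_ne h7 with h7 | h7
  · exact h _ hy p w q y hl (mem_insert_of_mem _ hw) (mem_insert _ _) h5 h7 h3 h4
  · exact h _ hx p x q w hl (mem_insert _ _) (mem_insert_of_mem _ hw) h1 h2 h7 h6

lemma unl_unlHull {L : Set Chord} {U : Set S1} (hinf : U.Infinite) : Unl L (unlHull L U) :=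
  Unl.of_two hinf fun _ hx => hx

lemma unlHull_max {L : Set Chord} {U : Set S1} (hU : Unl L U) {z : S1}
    (hz : Unl L (insert z (unlHull L U))) : z ∈ unlHull L U :=
  hz.mono (insert_subset_insert (subset_unlHull hU))

lemma unlHull_inv {L : Set Chord} (hL : IsInvLam L) {U : Set S1} (hU : Unl L U)
    (hinf : U.Infinite) {p : ℕ} (h : ∀ x ∈ U, s3^[p] x ∈ U) :
    ∀ x ∈ unlHull L U, s3^[p] x ∈ unlHull L U := by
  intro x hx
  have h1 : Unl L (s3^[p] '' insert x U) := Unl.iterate hL hx p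
  have h2 : (s3^[p] '' U).Infinite := infinite_iterate_image hinf p
  have h3 : s3^[p] '' U ⊆ U := by rintro _ ⟨y, hy, rfl⟩; exact h y hy
  refine Unl.of_two h2 ?_
  rintro y (rfl | hy)
  · rwa [image_insert_eq] at h1
  · exact hU.mono (insert_subset hy h3)

lemma Folding.hull {L : Set Chord} {U : Set S1} {b a b' a' : ℝ} (F : Folding L U b a b' a') :
    Folding L (unlHull L U) b a b' a' where
  unl := unl_unlHull F.inf
  inf := F.inf.mono (subset_unlHull F.unl)
  leaf := F.leaf
  leaf' := F.leaf'
  hb := subset_unlHull F.unl F.hb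
  ha := subset_unlHull F.unl F.ha
  hb' := subset_unlHull F.unl F.hb'
  ha' := subset_unlHull F.unl F.ha'
  ne := F.ne
  hbb := F.hbb
  haa := F.haa

/-- A maximal unseparated set `U`, invariant under an iterate of the tripling map, together with
the leaves `{d, d + 1/3 + η}` and `{d + η, d + 1/3}` bounding the strip containing it. -/
structure Core (L : Set Chord) (U : Set S1) (p : ℕ) (d η : ℝ) : Prop where
  lam : IsCubicSymLam L
  unl : Unl L U
  inf : U.Infinite
  max : ∀ z, Unl L (insert z U) → z ∈ U
  inv : ∀ x ∈ U, s3^[p] x ∈ U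
  one_le : 1 ≤ p
  pos : 0 < η
  le : η ≤ 1/6
  leaf : Lf L d (d + 1/3 + η)
  leaf' : Lf L (d + η) (d + 1/3)
  out : ∀ x : ℝ, (x : S1) ∈ U → d + 1/3 + η < x → x < d + 1 → False
  mid : ∀ x : ℝ, (x : S1) ∈ U → d + η < x → x < d + 1/3 → False
  strip : ∀ u v : ℝ, Lf L u v → d ≤ u → u ≤ d + η → d + 1/3 ≤ v → v ≤ d + 1/3 + η →
    (u = d ∧ v = d + 1/3 + η) ∨ (u = d + η ∧ v = d + 1/3)
  mem0 : (d : S1) ∈ U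
  mem1 : ((d + η : ℝ) : S1) ∈ U
  mem2 : ((d + 1/3 : ℝ) : S1) ∈ U
  mem3 : ((d + 1/3 + η : ℝ) : S1) ∈ U

lemma Lf.shift {L : Set Chord} {p q p' q' : ℝ} (h : Lf L p q) (m n : ℤ) (hp : p' = p + m)
    (hq : q' = q + n) : Lf L p' q' :=
  h.congr (coe_eq_iff.2 ⟨m, hp⟩) (coe_eq_iff.2 ⟨n, hq⟩)

lemma Unl.insert {L : Set Chord} {U : Set S1} (hU : Unl L U) {z : ℝ}
    (h : ∀ p q y : ℝ, Lf L p q → (y : S1) ∈ U → p < z → z < q → q < y → y < p + 1 → False) :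
    Unl L (insert (z : S1) U) := by
  intro p x q y hl hx hy h1 h2 h3 h4
  rcases hx with hx | hx <;> rcases hy with hy | hy
  · obtain ⟨n, hn⟩ := coe_eq_iff.1 (hx.trans hy.symm)
    have h5 : (0:ℝ) < -n := by linarith
    have h6 : (-n:ℝ) < 1 := by linarith
    norm_cast at h5 h6
    lia
  · obtain ⟨n, hn⟩ := coe_eq_iff.1 hx
    exact h (p - n) (q - n) (y - n) (hl.shift (-n) (-n) (by push_cast; ring) (by push_cast; ring))
      (mem_shift hy (-n) (by push_cast; ring)) (by linarith) (by linarith) (by linarith)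
      (by linarith)
  · obtain ⟨n, hn⟩ := coe_eq_iff.1 hy
    exact h (q - n) (p + 1 - n) (x + 1 - n)
      (hl.symm.shift (-n) (1 - n) (by push_cast; ring) (by push_cast; ring))
      (mem_shift hx (1 - n) (by push_cast; ring)) (by linarith) (by linarith) (by linarith)
      (by linarith)
  · exact hU p x q y hl hx hy h1 h2 h3 h4

lemma Folding.exists_core {L : Set Chord} (hL : IsCubicSymLam L) {U : Set S1} {b a b' a' : ℝ}
    (F : Folding L U b a b' a') (hmax : ∀ z, Unl L (insert z U) → z ∈ U) {p : ℕ} (hp : 1 ≤ p)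
    (hinv : ∀ x ∈ U, s3^[p] x ∈ U) : ∃ d η : ℝ, Core L U p d η := by
  obtain ⟨d, c, hA, hmin⟩ := F.exists_min hL
  obtain ⟨α, β, h1, h2, h3, ma, mb, ma', mb'⟩ := F.exists_pair hA
  obtain ⟨hM, hdc, hc, hout⟩ := hA
  obtain ⟨η, rfl⟩ : ∃ η, c = d + 1/3 + η := ⟨c - (d + 1/3), by ring⟩
  have hη : 0 < η := by linarith
  have hη6 : η ≤ 1/6 := by linarith
  have hI := hL.toIsLamination
  have hU := F.unl
  have hM' : Lf L (d + η) (d + 1/3) := by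
    have hn : ((3 * d : ℝ) : S1) ≠ ((3 * (d + 1/3 + η) : ℝ) : S1) := by
      rw [show ((3 * (d + 1/3 + η) : ℝ) : S1) = ((3 * d + 3 * η : ℝ) : S1) from
        coe_eq_iff.2 ⟨1, by push_cast; ring⟩]
      exact coe_ne_of_lt (by linarith) (by linarith)
    rcases hM.sib hL.toIsInvLam hn with ⟨h, -⟩ | ⟨h, -⟩
    · exact (Lf.noX hI hM h (by linarith) (by linarith) (by linarith) (by linarith)).elim
    · exact h.symm.shift (-1) 0 (by push_cast; ring) (by push_cast; ring)
  have hmid : ∀ x : ℝ, (x : S1) ∈ U → d + η < x → x < d + 1/3 → False := fun x hx x1 x2 =>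
    hU (d + η) x (d + 1/3) (α + 1) hM' hx (mem_shift ma 1 (by push_cast; ring)) x1 x2
      (by linarith) (by linarith)
  have inner : ∀ u v : ℝ, Lf L u v → d ≤ u → v ≤ d + 1/3 + η → u ≤ α → β + 1/3 ≤ v →
      u = d ∧ v = d + 1/3 + η := by
    intro u v hl k1 k2 k3 k4
    have := hmin u v ⟨hl, by linarith, by linarith, fun x hx x1 x2 =>
      hU u β v x hl mb hx (by linarith) (by linarith) x1 x2⟩
    constructor <;> linarith
  have strip : ∀ u v : ℝ, Lf L u v → d ≤ u → u ≤ d + η → d + 1/3 ≤ v → v ≤ d + 1/3 + η →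
      (u = d ∧ v = d + 1/3 + η) ∨ (u = d + η ∧ v = d + 1/3) := by
    intro u v hl k1 k2 k3 k4
    rcases le_or_gt u α with k5 | k5
    · refine Or.inl (inner u v hl k1 k4 k5 (le_of_not_gt fun k6 => ?_))
      exact hU u β v (β + 1/3) hl mb mb' (by linarith) (by linarith) k6 (by linarith)
    have k6 : β ≤ u := le_of_not_gt fun k6 =>
      hU u β v (α + 1) hl mb (mem_shift ma 1 (by push_cast; ring)) k6 (by linarith)
        (by linarith) (by linarith)
    have k7 : v ≤ α + 1/3 := le_of_not_gt fun k7 =>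
      hU u (α + 1/3) v (α + 1) hl ma' (mem_shift ma 1 (by push_cast; ring)) (by linarith) k7
        (by linarith) (by linarith)
    have hn : ((3 * u : ℝ) : S1) ≠ ((3 * v : ℝ) : S1) := coe_ne_of_lt (by linarith) (by linarith)
    right
    rcases hl.sib hL.toIsInvLam hn with ⟨h, h'⟩ | ⟨h', -⟩
    · rcases k2.lt_or_eq with k2 | k2
      · exact (Lf.noX hI hM h (by linarith) (by linarith) (by linarith) (by linarith)).elim
      refine ⟨k2, k3.eq_or_lt.elim Eq.symm fun k3 => ?_⟩
      exact (Lf.noX hI hM (h'.symm.shift (-1) 0 (p' := v + 2/3 - 1) (q' := u + 2/3)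
        (by push_cast; ring) (by push_cast; ring)) (by linarith) (by linarith) (by linarith)
        (by linarith)).elim
    · obtain ⟨e1, e2⟩ := inner (v - 1/3) (u + 1/3) (h'.symm.shift (-1) 0
        (by push_cast; ring) (by push_cast; ring)) (by linarith) (by linarith) (by linarith)
        (by linarith)
      constructor <;> linarith
  refine ⟨d, η, hL, hU, F.inf, hmax, hinv, hp, hη, hη6, hM, hM', hout, hmid, strip,
    hmax _ (hU.insert ?_), hmax _ (hU.insert ?_), hmax _ (hU.insert ?_), hmax _ (hU.insert ?_)⟩
  · intro p q y hl hy h4 h5 h6 h7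
    have k1 : y ≤ d + 1/3 + η := le_of_not_gt fun k => hout y hy k (by linarith)
    have k2 : p + 1 ≤ d + 1/3 + η := le_of_not_gt fun k =>
      Lf.noX hI hl hM h4 h5 (by linarith) k
    have k3 : q ≤ α := le_of_not_gt fun k => hU p α q y hl ma hy (by linarith) k h6 h7
    have k4 : β + 1/3 ≤ p + 1 := le_of_not_gt fun k =>
      hU p (β + 1/3 - 1) q y hl (mem_shift mb' (-1) (by push_cast; ring)) hy (by linarith)
        (by linarith) h6 h7
    have := inner q (p + 1) (hl.symm.shift 0 1 (by push_cast; ring) (by push_cast; ring))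
      (by linarith) k2 k3 k4
    linarith [this.1]
  · intro p q y hl hy h4 h5 h6 h7
    have k1 : d + 1/3 ≤ q := le_of_not_gt fun k => by
      refine Lf.noX hI hl hM' h4 h5 k (lt_of_not_ge fun k' => ?_)
      exact hmid y hy (by linarith) (by linarith)
    have k2 : α ≤ p := le_of_not_gt fun k => hU p α q y hl ma hy k (by linarith) h6 h7
    have k3 : q ≤ α + 1/3 := le_of_not_gt fun k =>
      hU p (α + 1/3) q y hl ma' hy (by linarith) k h6 h7
    rcases strip p q hl (by linarith) h4.le k1 (by linarith) with ⟨e1, e2⟩ | ⟨e1, e2⟩ <;> linarith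
  · intro p q y hl hy h4 h5 h6 h7
    have k1 : p ≤ d + η := le_of_not_gt fun k => by
      refine Lf.noX hI hM' hl k h4 h5 (lt_of_not_ge fun k' => ?_)
      exact hmid (y - 1) (mem_shift hy (-1) (by push_cast; ring)) (by linarith) (by linarith)
    have k2 : q ≤ β + 1/3 := le_of_not_gt fun k =>
      hU p (β + 1/3) q y hl mb' hy (by linarith) k h6 h7
    have k3 : β ≤ p := le_of_not_gt fun k => hU p β q y hl mb hy k (by linarith) h6 h7
    rcases strip p q hl (by linarith) k1 h5.le (by linarith) with ⟨e1, e2⟩ | ⟨e1, e2⟩ <;> linarith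
  · intro p q y hl hy h4 h5 h6 h7
    have k1 : d + 1 ≤ y := le_of_not_gt fun k => hout y hy (by linarith) k
    have k2 : d + 1 ≤ q := le_of_not_gt fun k =>
      Lf.noX hI hM (hl) (by linarith) h4 h5 k
    have k3 : q ≤ α + 1 := le_of_not_gt fun k =>
      hU p (α + 1) q y hl (mem_shift ma 1 (by push_cast; ring)) hy (by linarith) k h6 h7
    have k4 : β + 1/3 ≤ p := le_of_not_gt fun k =>
      hU p (β + 1/3) q y hl mb' hy k (by linarith) h6 h7
    have := inner (q - 1) p (hl.symm.shift (-1) 0 (by push_cast; ring) (by push_cast; ring))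
      (by linarith) h4.le (by linarith) k4
    linarith [this.2]

section

/-- The reals `x` and `y` are at distance at least `δ` modulo one. -/
def Far (δ x y : ℝ) : Prop := ∀ n : ℤ, δ ≤ |x - y - n|

lemma Far.mono {δ δ' x y : ℝ} (h : Far δ x y) (hd : δ' ≤ δ) : Far δ' x y :=
  fun n => hd.trans (h n)

lemma exists_far {x y : ℝ} (h : (x : S1) ≠ y) : ∃ δ > 0, Far δ x y := by
  obtain ⟨t, h1, h2, e⟩ := exists_lift_Ioo (x : S1) y h.symm
  obtain ⟨m, rfl⟩ := coe_eq_iff.1 e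
  refine ⟨min (x + m - y) (y + 1 - (x + m)), lt_min (by linarith) (by linarith), fun n => ?_⟩
  rcases le_or_gt (-m) n with h3 | h3
  · rcases h3.eq_or_lt with rfl | h3
    · refine (min_le_left _ _).trans ?_
      rw [abs_of_nonneg] <;> push_cast <;> linarith
    · have : (-m + 1 : ℝ) ≤ n := by exact_mod_cast h3
      refine (min_le_right _ _).trans ?_
      rw [abs_of_nonpos] <;> linarith
  · have : (n + 1 : ℝ) ≤ -m := by exact_mod_cast h3
    refine (min_le_left _ _).trans ?_
    rw [abs_of_nonneg] <;> linarith

/-- Differences avoiding a neighbourhood of `±1/3` grow under tripling. -/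
lemma Far.three {δ η x y : ℝ} (h : Far δ x y)
    (h1 : ∀ n : ℤ, ¬ (1/3 - η < x - y - n ∧ x - y - n < 1/3 + η))
    (h2 : ∀ n : ℤ, ¬ (1/3 - η < y - x - n ∧ y - x - n < 1/3 + η)) :
    Far (min (3 * δ) (3 * η)) (3 * x) (3 * y) := by
  intro n
  obtain ⟨m, hm | hm | hm⟩ : ∃ m : ℤ, n = 3 * m ∨ n = 3 * m + 1 ∨ n = 3 * m + 2 :=
    ⟨n / 3, by lia⟩
  · subst hm
    refine (min_le_left _ _).trans ?_
    have := h m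
    rw [show 3 * x - 3 * y - ((3 * m : ℤ) : ℝ) = 3 * (x - y - m) by push_cast; ring, abs_mul]
    norm_num
    linarith
  · subst hm
    refine (min_le_right _ _).trans ?_
    have := h1 m
    push_cast
    rw [le_abs]
    by_contra! h3
    exact this ⟨by linarith, by linarith⟩
  · subst hm
    refine (min_le_right _ _).trans ?_
    have := h2 (-m - 1)
    push_cast at *
    rw [le_abs]
    by_contra! h3
    exact this ⟨by linarith, by linarith⟩

variable {L : Set Chord} {U : Set S1} {p : ℕ} {d η : ℝ}

lemma Core.isLam (C : Core L U p d η) : IsLamination L := C.lam.toIsLamination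

lemma Core.isInv (C : Core L U p d η) : IsInvLam L := C.lam.toIsInvLam

lemma Core.no_medium_aux (C : Core L U p d η) {x y : ℝ} (h : Lf L x y) (h1 : 1/3 - η < y - x)
    (h2 : y - x < 1/3 + η) (hx : d ≤ x) (hx' : x < d + 1/2) : False := by
  have p1 := C.pos
  have p2 := C.le
  have hI := C.isLam
  rcases le_or_gt x (d + η) with k1 | k1
  · have k2 : d + 1/3 ≤ y := by
      by_contra! k2
      rcases k1.lt_or_eq with k1 | k1
      · exact Lf.noX hI h C.leaf' k1 (by linarith) k2 (by linarith)
      · linarith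
    have k3 : y ≤ d + 1/3 + η := by
      by_contra! k3
      exact Lf.noX hI C.leaf h (by linarith) (by linarith) k3 (by linarith)
    rcases C.strip x y h hx k1 k2 k3 with ⟨e1, e2⟩ | ⟨e1, e2⟩ <;> linarith
  rcases lt_or_ge x (d + 1/3) with k2 | k2
  · exact Lf.noX hI C.leaf' h k1 k2 (by linarith) (by linarith)
  rcases lt_or_ge x (d + 1/3 + η) with k3 | k3
  · exact Lf.noX hI C.leaf h (by linarith) k3 (by linarith) (by linarith)
  · refine Lf.noX hI h (C.leaf.half C.lam) hx' (by linarith) (by linarith) (by linarith)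

/-- No leaf has length in `(1/3 - η, 1/3 + η)`. -/
lemma Core.no_medium (C : Core L U p d η) {x y : ℝ} (h : Lf L x y) (n : ℤ) :
    ¬ (1/3 - η < y - x - n ∧ y - x - n < 1/3 + η) := by
  rintro ⟨h1, h2⟩
  obtain ⟨t, h3, h4, e⟩ := exists_lift (x : S1) d
  obtain ⟨m, rfl⟩ := coe_eq_iff.1 e
  have h' : Lf L (x + m) (y + m - n) :=
    h.shift m (m - n) rfl (by push_cast; ring)
  rcases lt_or_ge (x + m) (d + 1/2) with h5 | h5
  · exact C.no_medium_aux h' (by linarith) (by linarith) h3 h5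
  · exact C.no_medium_aux ((h'.half C.lam).shift (-1) (-1) (p' := x + m - 1/2)
      (q' := y + m - n - 1/2) (by push_cast; ring) (by push_cast; ring)) (by linarith)
      (by linarith) (by linarith) (by linarith)

lemma Core.leaf_three (C : Core L U p d η) {x y : ℝ} (h : Lf L x y) : Lf L (3 * x) (3 * y) := by
  refine h.three C.isInv fun e => ?_
  obtain ⟨n, hn⟩ := coe_eq_iff.1 e.symm
  have p1 := C.pos
  obtain ⟨m, hm | hm | hm⟩ : ∃ m : ℤ, n = 3 * m ∨ n = 3 * m + 1 ∨ n = 3 * m + 2 :=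
    ⟨n / 3, by lia⟩
  · refine h.2 (coe_eq_iff.2 ⟨-m, ?_⟩)
    subst hm; push_cast at *; linarith
  · refine C.no_medium h m ?_
    subst hm; push_cast at *; constructor <;> linarith
  · refine C.no_medium h.symm (-m - 1) ?_
    subst hm; push_cast at *; constructor <;> linarith

lemma Core.far_three (C : Core L U p d η) {x y : ℝ} (h : Lf L x y) {δ : ℝ} (hs : Far δ x y) :
    Far (min (3 * δ) (3 * η)) (3 * x) (3 * y) :=
  hs.three (fun n => C.no_medium h.symm n) (fun n => C.no_medium h n)

lemma s3_iterate_coe (n : ℕ) (x : ℝ) : s3^[n] (x : S1) = ((3 ^ n * x : ℝ) : S1) := by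
  induction n with
  | zero => simp
  | succ n ih => rw [Function.iterate_succ_apply', ih, s3_coe, pow_succ]; congr 1; ring

lemma Core.leaf_iterate (C : Core L U p d η) {x y : ℝ} (h : Lf L x y) (n : ℕ) :
    Lf L (3 ^ n * x) (3 ^ n * y) := by
  induction n with
  | zero => simpa using h
  | succ n ih =>
    have := C.leaf_three ih
    rwa [← mul_assoc, ← mul_assoc, ← pow_succ'] at this

lemma Core.far_iterate (C : Core L U p d η) {x y : ℝ} (h : Lf L x y) {δ : ℝ}
    (hs : Far δ x y) (n : ℕ) : Far (min (3 ^ n * δ) (3 * η)) (3 ^ n * x) (3 ^ n * y) := by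
  induction n with
  | zero => simpa using hs.mono (min_le_left _ _)
  | succ n ih =>
    have := C.far_three (C.leaf_iterate h n) ih
    rw [← mul_assoc, ← mul_assoc, ← pow_succ'] at this
    refine this.mono (le_min ?_ (min_le_right _ _))
    rw [mul_min_of_nonneg _ _ (by norm_num)]
    refine le_min ((min_le_left _ _).trans (by rw [pow_succ']; linarith)) ((min_le_right _ _).trans ?_)
    linarith [C.pos]

lemma Core.eventually_far (C : Core L U p d η) {x y : ℝ} (h : Lf L x y) :
    ∃ k : ℕ, ∀ n, k ≤ n → Far (3 * η) (3 ^ n * x) (3 ^ n * y) := by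
  obtain ⟨δ, hδ, hs⟩ := exists_far h.2
  obtain ⟨k, hk⟩ := pow_unbounded_of_one_lt (3 * η / δ) (show (1:ℝ) < 3 by norm_num)
  refine ⟨k, fun n hn => (C.far_iterate h hs n).mono (le_min ?_ le_rfl)⟩
  rw [div_lt_iff₀ hδ] at hk
  have : (3:ℝ) ^ k ≤ 3 ^ n := pow_le_pow_right₀ (by norm_num) hn
  nlinarith

/-- Points of `U` have a lift in one of the two arcs of the strip. -/
lemma Core.exists_strip_lift (C : Core L U p d η) {x : ℝ} (hx : (x : S1) ∈ U) :
    ∃ n : ℤ, (d ≤ x + n ∧ x + n ≤ d + η) ∨ (d + 1/3 ≤ x + n ∧ x + n ≤ d + 1/3 + η) := by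
  obtain ⟨t, h3, h4, e⟩ := exists_lift (x : S1) d
  obtain ⟨m, rfl⟩ := coe_eq_iff.1 e
  refine ⟨m, ?_⟩
  have hx' := mem_shift hx m rfl
  by_contra! h
  rcases le_or_gt (x + m) (d + η) with h5 | h5
  · linarith [h.1 h3]
  rcases lt_or_ge (x + m) (d + 1/3) with h6 | h6
  · exact C.mid _ hx' h5 h6
  · exact C.out _ hx' (h.2 h6) h4

/-- A long leaf with endpoints in `U` has the same image as the sides of the strip. -/
lemma Core.image_eq (C : Core L U p d η) {x y : ℝ} (h : Lf L x y) (hx : (x : S1) ∈ U)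
    (hy : (y : S1) ∈ U) (hs : Far (3 * η) x y) :
    s(((3 * x : ℝ) : S1), ((3 * y : ℝ) : S1)) =
      s(((3 * d : ℝ) : S1), ((3 * (d + 1/3 + η) : ℝ) : S1)) := by
  have p1 := C.pos
  have key : ∀ x y : ℝ, Lf L x y → ∀ m n : ℤ, d ≤ x + m → x + m ≤ d + η → d + 1/3 ≤ y + n →
      y + n ≤ d + 1/3 + η → s(((3 * x : ℝ) : S1), ((3 * y : ℝ) : S1)) =
      s(((3 * d : ℝ) : S1), ((3 * (d + 1/3 + η) : ℝ) : S1)) := by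
    intro x y h m n h1 h2 h3 h4
    rcases C.strip _ _ (h.shift m n rfl rfl) h1 h2 h3 h4 with ⟨e1, e2⟩ | ⟨e1, e2⟩
    · congr 1
      · exact coe_eq_iff.2 ⟨-(3 * m), by push_cast; linarith⟩
      · exact coe_eq_iff.2 ⟨-(3 * n), by push_cast; linarith⟩
    · rw [Sym2.eq_swap]
      congr 1
      · exact coe_eq_iff.2 ⟨1 - 3 * n, by push_cast; linarith⟩
      · exact coe_eq_iff.2 ⟨-1 - 3 * m, by push_cast; linarith⟩
  obtain ⟨m, ⟨h1, h2⟩ | ⟨h1, h2⟩⟩ := C.exists_strip_lift hx <;>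
  obtain ⟨n, ⟨h3, h4⟩ | ⟨h3, h4⟩⟩ := C.exists_strip_lift hy
  · have := hs (n - m)
    push_cast at this
    rw [le_abs] at this
    rcases this with h | h <;> linarith
  · exact key x y h m n h1 h2 h3 h4
  · rw [Sym2.eq_swap]; exact key y x h.symm n m h3 h4 h1 h2
  · have := hs (n - m)
    push_cast at this
    rw [le_abs] at this
    rcases this with h | h <;> linarith

lemma Core.mem_iterate (C : Core L U p d η) {x : ℝ} (hx : (x : S1) ∈ U) (n : ℕ) :
    ((3 ^ (p * n) * x : ℝ) : S1) ∈ U := by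
  rw [← s3_iterate_coe]
  induction n with
  | zero => simpa using hx
  | succ n ih => rw [mul_add, mul_one, add_comm, Function.iterate_add_apply]; exact C.inv _ ih

/-- Distinct leaves with endpoints in `U` have no common endpoint. -/
lemma Core.no_share (C : Core L U p d η) {x y z : ℝ} (hx : (x : S1) ∈ U) (hy : (y : S1) ∈ U)
    (hz : (z : S1) ∈ U) (h1 : Lf L y x) (h2 : Lf L y z) (hxz : (x : S1) ≠ z) : False := by
  obtain ⟨k1, hk1⟩ := C.eventually_far h1
  obtain ⟨k2, hk2⟩ := C.eventually_far h2
  have hle : ∀ k, k ≤ p * k := fun k => Nat.le_mul_of_pos_left _ C.one_le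
  set N := k1 + k2
  have e1 := C.image_eq (C.leaf_iterate h1 (p * N)) (C.mem_iterate hy N) (C.mem_iterate hx N)
    (hk1 _ ((Nat.le_add_right _ _).trans (hle _)))
  have e2 := C.image_eq (C.leaf_iterate h2 (p * N)) (C.mem_iterate hy N) (C.mem_iterate hz N)
    (hk2 _ ((Nat.le_add_left _ _).trans (hle _)))
  have e3 : ((3 * (3 ^ (p * N) * x) : ℝ) : S1) = ((3 * (3 ^ (p * N) * z) : ℝ) : S1) := by
    have e4 := e1.trans e2.symm
    rw [Sym2.eq_iff] at e4
    rcases e4 with ⟨-, e⟩ | ⟨e, e'⟩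
    · exact e
    · rw [e', e]
  have hex : ∃ n : ℕ, ((3 ^ n * x : ℝ) : S1) = ((3 ^ n * z : ℝ) : S1) :=
    ⟨p * N + 1, by rw [pow_succ', mul_assoc, mul_assoc]; exact e3⟩
  classical
  obtain ⟨n, hn⟩ : ∃ n, Nat.find hex = n + 1 := by
    refine ⟨Nat.find hex - 1, (Nat.succ_pred_eq_of_pos ?_).symm⟩
    rw [Nat.find_pos]
    simpa using hxz
  have m1 := Nat.find_spec hex
  have m2 := Nat.find_min hex (m := n) (by lia)
  rw [hn] at m1
  have mem : ∀ x : ℝ, (x : S1) ∈ U → ((3 ^ n * x : ℝ) : S1) ∈ s3^[n] '' U := fun x hx =>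
    ⟨x, hx, s3_iterate_coe n x⟩
  refine (C.unl.iterate C.isInv n).no_fold C.isInv (infinite_iterate_image C.inf n) (mem x hx)
    (mem y hy) (mem z hz) (C.leaf_iterate h1 n) (C.leaf_iterate h2 n) m2 ?_
    (C.leaf_three (C.leaf_iterate h1 n)).2
  rwa [← mul_assoc, ← mul_assoc, ← pow_succ']

end

section

variable {L : Set Chord} {U : Set S1} {p : ℕ} {d η : ℝ}

lemma Core.no_leaf_left (C : Core L U p d η) {z : ℝ} (h1 : d < z) (h2 : z ≤ d + η)
    (h : Lf L d z) : False := by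
  have p1 := C.pos
  have p2 := C.le
  have hI := C.isLam
  set S : Set ℝ := {z | d < z ∧ z ≤ d + η ∧ Lf L d z} with hS
  have hb : BddAbove S := ⟨d + η, fun z hz => hz.2.1⟩
  have hz : z ∈ S := ⟨h1, h2, h⟩
  have z1 : d < sSup S := h1.trans_le (le_csSup hb hz)
  have z2 : sSup S ≤ d + η := csSup_le ⟨z, hz⟩ fun z hz => hz.2.1
  set Z := sSup S with hZ
  have hl : Lf L d Z := by
    refine Lf.of_approx hI (coe_ne_of_lt z1 (by linarith)) fun ε hε => ?_
    obtain ⟨w, hw, hw'⟩ := exists_lt_of_lt_csSup ⟨z, hz⟩ (show sSup S - ε < sSup S by linarith)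
    refine ⟨d, w, hw.2.2, by simpa using hε, ?_⟩
    rw [abs_lt]
    constructor <;> linarith [le_csSup hb hw]
  have hZU : (Z : S1) ∈ U := by
    rcases z2.eq_or_lt with e | z2
    · rw [e]; exact C.mem1
    refine C.max _ (C.unl.insert fun a q y hla hy k1 k2 k3 k4 => ?_)
    have k5 : d ≤ a := le_of_not_gt fun k =>
      C.unl a d q y hla C.mem0 hy k (by linarith) k3 k4
    have k6 : q ≤ d + η := le_of_not_gt fun k =>
      C.unl a (d + η) q y hla C.mem1 hy (by linarith) k k3 k4
    rcases k5.eq_or_lt with e | k5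
    · have : q ∈ S := ⟨by linarith, k6, by rwa [e]⟩
      linarith [le_csSup hb this]
    · exact Lf.noX hI hl hla k5 k1 k2 (by linarith)
  refine C.no_share hZU C.mem0 C.mem3 hl C.leaf (coe_ne_of_lt ?_ ?_) <;> linarith

lemma Core.no_leaf_right (C : Core L U p d η) {z : ℝ} (h1 : d ≤ z) (h2 : z < d + η)
    (h : Lf L (d + η) z) : False := by
  have p1 := C.pos
  have p2 := C.le
  have hI := C.isLam
  set S : Set ℝ := {z | d ≤ z ∧ z < d + η ∧ Lf L (d + η) z} with hS
  have hb : BddBelow S := ⟨d, fun z hz => hz.1⟩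
  have hz : z ∈ S := ⟨h1, h2, h⟩
  have z1 : sInf S < d + η := (csInf_le hb hz).trans_lt h2
  have z2 : d ≤ sInf S := le_csInf ⟨z, hz⟩ fun z hz => hz.1
  set Z := sInf S with hZ
  have hl : Lf L (d + η) Z := by
    refine Lf.of_approx hI (coe_ne_of_lt z1 (by linarith)).symm fun ε hε => ?_
    obtain ⟨w, hw, hw'⟩ := exists_lt_of_csInf_lt ⟨z, hz⟩ (show sInf S < sInf S + ε by linarith)
    refine ⟨d + η, w, hw.2.2, by simpa using hε, ?_⟩
    rw [abs_lt]
    constructor <;> linarith [csInf_le hb hw]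
  have hZU : (Z : S1) ∈ U := by
    rcases z2.eq_or_lt with e | z2
    · rw [← e]; exact C.mem0
    refine C.max _ (C.unl.insert fun a q y hla hy k1 k2 k3 k4 => ?_)
    have k5 : d ≤ a := le_of_not_gt fun k =>
      C.unl a d q y hla C.mem0 hy k (by linarith) k3 k4
    have k6 : q ≤ d + η := le_of_not_gt fun k =>
      C.unl a (d + η) q y hla C.mem1 hy (by linarith) k k3 k4
    rcases k6.eq_or_lt with e | k6
    · have : a ∈ S := ⟨by linarith, by linarith, e ▸ hla.symm⟩
      linarith [csInf_le hb this]
    · exact Lf.noX hI hla hl.symm k1 k2 k6 (by linarith)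
  refine C.no_share hZU C.mem1 C.mem2 hl C.leaf' (coe_ne_of_lt ?_ ?_) <;> linarith

lemma Core.no_leaf_left' (C : Core L U p d η) {z : ℝ} (h1 : d + 1/3 < z) (h2 : z ≤ d + 1/3 + η)
    (h : Lf L (d + 1/3) z) : False := by
  have p1 := C.pos
  have p2 := C.le
  have hI := C.isLam
  rcases h.sib C.isInv (C.leaf_three h).2 with ⟨-, k⟩ | ⟨k, -⟩
  · exact C.no_leaf_left (z := z - 1/3) (by linarith) (by linarith)
      (k.shift (-1) (-1) (by push_cast; ring) (by push_cast; ring))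
  · exact Lf.noX hI (C.leaf) (k.symm.shift (-1) 0 (p' := z - 1/3) (q' := d + 2/3)
      (by push_cast; ring) (by push_cast; ring)) (by linarith) (by linarith) (by linarith)
      (by linarith)

lemma Core.no_leaf_right' (C : Core L U p d η) {z : ℝ} (h1 : d + 1/3 ≤ z)
    (h2 : z < d + 1/3 + η) (h : Lf L (d + 1/3 + η) z) : False := by
  have p1 := C.pos
  have p2 := C.le
  have hI := C.isLam
  rcases h.sib C.isInv (C.leaf_three h).2 with ⟨-, k⟩ | ⟨-, k⟩
  · exact C.no_leaf_right (z := z - 1/3) (by linarith) (by linarith)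
      (k.shift (-1) (-1) (by push_cast; ring) (by push_cast; ring))
  · exact Lf.noX hI (C.leaf) (k.shift (-1) 0 (p' := d + η) (q' := z + 1/3)
      (by push_cast; ring) (by push_cast; ring)) (by linarith) (by linarith) (by linarith)
      (by linarith)

lemma Core.leaf_region_aux (C : Core L U p d η) {x y : ℝ} (h : Lf L x y) (h1 : d ≤ x)
    (h2 : x < d + 1/2) (h3 : x < y) (h4 : y < d + 1) :
    (d < x ∧ y < d + η) ∨ (d + η ≤ x ∧ y ≤ d + 1/3) ∨ (d + 1/3 < x ∧ y < d + 1/3 + η) ∨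
      ((x = d ∨ d + 1/3 + η ≤ x) ∧ d + 1/3 + η ≤ y ∧ (y ≤ d + 1/2 ∨ d + 5/6 + η ≤ y)) := by
  have p1 := C.pos
  have p2 := C.le
  have hI := C.isLam
  have hM := C.leaf.half C.lam
  rcases h1.eq_or_lt with e | h1
  · subst e
    have k1 : d + η < y := lt_of_not_ge fun k => C.no_leaf_left h3 k h
    have k2 : d + 1/3 ≤ y := le_of_not_gt fun k =>
      Lf.noX hI h C.leaf' (by linarith) k1 k (by linarith)
    have k3 : d + 1/3 + η ≤ y := le_of_not_gt fun k => by
      rcases C.strip d y h le_rfl (by linarith) k2 k.le with ⟨e1, e2⟩ | ⟨e1, e2⟩ <;> linarith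
    refine Or.inr (Or.inr (Or.inr ⟨Or.inl rfl, k3, ?_⟩))
    by_contra! k
    rcases p2.eq_or_lt with e | p2
    · have h' := (h.half C.lam).shift 0 (-1) (p' := d + 1/3 + η) (q' := y - 1/2)
        (by push_cast; linarith) (by push_cast; ring)
      have k4 : y - 1/2 < d + 1/3 := lt_of_not_ge fun k' =>
        C.no_leaf_right' k' (by linarith) h'
      have k5 : y - 1/2 ≤ d + η := le_of_not_gt fun k' =>
        Lf.noX hI C.leaf' h'.symm k' k4 (by linarith) (by linarith)
      rcases C.strip _ _ h'.symm (by linarith) k5 (by linarith) le_rfl with ⟨e1, e2⟩ | ⟨e1, e2⟩ <;>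
        linarith
    exact Lf.noX hI hM (h.symm.shift 0 1 (p' := y) (q' := d + 1) (by push_cast; ring)
      (by push_cast; ring)) k.1 (by linarith) (by linarith) (by linarith)
  rcases lt_or_ge x (d + η) with k1 | k1
  · left
    refine ⟨h1, lt_of_not_ge fun k => ?_⟩
    have k2 : y ≤ d + 1/3 + η := le_of_not_gt fun k =>
      Lf.noX hI C.leaf h h1 (by linarith) k h4
    rcases k.eq_or_lt with e | k
    · exact C.no_leaf_right h1.le k1 (e ▸ h.symm)
    have k3 : d + 1/3 ≤ y := le_of_not_gt fun k' =>
      Lf.noX hI h C.leaf' k1 k k' (by linarith)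
    rcases C.strip x y h h1.le k1.le k3 k2 with ⟨e1, e2⟩ | ⟨e1, e2⟩ <;> linarith
  rcases le_or_gt x (d + 1/3) with k2 | k2
  · refine Or.inr (Or.inl ⟨k1, le_of_not_gt fun k => ?_⟩)
    rcases k2.eq_or_lt with e | k2
    · subst e
      have k3 : y ≤ d + 1/3 + η := le_of_not_gt fun k =>
        Lf.noX hI C.leaf h h1 (by linarith) k h4
      exact C.no_leaf_left' k k3 h
    rcases k1.eq_or_lt with e | k1
    · have k3 : y ≤ d + 1/3 + η := le_of_not_gt fun k =>
        Lf.noX hI C.leaf h h1 (by linarith) k h4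
      rcases C.strip x y h h1.le (by linarith) k.le k3 with ⟨e1, e2⟩ | ⟨e1, e2⟩ <;> linarith
    · exact Lf.noX hI C.leaf' h k1 k2 k (by linarith)
  rcases lt_or_ge x (d + 1/3 + η) with k3 | k3
  · refine Or.inr (Or.inr (Or.inl ⟨k2, lt_of_not_ge fun k => ?_⟩))
    rcases k.eq_or_lt with e | k
    · exact C.no_leaf_right' k2.le k3 (e ▸ h.symm)
    · exact Lf.noX hI C.leaf h h1 k3 k h4
  · refine Or.inr (Or.inr (Or.inr ⟨Or.inr k3, by linarith, ?_⟩))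
    by_contra! k
    exact Lf.noX hI h hM h2 k.1 (by linarith) (by linarith)

/-- The region of the circle containing the angle `t ∈ (d, d + 1]`. -/
def regionIdx (d η t : ℝ) : ℕ :=
  if t < d + η then 0 else if t ≤ d + 1/3 then 1 else if t < d + 1/3 + η then 2 else
  if t ≤ d + 1/2 then 3 else if t < d + 1/2 + η then 4 else if t ≤ d + 5/6 then 5 else
  if t < d + 5/6 + η then 6 else 3

/-- The tripling map in a lift that is monotone on each region. -/
def triple (d η t : ℝ) : ℝ :=
  3 * t - if t ≤ d + 1/3 then 0 else if t < d + 1/2 + η then 1 else 2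

lemma Core.leaf_region (C : Core L U p d η) {x y : ℝ} (h : Lf L x y) (h1 : d < x)
    (h2 : x < y) (h3 : y ≤ d + 1) : regionIdx d η x = regionIdx d η y := by
  have p1 := C.pos
  have p2 := C.le
  unfold regionIdx
  rcases lt_or_ge x (d + 1/2) with k1 | k1
  · rcases h3.lt_or_eq with k2 | k2
    · rcases C.leaf_region_aux h h1.le k1 h2 k2 with k | k | k | k
      · rw [if_pos (by linarith), if_pos (by linarith)]
      · rw [if_neg (by linarith), if_pos (by linarith), if_neg (by linarith),
          if_pos (by linarith)]
      · rw [if_neg (by linarith), if_neg (by linarith), if_pos (by linarith),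
          if_neg (by linarith), if_neg (by linarith), if_pos (by linarith)]
      · have k3 := k.1.resolve_left h1.ne'
        rw [if_neg (by linarith), if_neg (by linarith), if_neg (by linarith),
          if_pos (by linarith), if_neg (by linarith), if_neg (by linarith),
          if_neg (by linarith)]
        rcases k.2.2 with k4 | k4
        · rw [if_pos k4]
        · rw [if_neg (by linarith), if_neg (by linarith), if_neg (by linarith),
            if_neg (by linarith)]
    · rcases C.leaf_region_aux (h.symm.shift (-1) 0 (p' := d) (q' := x) (by push_cast; linarith)
        (by push_cast; ring)) le_rfl (by linarith) h1 (by linarith) with k | k | k | k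
      · linarith
      · linarith
      · linarith
      · subst k2
        rw [if_neg (by linarith), if_neg (by linarith), if_neg (by linarith),
          if_pos (by linarith), if_neg (by linarith), if_neg (by linarith),
          if_neg (by linarith), if_neg (by linarith), if_neg (by linarith), if_neg (by linarith),
          if_neg (by linarith)]
  · have k2 := (h.half C.lam).shift (-1) (-1) (p' := x - 1/2) (q' := y - 1/2)
      (by push_cast; ring) (by push_cast; ring)
    rcases C.leaf_region_aux k2 (by linarith) (by linarith) (by linarith) (by linarith)
      with k | k | k | ⟨k, k3, -⟩
    · rw [if_neg (by linarith), if_neg (by linarith), if_neg (by linarith),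
        if_neg (by linarith), if_pos (by linarith), if_neg (by linarith),
        if_neg (by linarith), if_neg (by linarith), if_neg (by linarith), if_pos (by linarith)]
    · rw [if_neg (by linarith), if_neg (by linarith), if_neg (by linarith),
        if_neg (by linarith), if_neg (by linarith), if_pos (by linarith), if_neg (by linarith),
        if_neg (by linarith), if_neg (by linarith), if_neg (by linarith), if_neg (by linarith),
        if_pos (by linarith)]
    · rw [if_neg (by linarith), if_neg (by linarith), if_neg (by linarith),
        if_neg (by linarith), if_neg (by linarith), if_neg (by linarith), if_pos (by linarith),
        if_neg (by linarith), if_neg (by linarith), if_neg (by linarith), if_neg (by linarith),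
        if_neg (by linarith), if_neg (by linarith), if_pos (by linarith)]
    · rw [if_neg (by linarith : ¬ y < d + η), if_neg (by linarith : ¬ y ≤ d + 1/3),
        if_neg (by linarith : ¬ y < d + 1/3 + η), if_neg (by linarith : ¬ y ≤ d + 1/2),
        if_neg (by linarith : ¬ y < d + 1/2 + η), if_neg (by linarith : ¬ y ≤ d + 5/6),
        if_neg (by linarith : ¬ y < d + 5/6 + η), if_neg (by linarith), if_neg (by linarith)]
      rcases k with k | k
      · rw [if_neg (by linarith), if_pos (by linarith)]
      · rw [if_neg (by linarith), if_neg (by linarith), if_neg (by linarith),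
          if_neg (by linarith), if_neg (by linarith)]

/-- The possible positions of two angles in the same region. -/
lemma regionIdx_cases {x y : ℝ}
    (h : regionIdx d η x = regionIdx d η y) :
    (x < d + η ∧ y < d + η) ∨ (d + η ≤ x ∧ x ≤ d + 1/3 ∧ d + η ≤ y ∧ y ≤ d + 1/3) ∨
    (d + 1/3 < x ∧ x < d + 1/3 + η ∧ d + 1/3 < y ∧ y < d + 1/3 + η) ∨
    (((d + 1/3 + η ≤ x ∧ x ≤ d + 1/2) ∨ d + 5/6 + η ≤ x) ∧
      ((d + 1/3 + η ≤ y ∧ y ≤ d + 1/2) ∨ d + 5/6 + η ≤ y)) ∨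
    (d + 1/2 < x ∧ x < d + 1/2 + η ∧ d + 1/2 < y ∧ y < d + 1/2 + η) ∨
    (d + 1/2 + η ≤ x ∧ x ≤ d + 5/6 ∧ d + 1/2 + η ≤ y ∧ y ≤ d + 5/6) ∨
    (d + 5/6 < x ∧ x < d + 5/6 + η ∧ d + 5/6 < y ∧ y < d + 5/6 + η) := by
  have key : ∀ t, (regionIdx d η t = 0 ∧ t < d + η) ∨
      (regionIdx d η t = 1 ∧ d + η ≤ t ∧ t ≤ d + 1/3) ∨
      (regionIdx d η t = 2 ∧ d + 1/3 < t ∧ t < d + 1/3 + η) ∨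
      (regionIdx d η t = 3 ∧ ((d + 1/3 + η ≤ t ∧ t ≤ d + 1/2) ∨ d + 5/6 + η ≤ t)) ∨
      (regionIdx d η t = 4 ∧ d + 1/2 < t ∧ t < d + 1/2 + η) ∨
      (regionIdx d η t = 5 ∧ d + 1/2 + η ≤ t ∧ t ≤ d + 5/6) ∨
      (regionIdx d η t = 6 ∧ d + 5/6 < t ∧ t < d + 5/6 + η) := by
    intro t
    unfold regionIdx
    split_ifs <;> simp <;> grind
  rcases key x with ⟨e, k⟩ | ⟨e, k⟩ | ⟨e, k⟩ | ⟨e, k⟩ | ⟨e, k⟩ | ⟨e, k⟩ | ⟨e, k⟩ <;>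
  rcases key y with ⟨e', k'⟩ | ⟨e', k'⟩ | ⟨e', k'⟩ | ⟨e', k'⟩ | ⟨e', k'⟩ | ⟨e', k'⟩ | ⟨e', k'⟩ <;>
  first
  | (exfalso; rw [e, e'] at h; exact absurd h (by decide))
  | grind

lemma Core.triple_mono (C : Core L U p d η) {x y : ℝ} (h : regionIdx d η x = regionIdx d η y)
    (h1 : d < x) (h2 : x < y) (h3 : y ≤ d + 1) :
    triple d η x < triple d η y ∧ triple d η y < triple d η x + 1 := by
  have p1 := C.pos
  have p2 := C.le
  unfold triple
  rcases regionIdx_cases h with k | k | k | ⟨k | k, k' | k'⟩ | k | k | k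
  · rw [if_pos (by linarith), if_pos (by linarith)]
    constructor <;> linarith
  · rw [if_pos (by linarith), if_pos (by linarith)]
    constructor <;> linarith
  · rw [if_neg (by linarith), if_pos (by linarith), if_neg (by linarith), if_pos (by linarith)]
    constructor <;> linarith
  · rw [if_neg (by linarith), if_pos (by linarith), if_neg (by linarith), if_pos (by linarith)]
    constructor <;> linarith
  · rw [if_neg (by linarith), if_pos (by linarith), if_neg (by linarith), if_neg (by linarith)]
    constructor <;> linarith
  · linarith
  · rw [if_neg (by linarith), if_neg (by linarith), if_neg (by linarith), if_neg (by linarith)]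
    constructor <;> linarith
  · rw [if_neg (by linarith), if_pos (by linarith), if_neg (by linarith), if_pos (by linarith)]
    constructor <;> linarith
  · rw [if_neg (by linarith), if_neg (by linarith), if_neg (by linarith), if_neg (by linarith)]
    constructor <;> linarith
  · rw [if_neg (by linarith), if_neg (by linarith), if_neg (by linarith), if_neg (by linarith)]
    constructor <;> linarith

lemma Core.region_no_medium (C : Core L U p d η) {x y : ℝ}
    (h : regionIdx d η x = regionIdx d η y) (h1 : d < x) (h1' : x ≤ d + 1) (h2 : d < y)
    (h3 : y ≤ d + 1) (n : ℤ) : ¬ (1/3 - η < x - y - n ∧ x - y - n < 1/3 + η) := by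
  have p1 := C.pos
  have p2 := C.le
  rintro ⟨k1, k2⟩
  have k3 : (n : ℝ) < 1 := by linarith
  have k4 : (-2 : ℝ) < n := by linarith
  norm_cast at k3 k4
  obtain rfl | rfl : n = 0 ∨ n = -1 := by lia
  all_goals
    push_cast at k1 k2
    rcases regionIdx_cases h with k | k | k | ⟨k | k, k' | k'⟩ | k | k | k <;> linarith

end

section

/-- The length of the positively oriented arc from `x` to `y`. -/
def fd (x y : S1) : ℝ := (AddCircle.equivIco (1 : ℝ) 0 (y - x) : ℝ)

lemma fd_nonneg (x y : S1) : 0 ≤ fd x y := (AddCircle.equivIco (1 : ℝ) 0 (y - x)).2.1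

lemma fd_lt_one (x y : S1) : fd x y < 1 := by
  have h := (AddCircle.equivIco (1 : ℝ) 0 (y - x)).2.2
  change _ < (0 : ℝ) + 1 at h
  exact h.trans_eq (zero_add 1)

lemma coe_fd (x y : S1) : ((fd x y : ℝ) : S1) = y - x :=
  (AddCircle.equivIco (1 : ℝ) 0).symm_apply_apply (y - x)

lemma coe_add_fd (a : ℝ) (y : S1) : ((a + fd a y : ℝ) : S1) = y := by
  rw [AddCircle.coe_add, coe_fd]; abel

lemma fd_coe {a b : ℝ} (h1 : a ≤ b) (h2 : b < a + 1) : fd a b = b - a := by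
  have h := coe_add_fd a b
  obtain ⟨n, hn⟩ := coe_eq_iff.1 h
  have h3 := fd_nonneg (a : S1) b
  have h4 := fd_lt_one (a : S1) b
  have h5 : (n : ℝ) < 1 := by linarith
  have h6 : (-1 : ℝ) < n := by linarith
  norm_cast at h5 h6
  obtain rfl : n = 0 := by lia
  push_cast at hn
  linarith

lemma exists_coe (x : S1) : ∃ a : ℝ, (a : S1) = x := by
  obtain ⟨t, -, -, h⟩ := exists_lift x 0
  exact ⟨t, h⟩

@[simp] lemma fd_self (x : S1) : fd x x = 0 := by
  obtain ⟨a, rfl⟩ := exists_coe x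
  rw [fd_coe le_rfl (by linarith), sub_self]

lemma eq_of_fd_eq {x y z : S1} (h : fd x y = fd x z) : y = z := by
  obtain ⟨a, rfl⟩ := exists_coe x
  rw [← coe_add_fd a y, h, coe_add_fd]

lemma fd_pos {x y : S1} (h : x ≠ y) : 0 < fd x y :=
  (fd_nonneg x y).lt_of_ne fun e => h (eq_of_fd_eq (x := x) (by rw [← e, fd_self]))

lemma ne_of_fd_pos {x y : S1} (h : 0 < fd x y) : x ≠ y := by
  rintro rfl
  simp at h

lemma fd_sub {x y z : S1} (h : fd x y ≤ fd x z) : fd y z = fd x z - fd x y := by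
  obtain ⟨a, rfl⟩ := exists_coe x
  conv_lhs => rw [← coe_add_fd a y, ← coe_add_fd a z]
  rw [fd_coe (by linarith) (by linarith [fd_nonneg (a : S1) y, fd_lt_one (a : S1) z])]
  ring

lemma fd_swap {x y : S1} (h : x ≠ y) : fd y x = 1 - fd x y := by
  obtain ⟨a, rfl⟩ := exists_coe x
  have h1 := fd_pos h
  have h2 := fd_lt_one (a : S1) y
  have h3 := fd_coe (a := a + fd (a : S1) y) (b := a + 1) (by linarith) (by linarith)
  rw [coe_add_fd, coe_add_one] at h3
  rw [h3]
  ring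

lemma fd_add {x y z : S1} (h : fd x y + fd y z < 1) : fd x z = fd x y + fd y z := by
  obtain ⟨a, rfl⟩ := exists_coe x
  have h2 := fd_nonneg (a : S1) y
  have h3 := fd_nonneg y z
  have h4 : ((a + fd (a : S1) y + fd y z : ℝ) : S1) = z := by
    rw [AddCircle.coe_add, coe_add_fd, coe_fd]; abel
  conv_lhs => rw [← h4]
  rw [fd_coe (by linarith) (by linarith)]
  ring

lemma fd_antip (x y : S1) : fd (antip x) (antip y) = fd x y := by
  unfold fd antip
  congr 2
  abel

lemma fd_s3 {x y : S1} (h : fd x y < 1/3) : fd (s3 x) (s3 y) = 3 * fd x y := by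
  obtain ⟨a, rfl⟩ := exists_coe x
  have h1 := fd_nonneg (a : S1) y
  conv_lhs => rw [← coe_add_fd a y]
  rw [s3_coe, s3_coe, fd_coe (by linarith) (by linarith)]
  ring

lemma s3_antip (x : S1) : s3 (antip x) = antip (s3 x) := by
  obtain ⟨a, rfl⟩ := exists_coe x
  rw [antip_coe, s3_coe, s3_coe, antip_coe]
  exact coe_eq_iff.2 ⟨1, by push_cast; ring⟩

variable {L : Set Chord}

lemma ChainJoined.symm {x y : S1} (h : ChainJoined L x y) : ChainJoined L y x :=
  have : Std.Symm fun x y : S1 => ∃ ℓ ∈ L, x ∈ ℓ ∧ y ∈ ℓ :=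
    ⟨fun _ _ ⟨ℓ, h1, h2, h3⟩ => ⟨ℓ, h1, h3, h2⟩⟩
  Relation.ReflTransGen.stdSymm.symm _ _ h

lemma ChainJoined.trans {x y z : S1} (h : ChainJoined L x y) (h' : ChainJoined L y z) :
    ChainJoined L x z := Relation.ReflTransGen.trans h h'

lemma chain_rfl {x : S1} : ChainJoined L x x := Relation.ReflTransGen.refl

lemma ChainJoined.map_antip (hL : IsCubicSymLam L) {x y : S1} (h : ChainJoined L x y) :
    ChainJoined L (antip x) (antip y) := by
  refine Relation.ReflTransGen.lift (p := fun x y => ∃ ℓ ∈ L, x ∈ ℓ ∧ y ∈ ℓ) antip (fun x y => ?_) _ _ h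
  rintro ⟨ℓ, h1, h2, h3⟩
  exact ⟨_, hL.symm ℓ h1, Sym2.mem_map.2 ⟨x, h2, rfl⟩, Sym2.mem_map.2 ⟨y, h3, rfl⟩⟩

lemma ChainJoined.map_s3 (hL : IsInvLam L) {x y : S1} (h : ChainJoined L x y) :
    ChainJoined L (s3 x) (s3 y) := by
  induction h with
  | refl => exact chain_rfl
  | tail _ hl ih =>
    obtain ⟨ℓ, h1, h2, h3⟩ := hl
    refine ih.trans ?_
    have m2 := Sym2.mem_map (f := s3) |>.2 ⟨_, h2, rfl⟩
    have m3 := Sym2.mem_map (f := s3) |>.2 ⟨_, h3, rfl⟩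
    rcases hL.forward ℓ h1 with h | h
    · exact Relation.ReflTransGen.single ⟨_, h, m2, m3⟩
    · obtain ⟨p, q⟩ := ℓ
      change s3 p = s3 q at h
      change _ ∈ s(s3 p, s3 q) at m2 m3
      rw [h, Sym2.mem_iff, or_self] at m2 m3
      rw [m2, m3]
      exact chain_rfl

lemma leaf_of_mem {x y : ℝ} {ℓ : Chord} (hℓ : ℓ ∈ L) (hx : (x : S1) ∈ ℓ) (hy : (y : S1) ∈ ℓ)
    (hxy : (x : S1) ≠ y) : Lf L x y := by
  refine ⟨?_, hxy⟩
  rwa [← (Sym2.mem_and_mem_iff hxy).1 ⟨hx, hy⟩]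

lemma Lf.chain {x y : ℝ} (h : Lf L x y) : ChainJoined L (x : S1) y :=
  Relation.ReflTransGen.single ⟨_, h.1, Sym2.mem_mk_left _ _, Sym2.mem_mk_right _ _⟩

/-- A chain from outside a set to inside it contains a leaf doing the same. -/
lemma ChainJoined.exists_leaf {a c : S1} (h : ChainJoined L a c) {B : Set S1} (ha : a ∉ B)
    (hc : c ∈ B) : ∃ u v : S1, ChainJoined L a u ∧ u ∉ B ∧ v ∈ B ∧
      ∀ x y : ℝ, (x : S1) = u → (y : S1) = v → Lf L x y := by
  induction h with
  | refl => exact absurd hc ha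
  | @tail b c hab hl ih =>
    by_cases hb : b ∈ B
    · exact ih hb
    · obtain ⟨ℓ, h1, h2, h3⟩ := hl
      refine ⟨b, c, hab, hb, hc, ?_⟩
      rintro x y rfl rfl
      exact leaf_of_mem h1 h2 h3 fun e => hb (by rw [e]; exact hc)

/-- Chains whose endpoints alternate on the circle belong to the same class. -/
lemma ChainJoined.of_cross (hL : IsLamination L) {a b c e : ℝ} (h1 : ChainJoined L (a : S1) c)
    (h2 : ChainJoined L (b : S1) e) (hab : a < b) (hbc : b < c) (hce : c < e) (hea : e < a + 1) :
    ChainJoined L (a : S1) b := by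
  by_contra hn
  have hne : ∀ x : S1, ChainJoined L (a : S1) x → ¬ ChainJoined L (b : S1) x :=
    fun x hx hx' => hn (hx.trans hx'.symm)
  obtain ⟨u, v, hau, hu, ⟨y, ⟨hy1, hy2⟩, rfl⟩, hl⟩ :=
    h1.exists_leaf (B := (fun t : ℝ => (t : S1)) '' Ioo b e) (by
      rintro ⟨t, ⟨ht1, ht2⟩, ht⟩
      obtain ⟨n, hn⟩ := coe_eq_iff.1 ht
      have h5 : (n : ℝ) < 1 := by linarith
      have h6 : (0 : ℝ) < n := by linarith
      norm_cast at h5 h6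
      lia) ⟨c, ⟨hbc, hce⟩, rfl⟩
  have hub : (b : S1) ≠ u := fun e => hne _ hau (by rw [e]; exact chain_rfl)
  obtain ⟨x, hx1, hx2, rfl⟩ := exists_lift_Ioo u b hub
  have hlx := hl x y rfl rfl
  have hex : e < x := by
    refine lt_of_not_ge fun k => ?_
    rcases k.lt_or_eq with k | k
    · exact hu ⟨x, ⟨hx1, k⟩, rfl⟩
    · exact hne _ hau (by rw [k]; exact h2)
  have hay : ChainJoined L (a : S1) y := hau.trans hlx.chain
  obtain ⟨r, s, hbr, hr, ⟨s, ⟨hs1, hs2⟩, rfl⟩, hl'⟩ :=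
    h2.exists_leaf (B := (fun t : ℝ => (t : S1)) '' Ioo y x) (by
      rintro ⟨t, ⟨ht1, ht2⟩, ht⟩
      obtain ⟨n, hn⟩ := coe_eq_iff.1 ht
      have h5 : (n : ℝ) < 1 := by linarith
      have h6 : (0 : ℝ) < n := by linarith
      norm_cast at h5 h6
      lia) ⟨e, ⟨hy2, hex⟩, rfl⟩
  have hxr : (x : S1) ≠ r := fun e => hne _ hau (by rw [e]; exact hbr)
  obtain ⟨r, hr1, hr2, rfl⟩ := exists_lift_Ioo r x hxr
  have hyr : r < y + 1 := by
    refine lt_of_not_ge fun k => ?_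
    rcases k.eq_or_lt with k | k
    · exact hne _ hay (by rw [(coe_add_one y).symm, k]; exact hbr)
    · exact hr ⟨r - 1, ⟨by linarith, by linarith⟩, by
        change ((r - 1 : ℝ) : S1) = r
        rw [(coe_add_one (r - 1)).symm, sub_add_cancel]⟩
  exact Lf.noX hL hlx.symm (hl' r s rfl rfl).symm hs1 hs2 hr1 hyr

end

section

variable {L : Set Chord} {U : Set S1} {p : ℕ} {d η : ℝ}

/-- The lift of a point of the circle to `(d, d + 1]`. -/
def rep (d : ℝ) (x : S1) : ℝ := (AddCircle.equivIoc (1 : ℝ) d x : ℝ)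

lemma lt_rep (d : ℝ) (x : S1) : d < rep d x := (AddCircle.equivIoc (1 : ℝ) d x).2.1

lemma rep_le (d : ℝ) (x : S1) : rep d x ≤ d + 1 := (AddCircle.equivIoc (1 : ℝ) d x).2.2

lemma coe_rep (d : ℝ) (x : S1) : ((rep d x : ℝ) : S1) = x :=
  (AddCircle.equivIoc (1 : ℝ) d).symm_apply_apply x

lemma rep_coe {t : ℝ} (h1 : d < t) (h2 : t ≤ d + 1) : rep d (t : S1) = t := by
  obtain ⟨n, hn⟩ := coe_eq_iff.1 (coe_rep d (t : S1))
  have h3 := lt_rep d (t : S1)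
  have h4 := rep_le d (t : S1)
  have h5 : (n : ℝ) < 1 := by linarith
  have h6 : (-1 : ℝ) < n := by linarith
  norm_cast at h5 h6
  obtain rfl : n = 0 := by lia
  simpa using hn

lemma fd_of_rep_le {x y : S1} (h : rep d x ≤ rep d y) : fd x y = rep d y - rep d x := by
  conv_lhs => rw [← coe_rep d x, ← coe_rep d y]
  exact fd_coe h (by linarith [rep_le d y, lt_rep d x])

lemma fd_of_rep_lt {x y : S1} (h : rep d y < rep d x) : fd x y = rep d y + 1 - rep d x := by
  conv_lhs => rw [← coe_rep d x, ← coe_rep d y, ← coe_add_one (rep d y)]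
  exact fd_coe (by linarith [rep_le d x, lt_rep d y]) (by linarith)

lemma coe_triple (t : ℝ) : ((triple d η t : ℝ) : S1) = s3 (t : S1) := by
  rw [s3_coe, triple]
  split_ifs
  · simp
  · exact coe_eq_iff.2 ⟨-1, by push_cast; ring⟩
  · exact coe_eq_iff.2 ⟨-2, by push_cast; ring⟩

namespace Core

lemma chain_region (C : Core L U p d η) {x y : S1} (h : ChainJoined L x y) :
    regionIdx d η (rep d x) = regionIdx d η (rep d y) := by
  induction h with
  | refl => exact Eq.refl _
  | @tail b c _ hl ih =>
    refine ih.trans ?_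
    obtain ⟨ℓ, h1, h2, h3⟩ := hl
    by_cases hbc : b = c
    · rw [hbc]
    rw [← coe_rep d b] at h2 hbc
    rw [← coe_rep d c] at h3 hbc
    have hl := leaf_of_mem h1 h2 h3 hbc
    rcases lt_trichotomy (rep d b) (rep d c) with k | k | k
    · exact C.leaf_region hl (lt_rep d b) k (rep_le d c)
    · rw [k]
    · exact (C.leaf_region hl.symm (lt_rep d c) k (rep_le d b)).symm

lemma fd_s3_of_rep_lt (C : Core L U p d η) {x y : S1} (h : ChainJoined L x y)
    (hxy : rep d x < rep d y) :
    fd (s3 x) (s3 y) = triple d η (rep d y) - triple d η (rep d x) ∧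
      triple d η (rep d x) < triple d η (rep d y) ∧
      triple d η (rep d y) < triple d η (rep d x) + 1 := by
  obtain ⟨h1, h2⟩ := C.triple_mono (C.chain_region h) (lt_rep d x) hxy (rep_le d y)
  refine ⟨?_, h1, h2⟩
  rw [← fd_coe h1.le h2, coe_triple, coe_triple, coe_rep, coe_rep]

lemma fd_s3_of_rep_gt (C : Core L U p d η) {x y : S1} (h : ChainJoined L x y)
    (hxy : rep d y < rep d x) :
    fd (s3 x) (s3 y) = triple d η (rep d y) + 1 - triple d η (rep d x) ∧
      triple d η (rep d y) < triple d η (rep d x) ∧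
      triple d η (rep d x) < triple d η (rep d y) + 1 := by
  obtain ⟨h1, h2⟩ := C.triple_mono (C.chain_region h).symm (lt_rep d y) hxy (rep_le d x)
  refine ⟨?_, h1, h2⟩
  rw [← fd_coe h2.le (by linarith), coe_add_one, coe_triple, coe_triple, coe_rep, coe_rep]

/-- Tripling preserves the cyclic order on classes. -/
lemma fd_s3_lt (C : Core L U p d η) {x y z : S1} (hy : ChainJoined L x y)
    (hz : ChainJoined L x z) (h : fd x y < fd x z) : fd (s3 x) (s3 y) < fd (s3 x) (s3 z) := by
  have hyz : ChainJoined L y z := hy.symm.trans hz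
  have k1 := lt_rep d x
  have k2 := rep_le d x
  have k3 := lt_rep d y
  have k4 := rep_le d y
  have k5 := lt_rep d z
  have k6 := rep_le d z
  have mono : rep d y < rep d z → triple d η (rep d y) < triple d η (rep d z) :=
    fun k => (C.fd_s3_of_rep_lt hyz k).2.1
  rcases lt_trichotomy (rep d x) (rep d y) with a | a | a
  · rw [fd_of_rep_le a.le] at h
    rw [(C.fd_s3_of_rep_lt hy a).1]
    rcases lt_or_ge (rep d z) (rep d x) with b | b
    · rw [fd_of_rep_lt b] at h
      rw [(C.fd_s3_of_rep_gt hz b).1]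
      have := (C.fd_s3_of_rep_gt hyz.symm.symm (b.trans a)).2.2
      linarith
    · rw [fd_of_rep_le b] at h
      rw [(C.fd_s3_of_rep_lt hz (by linarith)).1]
      have := mono (by linarith)
      linarith
  · obtain rfl : x = y := by rw [← coe_rep d x, ← coe_rep d y, a]
    rw [fd_self] at h ⊢
    rcases lt_trichotomy (rep d x) (rep d z) with b | b | b
    · obtain ⟨e1, e2, -⟩ := C.fd_s3_of_rep_lt hz b
      linarith
    · obtain rfl : x = z := by rw [← coe_rep d x, ← coe_rep d z, b]
      simp at h
    · obtain ⟨e1, e2, e3⟩ := C.fd_s3_of_rep_gt hz b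
      linarith
  · rw [fd_of_rep_lt a] at h
    rw [(C.fd_s3_of_rep_gt hy a).1]
    rcases lt_or_ge (rep d z) (rep d x) with b | b
    · rw [fd_of_rep_lt b] at h
      rw [(C.fd_s3_of_rep_gt hz b).1]
      have := mono (by linarith)
      linarith
    · rw [fd_of_rep_le b] at h
      linarith

lemma s3_injOn (C : Core L U p d η) {x y : S1} (h : ChainJoined L x y) (hs : s3 x = s3 y) :
    x = y := by
  by_contra hn
  have := C.fd_s3_lt chain_rfl h (by rw [fd_self]; exact fd_pos hn)
  rw [hs] at this
  exact lt_irrefl _ this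

lemma fd_s3_cases (C : Core L U p d η) {x y : S1} (h : ChainJoined L x y) :
    (fd x y ≤ 1/3 - η ∧ fd (s3 x) (s3 y) = 3 * fd x y) ∨
    (1/3 + η ≤ fd x y ∧ fd x y ≤ 2/3 - η ∧ fd (s3 x) (s3 y) = 3 * fd x y - 1) ∨
    (2/3 + η ≤ fd x y ∧ fd (s3 x) (s3 y) = 3 * fd x y - 2) := by
  have p1 := C.pos
  have hr := C.chain_region h
  have e : ∃ n : ℤ, rep d y = rep d x + fd x y + n := by
    refine coe_eq_iff.1 ?_
    rw [coe_rep, AddCircle.coe_add, coe_rep, coe_fd]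
    abel
  obtain ⟨n, hn⟩ := e
  have m1 := C.region_no_medium hr.symm (lt_rep d y) (rep_le d y) (lt_rep d x) (rep_le d x) n
  have m2 := C.region_no_medium hr (lt_rep d x) (rep_le d x) (lt_rep d y) (rep_le d y) (-n-1)
  push_cast at m2
  have f0 := fd_nonneg x y
  have f1 := fd_lt_one x y
  have key : ∀ k : ℤ, 0 ≤ 3 * fd x y - k → 3 * fd x y - k < 1 →
      fd (s3 x) (s3 y) = 3 * fd x y - k := by
    intro k a b
    have e1 : (((3 * rep d x : ℝ)) : S1) = s3 x := by rw [← s3_coe, coe_rep]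
    have e2 : ((3 * rep d x + (3 * fd x y - k) : ℝ) : S1) = s3 y := by
      conv_rhs => rw [← coe_rep d y, s3_coe]
      exact coe_eq_iff.2 ⟨-k - 3 * n, by rw [hn]; push_cast; ring⟩
    rw [← e1, ← e2, fd_coe (by linarith) (by linarith)]
    ring
  rcases le_or_gt (fd x y) (1/3 - η) with a | a
  · exact Or.inl ⟨a, by simpa using key 0 (by push_cast; linarith) (by push_cast; linarith)⟩
  rcases lt_or_ge (fd x y) (1/3 + η) with b | b
  · exact absurd ⟨by linarith, by linarith⟩ m1
  rcases le_or_gt (fd x y) (2/3 - η) with c | c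
  · exact Or.inr (Or.inl ⟨b, c, by
      simpa using key 1 (by push_cast; linarith) (by push_cast; linarith)⟩)
  rcases lt_or_ge (fd x y) (2/3 + η) with e | e
  · exact absurd ⟨by linarith, by linarith⟩ m2
  · exact Or.inr (Or.inr ⟨e, by
      simpa using key 2 (by push_cast; linarith) (by push_cast; linarith)⟩)

lemma far_iter (C : Core L U p d η) {x y : S1} (h : ChainJoined L x y) (hne : x ≠ y) :
    ∃ k : ℕ, ∀ n, k ≤ n → 3 * η ≤ fd (s3^[n] x) (s3^[n] y) := by
  have p1 := C.pos
  have hE : ∀ n, ChainJoined L (s3^[n] x) (s3^[n] y) := by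
    intro n
    induction n with
    | zero => exact h
    | succ n ih => rw [Function.iterate_succ_apply', Function.iterate_succ_apply']
                   exact ih.map_s3 C.isInv
  have hg : ∀ n, min (3 ^ n * fd x y) (3 * η) ≤ fd (s3^[n] x) (s3^[n] y) := by
    intro n
    induction n with
    | zero => simp
    | succ n ih =>
      rw [Function.iterate_succ_apply', Function.iterate_succ_apply', pow_succ]
      rcases C.fd_s3_cases (hE n) with ⟨a, b⟩ | ⟨a, a', b⟩ | ⟨a, b⟩
      · rw [b]
        rcases min_choice (3 ^ n * fd x y) (3 * η) with e | e <;> rw [e] at ih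
        · exact (min_le_left _ _).trans (by linarith)
        · exact (min_le_right _ _).trans (by linarith)
      · exact (min_le_right _ _).trans (by linarith)
      · exact (min_le_right _ _).trans (by linarith)
  have h0 := fd_pos hne
  obtain ⟨k, hk⟩ := pow_unbounded_of_one_lt (3 * η / fd x y) (by norm_num : (1 : ℝ) < 3)
  refine ⟨k, fun n hn => le_trans ?_ (hg n)⟩
  refine le_min ?_ le_rfl
  rw [div_lt_iff₀ h0] at hk
  have : (3 : ℝ) ^ k ≤ 3 ^ n := pow_le_pow_right₀ (by norm_num) hn
  nlinarith

end Core

end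

section

variable {L : Set Chord} {U : Set S1} {p : ℕ} {d η : ℝ}

lemma ChainJoined.iterate (hL : IsInvLam L) {x y : S1} (h : ChainJoined L x y) (n : ℕ) :
    ChainJoined L (s3^[n] x) (s3^[n] y) := by
  induction n with
  | zero => exact h
  | succ n ih =>
    rw [Function.iterate_succ_apply', Function.iterate_succ_apply']
    exact ih.map_s3 hL

lemma card_le_of_far {δ : ℝ} (hδ : 0 < δ) (F : Finset S1)
    (h : ∀ a ∈ F, ∀ b ∈ F, a ≠ b → δ ≤ fd a b) : F.card ≤ ⌊1/δ⌋₊ + 1 := by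
  have hc : F.card ≤ (Finset.range (⌊1/δ⌋₊ + 1)).card := by
    refine Finset.card_le_card_of_injOn (fun a => ⌊fd 0 a / δ⌋₊) ?_ ?_
    · intro a _
      simp only [Finset.coe_range, mem_Iio]
      refine Nat.lt_succ_of_le (Nat.floor_le_floor ?_)
      exact div_le_div_of_nonneg_right (fd_lt_one 0 a).le hδ.le
    · intro a ha b hb hab
      simp only at hab
      by_contra hne
      wlog hle : fd 0 a ≤ fd 0 b generalizing a b
      · exact this hb ha hab.symm (Ne.symm hne) (le_of_not_ge hle)
      have h1 := h a ha b hb hne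
      rw [fd_sub hle] at h1
      have h2 := Nat.floor_le (div_nonneg (fd_nonneg 0 a) hδ.le)
      have h3 := Nat.lt_floor_add_one (fd 0 b / δ)
      rw [le_div_iff₀ hδ] at h2
      rw [div_lt_iff₀ hδ, ← hab] at h3
      linarith
  simpa using hc

namespace Core

lemma eventually_far_finset (C : Core L U p d η) (F : Finset S1)
    (hF : ∀ a ∈ F, ∀ b ∈ F, ChainJoined L a b) :
    ∃ k : ℕ, ∀ n, k ≤ n → ∀ a ∈ F, ∀ b ∈ F, a ≠ b → 3 * η ≤ fd (s3^[n] a) (s3^[n] b) := by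
  have h : ∀ᶠ n in Filter.atTop, ∀ a ∈ F, ∀ b ∈ F, a ≠ b →
      3 * η ≤ fd (s3^[n] a) (s3^[n] b) := by
    rw [Filter.eventually_all_finset]
    intro a ha
    rw [Filter.eventually_all_finset]
    intro b hb
    by_cases hab : a = b
    · simp [hab]
    obtain ⟨k, hk⟩ := C.far_iter (hF a ha b hb) hab
    exact Filter.eventually_atTop.2 ⟨k, fun n hn _ => hk n hn⟩
  exact Filter.eventually_atTop.1 h

lemma class_finite (C : Core L U p d η) (x : S1) : {y | ChainJoined L x y}.Finite := by
  by_contra hinf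
  obtain ⟨F, hF, hc⟩ := Set.Infinite.exists_subset_card_eq hinf (⌊1/(3 * η)⌋₊ + 2)
  have hE : ∀ a ∈ F, ∀ b ∈ F, ChainJoined L a b := fun a ha b hb =>
    (ChainJoined.symm (hF ha)).trans (hF hb)
  obtain ⟨k, hk⟩ := C.eventually_far_finset F hE
  classical
  have hpos := C.pos
  have hne : ∀ a ∈ F, ∀ b ∈ F, s3^[k] a = s3^[k] b → a = b := by
    intro a ha b hb hab
    by_contra hn
    have := hk k le_rfl a ha b hb hn
    rw [hab, fd_self] at this
    linarith
  have h1 := card_le_of_far (δ := 3 * η) (by linarith) (F.image (s3^[k])) (by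
    intro a ha b hb hab
    obtain ⟨u, hu, rfl⟩ := Finset.mem_image.1 ha
    obtain ⟨v, hv, rfl⟩ := Finset.mem_image.1 hb
    exact hk k le_rfl u hu v hv fun e => hab (by rw [e]))
  rw [Finset.card_image_of_injOn (fun a ha b hb => hne a ha b hb), hc] at h1
  lia

lemma chain_of_close (C : Core L U p d η) {a b a' b' : ℝ} (h : ChainJoined L (a : S1) b)
    (h' : ChainJoined L (a' : S1) b') (ha : |a' - a| < η) (hb : |b' - b| < η)
    (hab : 0 ≤ (a' - a) * (b' - b)) (f1 : 3 * η ≤ fd (a : S1) b) (f2 : 3 * η ≤ fd (b : S1) a)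
    (f3 : 3 * η ≤ fd (a' : S1) b') (f4 : 3 * η ≤ fd (b' : S1) a') :
    ChainJoined L (a : S1) a' := by
  have hpos := C.pos
  have key : ∀ a b a' b' : ℝ, ChainJoined L (a : S1) b → ChainJoined L (a' : S1) b' →
      |a' - a| < η → |b' - b| < η → 0 < a' - a → 0 < b' - b → 3 * η ≤ fd (a : S1) b →
      3 * η ≤ fd (b : S1) a → ChainJoined L (a : S1) a' := by
    intro a b a' b' h h' ha hb h1 h2 f1 f2
    rw [abs_lt] at ha hb
    have hne : (a : S1) ≠ b := ne_of_fd_pos (by linarith)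
    rw [fd_swap hne] at f2
    have e := coe_add_fd a (b : S1)
    refine ChainJoined.of_cross C.isLam (c := a + fd (a : S1) b)
      (e := a + fd (a : S1) b + (b' - b)) (by rw [e]; exact h) ?_ (by linarith) (by linarith)
      (by linarith) (by linarith)
    have : ((a + fd (a : S1) b + (b' - b) : ℝ) : S1) = b' := by
      rw [AddCircle.coe_add, e, ← AddCircle.coe_add]
      congr 1
      ring
    rw [this]
    exact h'
  rcases lt_trichotomy (a' - a) 0 with k | k | k
  · rcases lt_trichotomy (b' - b) 0 with m | m | m
    · exact (key a' b' a b h' h (by rwa [abs_sub_comm]) (by rwa [abs_sub_comm]) (by linarith)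
        (by linarith) f3 f4).symm
    · rw [sub_eq_zero] at m
      rw [m] at h'
      exact h.trans h'.symm
    · nlinarith
  · rw [sub_eq_zero] at k
    rw [k]
    exact chain_rfl
  · rcases lt_trichotomy (b' - b) 0 with m | m | m
    · nlinarith
    · rw [sub_eq_zero] at m
      rw [m] at h'
      exact h.trans h'.symm
    · exact key a b a' b' h h' ha hb k m f1 f2

lemma exists_periodic_class (C : Core L U p d η) {x y z : S1} (hxy : ChainJoined L x y)
    (hxz : ChainJoined L x z) (h1 : x ≠ y) (h2 : x ≠ z) (h3 : y ≠ z) :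
    ∃ n k, 1 ≤ k ∧ s3^[k] (s3^[n] x) = s3^[n] x := by
  classical
  have hpos := C.pos
  have hyz := hxy.symm.trans hxz
  obtain ⟨k, hk⟩ := C.eventually_far_finset {x, y, z} (by
    have hE : ∀ a ∈ ({x, y, z} : Finset S1), ChainJoined L x a := by
      intro a ha
      simp only [Finset.mem_insert, Finset.mem_singleton] at ha
      rcases ha with rfl | rfl | rfl
      exacts [chain_rfl, hxy, hxz]
    exact fun a ha b hb => (hE a ha).symm.trans (hE b hb))
  have far : ∀ n, k ≤ n → 3 * η ≤ fd (s3^[n] x) (s3^[n] y) ∧ 3 * η ≤ fd (s3^[n] y) (s3^[n] x) ∧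
      3 * η ≤ fd (s3^[n] x) (s3^[n] z) ∧ 3 * η ≤ fd (s3^[n] z) (s3^[n] x) ∧
      3 * η ≤ fd (s3^[n] y) (s3^[n] z) ∧ 3 * η ≤ fd (s3^[n] z) (s3^[n] y) := by
    intro n hn
    have := hk n hn
    refine ⟨this x ?_ y ?_ h1, this y ?_ x ?_ h1.symm, this x ?_ z ?_ h2, this z ?_ x ?_ h2.symm,
      this y ?_ z ?_ h3, this z ?_ y ?_ h3.symm⟩ <;> simp
  set N := ⌊1/η⌋₊ + 1 with hN
  have hbin : ∀ u : S1, ⌊(rep d u - d)/η⌋₊ < N := by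
    intro u
    refine Nat.lt_succ_of_le (Nat.floor_le_floor ?_)
    exact div_le_div_of_nonneg_right (by linarith [rep_le d u]) hpos.le
  have close : ∀ u v : S1, ⌊(rep d u - d)/η⌋₊ = ⌊(rep d v - d)/η⌋₊ →
      |rep d v - rep d u| < η := by
    intro u v e
    have a1 := Nat.floor_le (div_nonneg (by linarith [lt_rep d u] : 0 ≤ rep d u - d) hpos.le)
    have a2 := Nat.lt_floor_add_one ((rep d u - d)/η)
    have b1 := Nat.floor_le (div_nonneg (by linarith [lt_rep d v] : 0 ≤ rep d v - d) hpos.le)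
    have b2 := Nat.lt_floor_add_one ((rep d v - d)/η)
    rw [← e] at b1 b2
    rw [le_div_iff₀ hpos] at a1 b1
    rw [div_lt_iff₀ hpos] at a2 b2
    rw [abs_lt]
    constructor <;> linarith
  let f : ℕ → Fin N × Fin N × Fin N := fun n =>
    (⟨_, hbin (s3^[n+k] x)⟩, ⟨_, hbin (s3^[n+k] y)⟩, ⟨_, hbin (s3^[n+k] z)⟩)
  obtain ⟨i, j, hij, hf⟩ := Finite.exists_ne_map_eq_of_infinite f
  wlog hlt : i < j generalizing i j
  · exact this j i hij.symm hf.symm (lt_of_le_of_ne (le_of_not_gt hlt) hij.symm)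
  simp only [f, Prod.mk.injEq, Fin.mk.injEq] at hf
  have cx := close _ _ hf.1
  have cy := close _ _ hf.2.1
  have cz := close _ _ hf.2.2
  obtain ⟨a1, a2, a3, a4, a5, a6⟩ := far (i + k) (by lia)
  obtain ⟨b1, b2, b3, b4, b5, b6⟩ := far (j + k) (by lia)
  have e1 := hxy.iterate C.isInv (i + k)
  have e2 := hxz.iterate C.isInv (i + k)
  have e3 := hyz.iterate C.isInv (i + k)
  have g1 := hxy.iterate C.isInv (j + k)
  have g2 := hxz.iterate C.isInv (j + k)
  have g3 := hyz.iterate C.isInv (j + k)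
  generalize hx : s3^[i + k] x = x1 at *
  generalize hx' : s3^[j + k] x = x2 at *
  generalize s3^[i + k] y = y1 at *
  generalize s3^[j + k] y = y2 at *
  generalize s3^[i + k] z = z1 at *
  generalize s3^[j + k] z = z2 at *
  have main : ∀ u v u' v' : S1, ChainJoined L u v → ChainJoined L u' v' →
      |rep d u' - rep d u| < η → |rep d v' - rep d v| < η →
      0 ≤ (rep d u' - rep d u) * (rep d v' - rep d v) → 3 * η ≤ fd u v → 3 * η ≤ fd v u →
      3 * η ≤ fd u' v' → 3 * η ≤ fd v' u' → ChainJoined L u u' := by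
    intro u v u' v' h h' ha hb hab f1 f2 f3 f4
    have := C.chain_of_close (a := rep d u) (b := rep d v) (a' := rep d u') (b' := rep d v')
    simp only [coe_rep] at this
    exact this h h' ha hb hab f1 f2 f3 f4
  have hE : ChainJoined L x1 x2 := by
    rcases le_or_gt 0 ((rep d x2 - rep d x1) * (rep d y2 - rep d y1)) with s | s
    · exact main _ _ _ _ e1 g1 cx cy s a1 a2 b1 b2
    rcases le_or_gt 0 ((rep d x2 - rep d x1) * (rep d z2 - rep d z1)) with t | t
    · exact main _ _ _ _ e2 g2 cx cz t a3 a4 b3 b4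
    have r : 0 ≤ (rep d y2 - rep d y1) * (rep d z2 - rep d z1) := by
      have := mul_pos_of_neg_of_neg s t
      by_contra hr
      push Not at hr
      have := mul_neg_of_pos_of_neg this hr
      nlinarith [sq_nonneg ((rep d x2 - rep d x1) * (rep d y2 - rep d y1) * (rep d z2 - rep d z1))]
    exact (e1.trans (main _ _ _ _ e3 g3 cy cz r a5 a6 b5 b6)).trans g1.symm
  obtain ⟨q, rfl⟩ := Nat.exists_eq_add_of_lt hlt
  have hx2 : s3^[q + 1] x1 = x2 := by
    rw [← hx, ← hx', ← Function.iterate_add_apply]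
    congr 1
    lia
  have hmaps : MapsTo (s3^[q + 1]) {w | ChainJoined L x1 w} {w | ChainJoined L x1 w} := by
    intro w hw
    have := ChainJoined.iterate C.isInv hw (q + 1)
    rw [hx2] at this
    exact hE.trans this
  have hit : ∀ n, ChainJoined L x1 ((s3^[q + 1])^[n] x1) := fun n =>
    (hmaps.iterate n) chain_rfl
  have inj : ∀ n u v, ChainJoined L u v → s3^[n] u = s3^[n] v → u = v := by
    intro n
    induction n with
    | zero => exact fun u v _ h => h
    | succ n ih =>
      intro u v h e
      rw [Function.iterate_succ_apply', Function.iterate_succ_apply'] at e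
      exact ih u v h (C.s3_injOn (h.iterate C.isInv n) e)
  have hni : ¬ Function.Injective fun n : ℕ =>
      (⟨(s3^[q + 1])^[n] x1, hit n⟩ : {w | ChainJoined L x1 w}) := by
    have := (C.class_finite x1).to_subtype
    exact not_injective_infinite_finite _
  simp only [Function.Injective, not_forall, Subtype.mk.injEq] at hni
  obtain ⟨a, b, hab, hne⟩ := hni
  wlog hlt' : a < b generalizing a b
  · exact this b a hab.symm (Ne.symm hne) (by lia)
  obtain ⟨c, rfl⟩ := Nat.exists_eq_add_of_lt hlt'
  refine ⟨i + k, (q + 1) * (c + 1), Nat.mul_pos (by lia) (by lia), ?_⟩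
  rw [hx, Function.iterate_mul]
  have e : (s3^[q + 1])^[a] x1 = (s3^[q + 1])^[a] ((s3^[q + 1])^[c + 1] x1) := by
    rw [← Function.iterate_add_apply]
    exact hab
  rw [← Function.iterate_mul] at e
  have := inj _ _ _ ?_ e
  · exact this.symm
  · exact hit (c + 1)

end Core

end

section

/-- The maps generated by the tripling map and the antipodal map. -/
inductive SymIter : (S1 → S1) → Prop
  | id : SymIter id
  | tri {g : S1 → S1} (h : SymIter g) : SymIter (s3 ∘ g)
  | anti {g : S1 → S1} (h : SymIter g) : SymIter (antip ∘ g)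

lemma SymIter.comp {g h : S1 → S1} (hg : SymIter g) (hh : SymIter h) : SymIter (g ∘ h) := by
  induction hg with
  | id => exact hh
  | tri _ ih => exact ih.tri
  | anti _ ih => exact ih.anti

lemma symIter_iterate (n : ℕ) : SymIter (s3^[n]) := by
  induction n with
  | zero => exact SymIter.id
  | succ n ih => rw [Function.iterate_succ']; exact ih.tri

lemma iterate_antip (n : ℕ) (x : S1) : s3^[n] (antip x) = antip (s3^[n] x) := by
  induction n with
  | zero => rfl
  | succ n ih => rw [Function.iterate_succ_apply', Function.iterate_succ_apply', ih, s3_antip]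

lemma SymIter.normal {g : S1 → S1} (hg : SymIter g) :
    ∃ n, (∀ x, g x = s3^[n] x) ∨ ∀ x, g x = antip (s3^[n] x) := by
  induction hg with
  | id => exact ⟨0, Or.inl fun _ => rfl⟩
  | tri _ ih =>
    obtain ⟨n, h | h⟩ := ih
    · exact ⟨n + 1, Or.inl fun x => by rw [Function.comp_apply, h, Function.iterate_succ_apply']⟩
    · exact ⟨n + 1, Or.inr fun x => by
        rw [Function.comp_apply, h, Function.iterate_succ_apply', s3_antip]⟩
  | anti _ ih =>
    obtain ⟨n, h | h⟩ := ih
    · exact ⟨n, Or.inr fun x => by rw [Function.comp_apply, h]⟩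
    · exact ⟨n, Or.inl fun x => by rw [Function.comp_apply, h, antip_antip]⟩

lemma SymIter.chain {L : Set Chord} (hL : IsCubicSymLam L) {g : S1 → S1} (hg : SymIter g) {x y : S1}
    (h : ChainJoined L x y) : ChainJoined L (g x) (g y) := by
  induction hg with
  | id => exact h
  | tri _ ih => exact ih.map_s3 hL.toIsInvLam
  | anti _ ih => exact ih.map_antip hL

/-- A strictly order preserving self-map of a finite set is the identity. -/
lemma eq_self_of_strictMono {Y : Set S1} (hY : Y.Finite) {f : S1 → S1} (hf : MapsTo f Y Y)
    {r : S1 → ℝ} (hr : ∀ x ∈ Y, ∀ y ∈ Y, r x < r y → r (f x) < r (f y))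
    (hi : ∀ x ∈ Y, ∀ y ∈ Y, r x = r y → x = y) {y : S1} (hy : y ∈ Y) : f y = y := by
  have hit : ∀ n, f^[n] y ∈ Y := fun n => hf.iterate n hy
  have key : ∀ r : S1 → ℝ, (∀ x ∈ Y, ∀ y ∈ Y, r x < r y → r (f x) < r (f y)) →
      ¬ r y < r (f y) := by
    intro r hr h
    have hm : StrictMono fun n => r (f^[n] y) := by
      refine strictMono_nat_of_lt_succ fun n => ?_
      induction n with
      | zero => exact h
      | succ n ih =>
        have := hr _ (hit n) _ (hit (n + 1)) ih
        rw [← Function.iterate_succ_apply' f, ← Function.iterate_succ_apply' f] at this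
        exact this
    have hinj : Function.Injective fun n => f^[n] y := fun a b hab =>
      hm.injective (by simp only at hab ⊢; rw [hab])
    exact Set.infinite_of_injective_forall_mem hinj hit hY
  refine hi _ (hf hy) _ hy (le_antisymm ?_ ?_)
  · exact not_lt.1 (key r hr)
  · have := key (fun x => - r x) fun x hx y hy h => neg_lt_neg (hr y hy x hx (neg_lt_neg_iff.1 h))
    simpa using this

/-- A finite fully invariant family of periodic classes with at least three points. -/
structure PerSys (L : Set Chord) (P : Set S1) (K : ℕ) : Prop where
  lam : IsCubicSymLam L
  ord : ∀ x y z, ChainJoined L x y → ChainJoined L x z → fd x y < fd x z →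
    fd (s3 x) (s3 y) < fd (s3 x) (s3 z)
  fin : P.Finite
  adm : ∀ g, SymIter g → ∀ x ∈ P, g x ∈ P
  closed : ∀ x ∈ P, ∀ y, ChainJoined L x y → y ∈ P
  per : ∀ x ∈ P, s3^[K] x = x
  one_le : 1 ≤ K
  three : ∀ x ∈ P, ∃ y z, ChainJoined L x y ∧ ChainJoined L x z ∧ x ≠ y ∧ x ≠ z ∧ y ≠ z
  trans : ∀ x ∈ P, ∀ y ∈ P, ∃ g, SymIter g ∧ ChainJoined L y (g x)

lemma iterate_ord {L : Set Chord} (hL : IsInvLam L)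
    (ord : ∀ x y z, ChainJoined L x y → ChainJoined L x z → fd x y < fd x z →
      fd (s3 x) (s3 y) < fd (s3 x) (s3 z)) (n : ℕ) {x y z : S1} (hy : ChainJoined L x y)
    (hz : ChainJoined L x z) (h : fd x y < fd x z) :
    fd (s3^[n] x) (s3^[n] y) < fd (s3^[n] x) (s3^[n] z) := by
  induction n with
  | zero => exact h
  | succ n ih =>
    rw [Function.iterate_succ_apply', Function.iterate_succ_apply', Function.iterate_succ_apply']
    exact ord _ _ _ (hy.iterate hL n) (hz.iterate hL n) ih

lemma iterate_inj {L : Set Chord} (hL : IsInvLam L)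
    (ord : ∀ x y z, ChainJoined L x y → ChainJoined L x z → fd x y < fd x z →
      fd (s3 x) (s3 y) < fd (s3 x) (s3 z)) (n : ℕ) {x y : S1} (hy : ChainJoined L x y)
    (h : s3^[n] x = s3^[n] y) : x = y := by
  by_contra hn
  have := iterate_ord hL ord n chain_rfl hy (by rw [fd_self]; exact fd_pos hn)
  rw [h] at this
  exact lt_irrefl _ this

variable {U : Set S1} {p : ℕ} {d η : ℝ}

lemma Core.exists_perSys {L : Set Chord} (C : Core L U p d η) {x y z : S1}
    (hxy : ChainJoined L x y) (hxz : ChainJoined L x z) (h1 : x ≠ y) (h2 : x ≠ z) (h3 : y ≠ z) :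
    ∃ P K n, PerSys L P K ∧ s3^[n] x ∈ P := by
  obtain ⟨n, K, hK, hper⟩ := C.exists_periodic_class hxy hxz h1 h2 h3
  have hI := C.isInv
  have ord : ∀ x y z, ChainJoined L x y → ChainJoined L x z → fd x y < fd x z →
      fd (s3 x) (s3 y) < fd (s3 x) (s3 z) := fun x y z a b c => C.fd_s3_lt a b c
  have i1 : s3^[n] x ≠ s3^[n] y := fun e => h1 (iterate_inj hI ord n hxy e)
  have i2 : s3^[n] x ≠ s3^[n] z := fun e => h2 (iterate_inj hI ord n hxz e)
  have i3 : s3^[n] y ≠ s3^[n] z := fun e => h3 (iterate_inj hI ord n (hxy.symm.trans hxz) e)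
  have j1 := hxy.iterate hI n
  have j2 := hxz.iterate hI n
  generalize s3^[n] y = v at *
  generalize s3^[n] z = w at *
  generalize hu : s3^[n] x = u at *
  have hperm : ∀ m, s3^[K * m] u = u := by
    intro m
    induction m with
    | zero => rfl
    | succ m ih => rw [Nat.mul_succ, Function.iterate_add_apply, hper, ih]
  have hgu : ∀ g, SymIter g → s3^[K] (g u) = g u := by
    intro g hg
    obtain ⟨m, h | h⟩ := hg.normal
    · rw [h, ← Function.iterate_add_apply, add_comm, Function.iterate_add_apply, hper]
    · rw [h, iterate_antip, ← Function.iterate_add_apply, add_comm, Function.iterate_add_apply,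
        hper]
  set P : Set S1 := {y | ∃ g, SymIter g ∧ ChainJoined L y (g u)} with hP
  have hperP : ∀ x ∈ P, s3^[K] x = x := by
    rintro x ⟨g, hg, hx⟩
    refine eq_self_of_strictMono (C.class_finite (g u)) (r := fd (g u)) ?_ ?_ ?_ hx.symm
    · intro y hy
      have := ChainJoined.iterate hI hy K
      rwa [hgu g hg] at this
    · intro y hy z hz hlt
      have := iterate_ord hI ord K hy hz hlt
      rwa [hgu g hg] at this
    · exact fun _ _ _ _ e => eq_of_fd_eq e
  have hadm : ∀ g, SymIter g → ∀ x ∈ P, g x ∈ P := by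
    rintro g hg x ⟨k, hk, hx⟩
    exact ⟨g ∘ k, hg.comp hk, hg.chain C.lam hx⟩
  have hinv : ∀ g, SymIter g → ∃ h, SymIter h ∧ ∀ x ∈ P, h (g x) = x := by
    intro g hg
    induction hg with
    | id => exact ⟨id, SymIter.id, fun _ _ => rfl⟩
    | @tri g hg ih =>
      obtain ⟨h, hh, hx⟩ := ih
      refine ⟨h ∘ s3^[K-1], hh.comp (symIter_iterate _), fun x hxP => ?_⟩
      rw [Function.comp_apply, Function.comp_apply, ← Function.iterate_succ_apply,
        Nat.succ_eq_add_one, Nat.sub_add_cancel hK, hperP _ (hadm g hg x hxP), hx x hxP]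
    | @anti g hg ih =>
      obtain ⟨h, hh, hx⟩ := ih
      refine ⟨h ∘ antip, hh.comp SymIter.id.anti, fun x hxP => ?_⟩
      rw [Function.comp_apply, Function.comp_apply, antip_antip, hx x hxP]
  have huP : u ∈ P := ⟨id, SymIter.id, chain_rfl⟩
  refine ⟨P, K, n, ⟨C.lam, ord, ?_, hadm, ?_, hperP, hK, ?_, ?_⟩, by rw [hu]; exact huP⟩
  · have hsub : P ⊆ ⋃ m ∈ Finset.range K,
        ({y | ChainJoined L (s3^[m] u) y} ∪ {y | ChainJoined L (antip (s3^[m] u)) y}) := by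
      rintro y ⟨g, hg, hy⟩
      obtain ⟨m, hm⟩ := hg.normal
      have hmod : s3^[m] u = s3^[m % K] u := by
        conv_lhs => rw [← Nat.mod_add_div m K, Function.iterate_add_apply, hperm]
      simp only [mem_iUnion, Finset.mem_range]
      refine ⟨m % K, Nat.mod_lt _ (by lia), ?_⟩
      rcases hm with h | h
      · left
        rw [h, hmod] at hy
        exact hy.symm
      · right
        rw [h, hmod] at hy
        exact hy.symm
    exact (Set.Finite.biUnion (Finset.finite_toSet _) fun m _ =>
      (C.class_finite _).union (C.class_finite _)).subset hsub
  · rintro x ⟨g, hg, hx⟩ y hy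
    exact ⟨g, hg, hy.symm.trans hx⟩
  · rintro x ⟨g, hg, hx⟩
    have ginj : ∀ a b, ChainJoined L a b → g a = g b → a = b := by
      intro a b hab e
      obtain ⟨m, h | h⟩ := hg.normal
      · rw [h, h] at e
        exact iterate_inj hI ord m hab e
      · rw [h, h] at e
        have := congrArg antip e
        rw [antip_antip, antip_antip] at this
        exact iterate_inj hI ord m hab this
    have g1 : ChainJoined L x (g v) := hx.trans (hg.chain C.lam j1)
    have g2 : ChainJoined L x (g w) := hx.trans (hg.chain C.lam j2)
    have n1 : g u ≠ g v := fun e => i1 (ginj _ _ j1 e)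
    have n2 : g u ≠ g w := fun e => i2 (ginj _ _ j2 e)
    have n3 : g v ≠ g w := fun e => i3 (ginj _ _ (j1.symm.trans j2) e)
    by_cases k1 : x = g v
    · exact ⟨g u, g w, hx, g2, by rw [k1]; exact n1.symm, by rw [k1]; exact n3, n2⟩
    by_cases k2 : x = g w
    · exact ⟨g u, g v, hx, g1, by rw [k2]; exact n2.symm, k1, n1⟩
    exact ⟨g v, g w, g1, g2, k1, k2, n3⟩
  · rintro x ⟨g, hg, hx⟩ y ⟨k, hk, hy⟩
    obtain ⟨h, hh, hinv⟩ := hinv g hg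
    refine ⟨k ∘ h, hk.comp hh, ?_⟩
    have := hk.chain C.lam (hh.chain C.lam hx)
    rw [hinv u huP] at this
    exact hy.trans this.symm

end

section

/-- `y` follows `x` in the cyclic order of its class. -/
def IsNext (L : Set Chord) (x y : S1) : Prop :=
  ChainJoined L x y ∧ x ≠ y ∧ ∀ z, ChainJoined L x z → x ≠ z → fd x y ≤ fd x z

open Classical in
/-- The successor of `x` in its class. -/
def nxt (L : Set Chord) (x : S1) : S1 := if h : ∃ y, IsNext L x y then h.choose else x

/-- The length of the arc from a point to its successor. -/
def gapLen (L : Set Chord) (x : S1) : ℝ := fd x (nxt L x)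

/-- The open arc from a point to its successor. -/
def sector (L : Set Chord) (x : S1) : Set S1 := {t | 0 < fd x t ∧ fd x t < gapLen L x}

variable {L : Set Chord} {P : Set S1} {K : ℕ}

lemma IsNext.nxt_eq {x y : S1} (h : IsNext L x y) : nxt L x = y := by
  have hex : ∃ y, IsNext L x y := ⟨y, h⟩
  have hc := hex.choose_spec
  rw [nxt, dif_pos hex]
  exact eq_of_fd_eq (le_antisymm (hc.2.2 y h.1 h.2.1) (h.2.2 _ hc.1 hc.2.1))

lemma not_chain_of_mem_sector {x t : S1} (hx : IsNext L x (nxt L x)) (h : t ∈ sector L x) :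
    ¬ ChainJoined L x t := fun hc =>
  not_lt.2 (hx.2.2 t hc (ne_of_fd_pos h.1)) h.2

lemma sector_disjoint {x y t : S1} (hx : IsNext L x (nxt L x)) (hy : IsNext L y (nxt L y))
    (hxy : ChainJoined L x y) (h1 : t ∈ sector L x) (h2 : t ∈ sector L y) : x = y := by
  by_contra hn
  have a := hx.2.2 y hxy hn
  have b := hy.2.2 x hxy.symm (Ne.symm hn)
  obtain ⟨h1, h1'⟩ := h1
  obtain ⟨h2, h2'⟩ := h2
  unfold gapLen at h1' h2'
  have e1 := fd_sub (x := x) (y := t) (z := y) (by linarith)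
  have e2 := fd_swap hn
  have e3 := fd_swap (ne_of_fd_pos h2)
  linarith

namespace PerSys

lemma inv (S : PerSys L P K) {g : S1 → S1} (hg : SymIter g) :
    ∃ h, SymIter h ∧ (∀ x ∈ P, h (g x) = x) ∧ ∀ x ∈ P, g (h x) = x := by
  induction hg with
  | id => exact ⟨id, SymIter.id, fun _ _ => rfl, fun _ _ => rfl⟩
  | @tri g hg ih =>
    obtain ⟨h, hh, hx, hx'⟩ := ih
    have hK := S.one_le
    refine ⟨h ∘ s3^[K-1], hh.comp (symIter_iterate _), fun x hxP => ?_, fun x hxP => ?_⟩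
    · rw [Function.comp_apply, Function.comp_apply, ← Function.iterate_succ_apply,
        Nat.succ_eq_add_one, Nat.sub_add_cancel hK, S.per _ (S.adm g hg x hxP), hx x hxP]
    · rw [Function.comp_apply, Function.comp_apply, hx' _ (S.adm _ (symIter_iterate _) x hxP),
        ← Function.iterate_succ_apply' s3, Nat.succ_eq_add_one, Nat.sub_add_cancel hK, S.per x hxP]
  | @anti g hg ih =>
    obtain ⟨h, hh, hx, hx'⟩ := ih
    refine ⟨h ∘ antip, hh.comp SymIter.id.anti, fun x hxP => ?_, fun x hxP => ?_⟩
    · rw [Function.comp_apply, Function.comp_apply, antip_antip, hx x hxP]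
    · rw [Function.comp_apply, Function.comp_apply, hx' (antip x) (S.adm _ SymIter.id.anti x hxP),
        antip_antip]

lemma ord_symIter (S : PerSys L P K) {g : S1 → S1} (hg : SymIter g) {x y z : S1}
    (hy : ChainJoined L x y) (hz : ChainJoined L x z) (h : fd x y < fd x z) :
    fd (g x) (g y) < fd (g x) (g z) := by
  induction hg with
  | id => exact h
  | tri hg ih => exact S.ord _ _ _ (hg.chain S.lam hy) (hg.chain S.lam hz) ih
  | anti _ ih => simpa only [Function.comp_apply, fd_antip] using ih

lemma class_finite (S : PerSys L P K) {x : S1} (hx : x ∈ P) : {y | ChainJoined L x y}.Finite :=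
  S.fin.subset fun y hy => S.closed x hx y hy

lemma isNext (S : PerSys L P K) {x : S1} (hx : x ∈ P) : IsNext L x (nxt L x) := by
  obtain ⟨y, -, h1, -, h3, -, -⟩ := S.three x hx
  obtain ⟨z, ⟨hz, hz'⟩, hm⟩ := Set.exists_min_image ({y | ChainJoined L x y} \ {x}) (fd x)
    ((S.class_finite hx).subset sdiff_subset) ⟨y, h1, Ne.symm h3⟩
  have : IsNext L x z := ⟨hz, fun e => hz' e.symm, fun w hw hn => hm w ⟨hw, Ne.symm hn⟩⟩
  rwa [this.nxt_eq]

lemma nxt_mem (S : PerSys L P K) {x : S1} (hx : x ∈ P) : nxt L x ∈ P :=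
  S.closed x hx _ (S.isNext hx).1

lemma gapLen_pos (S : PerSys L P K) {x : S1} (hx : x ∈ P) : 0 < gapLen L x :=
  fd_pos (S.isNext hx).2.1

lemma nxt_symIter (S : PerSys L P K) {g : S1 → S1} (hg : SymIter g) {x : S1} (hx : x ∈ P) :
    nxt L (g x) = g (nxt L x) := by
  obtain ⟨h, hh, h1, h2⟩ := S.inv hg
  have hn := S.isNext hx
  refine IsNext.nxt_eq ⟨hg.chain S.lam hn.1, fun e => hn.2.1 <|
    (h1 x hx).symm.trans ((congrArg h e).trans (h1 _ (S.nxt_mem hx))), fun z hz hne => ?_⟩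
  · have hzP : z ∈ P := S.closed _ (S.adm g hg x hx) z hz
    have hc : ChainJoined L x (h z) := by
      have := hh.chain S.lam hz
      rwa [h1 x hx] at this
    have hle := hn.2.2 (h z) hc fun e => hne (by rw [e, h2 z hzP])
    rcases hle.lt_or_eq with k | k
    · have := S.ord_symIter hg hn.1 hc k
      rw [h2 z hzP] at this
      exact this.le
    · rw [eq_of_fd_eq k, h2 z hzP]

lemma gapLen_antip (S : PerSys L P K) {x : S1} (hx : x ∈ P) :
    gapLen L (antip x) = gapLen L x := by
  unfold gapLen
  have := S.nxt_symIter SymIter.id.anti hx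
  simp only [Function.comp_apply, id_eq] at this
  rw [this, fd_antip]

lemma nxt_s3 (S : PerSys L P K) {x : S1} (hx : x ∈ P) : nxt L (s3 x) = s3 (nxt L x) :=
  S.nxt_symIter SymIter.id.tri hx

lemma gapLen_s3 (S : PerSys L P K) {x : S1} (hx : x ∈ P) (h : gapLen L x < 1/3) :
    gapLen L (s3 x) = 3 * gapLen L x := by
  unfold gapLen at h ⊢
  rw [S.nxt_s3 hx, fd_s3 h]

lemma sector_antip (S : PerSys L P K) {x t : S1} (hx : x ∈ P) (h : t ∈ sector L x) :
    antip t ∈ sector L (antip x) := by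
  simp only [sector, mem_ofPred_eq] at h ⊢
  rwa [fd_antip, S.gapLen_antip hx]

lemma sector_s3 (S : PerSys L P K) {x t : S1} (hx : x ∈ P) (hl : gapLen L x < 1/3)
    (h : t ∈ sector L x) : s3 t ∈ sector L (s3 x) := by
  simp only [sector, mem_ofPred_eq] at h ⊢
  rw [S.gapLen_s3 hx hl, fd_s3 (h.2.trans hl)]
  exact ⟨by linarith [h.1], by linarith [h.2]⟩

/-- A class meeting a sector is contained in it. -/
lemma sector_class (S : PerSys L P K) {x y y' : S1} (hx : x ∈ P) (h : y ∈ sector L x)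
    (hy : ChainJoined L y y') : y' ∈ sector L x := by
  have hn := S.isNext hx
  have hxy := not_chain_of_mem_sector hn h
  have hne : x ≠ y' := fun e => hxy (by rw [e]; exact hy.symm)
  refine ⟨fd_pos hne, lt_of_not_ge fun hle => ?_⟩
  obtain ⟨a, rfl⟩ := exists_coe x
  obtain ⟨h1, h2⟩ := h
  unfold gapLen at h2 hle
  have hlt : fd (a : S1) (nxt L a) < fd (a : S1) y' := by
    refine lt_of_le_of_ne hle fun e => hxy ?_
    rw [eq_of_fd_eq e] at hn
    exact hn.1.trans hy.symm
  have e1 := coe_add_fd a y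
  have e2 := coe_add_fd a y'
  have e3 := coe_add_fd a (nxt L a)
  have := ChainJoined.of_cross S.lam.toIsLamination (a := a) (b := a + fd (a : S1) y)
    (c := a + fd (a : S1) (nxt L a)) (e := a + fd (a : S1) y') (by rw [e3]; exact hn.1)
    (by rw [e1, e2]; exact hy) (by linarith) (by linarith) (by linarith)
    (by linarith [fd_lt_one (a : S1) y'])
  rw [e1] at this
  exact hxy this

lemma exists_sector (S : PerSys L P K) {x t : S1} (hx : x ∈ P) (ht : ¬ ChainJoined L x t) :
    ∃ y, ChainJoined L x y ∧ t ∈ sector L y := by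
  obtain ⟨y, hy, hm⟩ := Set.exists_min_image {y | ChainJoined L x y} (fun y => fd y t)
    (S.class_finite hx) ⟨x, chain_rfl⟩
  have hyt : y ≠ t := fun e => ht (by rw [← e]; exact hy)
  refine ⟨y, hy, fd_pos hyt, lt_of_not_ge fun hle => ?_⟩
  have hn := S.isNext (S.closed x hx y hy)
  have h1 := hm _ (ChainJoined.trans hy hn.1)
  have h2 := fd_pos hn.2.1
  unfold gapLen at hle
  rw [fd_sub hle] at h1
  linarith

/-- Two minimality constraints on sectors sharing a point. -/
lemma mem_sector_of_share (S : PerSys L P K) {u w t : S1} (hu : u ∈ P) (hw : w ∈ P)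
    (hmin : gapLen L u ≤ gapLen L w) (hn : ¬ ChainJoined L w u) (h1 : t ∈ sector L u)
    (h2 : t ∈ sector L w) : u ∈ sector L w := by
  have hne : w ≠ u := fun e => hn (by rw [e]; exact chain_rfl)
  refine ⟨fd_pos hne, lt_of_not_ge fun hle => ?_⟩
  have hN := S.isNext hw
  have hlt : gapLen L w < fd w u := by
    refine lt_of_le_of_ne hle fun e => hn ?_
    unfold gapLen at e
    rw [eq_of_fd_eq e] at hN
    exact hN.1
  obtain ⟨a1, a2⟩ := h1
  obtain ⟨b1, b2⟩ := h2
  have e1 := fd_swap hne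
  have e2 : fd u t = 1 - fd w u + fd w t := by
    rw [fd_add (y := w) (by linarith), e1]
  have hwu : w ∈ sector L u := ⟨fd_pos hne.symm, by linarith⟩
  have hs := (S.sector_class hu hwu hN.1).2
  have e3 : fd u (nxt L w) = 1 - fd w u + gapLen L w := by
    rw [fd_add (y := w) (by rw [e1]; change 1 - fd w u + gapLen L w < 1; linarith), e1]
    rfl
  have := fd_lt_one w u
  linarith

/-- Some point of the system lies in the sector. -/
def Occ (L : Set Chord) (P : Set S1) (x : S1) : Prop := ∃ y ∈ P, y ∈ sector L x

lemma occ_antip (S : PerSys L P K) {x : S1} (hx : x ∈ P) (h : Occ L P x) :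
    Occ L P (antip x) := by
  obtain ⟨y, hy, h⟩ := h
  exact ⟨antip y, S.adm _ SymIter.id.anti y hy, S.sector_antip hx h⟩

lemma occ_antip_iff (S : PerSys L P K) {x : S1} (hx : x ∈ P) :
    Occ L P (antip x) ↔ Occ L P x :=
  ⟨fun h => by simpa [antip_antip] using S.occ_antip (S.adm _ SymIter.id.anti x hx) h,
    S.occ_antip hx⟩

/-- A strictly larger occupied sector exists next to any occupied sector of the same class. -/
lemma exists_longer (S : PerSys L P K) {w x : S1} (hw : w ∈ P) (hwx : ChainJoined L w x)
    (hne : w ≠ x) (h : Occ L P x) : ∃ y ∈ P, Occ L P y ∧ gapLen L w < gapLen L y := by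
  obtain ⟨y, hyP, hy⟩ := h
  have hx := S.closed w hw x hwx
  have hnx := S.isNext hx
  have hyx : ¬ ChainJoined L y x := fun h => not_chain_of_mem_sector hnx hy h.symm
  obtain ⟨z, hyz, hz⟩ := S.exists_sector hyP hyx
  have hzP := S.closed y hyP z hyz
  have hzx := S.sector_class hx hy hyz
  refine ⟨z, hzP, ⟨x, hx, hz⟩, ?_⟩
  have hnw := S.isNext hw
  have hzw : w ∈ sector L z := S.sector_class hzP hz hwx.symm
  have hzw' : nxt L w ∈ sector L z := S.sector_class hzP hzw hnw.1
  rcases le_or_gt (fd z w) (fd z (nxt L w)) with k | k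
  · have := fd_sub k
    have h1 := hzw.1
    have h2 := hzw'.2
    change gapLen L w = _ at this
    linarith
  · exfalso
    refine hne (sector_disjoint hnw hnx hwx (t := z) ⟨?_, ?_⟩ hzx)
    · exact fd_pos (ne_of_fd_pos hzw.1).symm
    · rw [fd_swap (ne_of_fd_pos hzw.1)]
      have e : gapLen L w = fd w z + fd z (nxt L w) := by
        unfold gapLen
        rw [fd_add]
        rw [fd_swap (ne_of_fd_pos hzw.1)]
        linarith
      rw [e, fd_swap (ne_of_fd_pos hzw.1)]
      linarith [hzw'.1]

lemma exists_long_iterate (S : PerSys L P K) {v : S1} (hv : v ∈ P) :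
    ∃ n, 1/3 ≤ gapLen L (s3^[n] v) := by
  by_contra! hn
  have h : ∀ n, gapLen L (s3^[n] v) = 3 ^ n * gapLen L v := by
    intro n
    induction n with
    | zero => simp
    | succ n ih =>
      rw [Function.iterate_succ_apply', S.gapLen_s3 (S.adm _ (symIter_iterate n) v hv) (hn n), ih,
        pow_succ]
      ring
  have h0 := S.gapLen_pos hv
  obtain ⟨n, hk⟩ := pow_unbounded_of_one_lt (1 / gapLen L v) (by norm_num : (1 : ℝ) < 3)
  rw [div_lt_iff₀ h0] at hk
  have := hn n
  rw [h] at this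
  linarith

end PerSys

end

section

variable {L : Set Chord} {P : Set S1} {K : ℕ}

namespace PerSys

/-- An iterate mapping two points of a class to one another is the identity on the class as soon
as it fixes a point of the class. -/
lemma eq_self_of_fixed (S : PerSys L P K) {g : S1 → S1} (hg : SymIter g) {w x : S1} (hw : w ∈ P)
    (h : g w = w) (hx : ChainJoined L w x) : g x = x := by
  refine eq_self_of_strictMono (S.class_finite hw) (r := fd w) ?_ ?_ ?_ hx
  · intro y hy
    have := hg.chain S.lam hy
    rwa [h] at this
  · intro y hy z hz hlt
    have := S.ord_symIter hg hy hz hlt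
    rwa [h] at this
  · exact fun _ _ _ _ e => eq_of_fd_eq e

lemma occ_of_not_orbit (S : PerSys L P K) {ω u : S1} (hu : u ∈ P)
    (hmin : ∀ x ∈ P, gapLen L u ≤ gapLen L x) (hω : ω ∈ sector L u)
    (hEV : ∀ x ∈ P, 1/3 ≤ gapLen L x → ω ∈ sector L (s3 x) ∨ antip ω ∈ sector L (s3 x))
    {v : S1} (hv : v ∈ P) (hno : ¬ ∃ g, SymIter g ∧ v = g u) : Occ L P v := by
  have horb : ∀ g, SymIter g → ∀ x ∈ P, g x = u → ∃ k, SymIter k ∧ x = k u := by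
    intro g hg x hx e
    obtain ⟨h, hh, h1, -⟩ := S.inv hg
    exact ⟨h, hh, by rw [← e, h1 x hx]⟩
  have hit : ∀ n, s3^[n] v ∈ P := fun n => S.adm _ (symIter_iterate n) v hv
  have hsh : ∀ w ∈ P, ω ∈ sector L w → w ≠ u → Occ L P w := by
    intro w hw h hne
    by_cases hc : ChainJoined L w u
    · exact absurd (sector_disjoint (S.isNext hw) (S.isNext hu) hc h hω) hne
    · exact ⟨u, hu, S.mem_sector_of_share hu hw (hmin w hw) hc hω h⟩
  have long : ∀ n, 1/3 ≤ gapLen L (s3^[n] v) → Occ L P (s3^[n+1] v) := by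
    intro n hn
    have hs : s3^[n+1] v ∈ P := hit (n + 1)
    have e : s3 (s3^[n] v) = s3^[n+1] v := (Function.iterate_succ_apply' s3 n v).symm
    rcases hEV _ (hit n) hn with h | h
    · rw [e] at h
      exact hsh _ hs h fun e => hno (horb _ (symIter_iterate (n+1)) v hv e)
    · rw [e] at h
      have h' := S.sector_antip hs h
      rw [antip_antip] at h'
      exact (S.occ_antip_iff hs).1 (hsh _ (S.adm _ SymIter.id.anti _ hs) h' fun e =>
        hno (horb _ (symIter_iterate (n+1)).anti v hv e))
  have step : ∀ n, Occ L P (s3^[n] v) → Occ L P (s3^[n+1] v) := by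
    intro n h
    rcases le_or_gt (1/3) (gapLen L (s3^[n] v)) with k | k
    · exact long n k
    · obtain ⟨y, hy, h⟩ := h
      rw [Function.iterate_succ_apply']
      exact ⟨s3 y, S.adm _ SymIter.id.tri y hy, S.sector_s3 (hit n) k h⟩
  obtain ⟨n, hn⟩ := S.exists_long_iterate hv
  have hall : ∀ m, Occ L P (s3^[n+1+m] v) := by
    intro m
    induction m with
    | zero => exact long n hn
    | succ m ih => exact step _ ih
  have hper : ∀ m, s3^[K * m] v = v := by
    intro m
    induction m with
    | zero => rfl
    | succ m ih => rw [Nat.mul_succ, Function.iterate_add_apply, S.per v hv, ih]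
  have hle : n + 1 ≤ K * (n + 1) := Nat.le_mul_of_pos_left _ S.one_le
  have := hall (K * (n + 1) - (n + 1))
  rwa [Nat.add_sub_cancel' hle, hper] at this

/-- The system is a single orbit under the maps generated by tripling and the antipodal map. -/
lemma exists_orbit (S : PerSys L P K) (hP : P.Nonempty) {ω : S1}
    (hEV : ∀ x ∈ P, 1/3 ≤ gapLen L x → ω ∈ sector L (s3 x) ∨ antip ω ∈ sector L (s3 x)) :
    ∃ u ∈ P, ∀ x ∈ P, ∃ g, SymIter g ∧ x = g u := by
  obtain ⟨u, hu, hmin, hω⟩ : ∃ u ∈ P, (∀ x ∈ P, gapLen L u ≤ gapLen L x) ∧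
      ω ∈ sector L u := by
    obtain ⟨u, hu, hmin⟩ := Set.exists_min_image P (gapLen L) S.fin hP
    have hu' : s3^[K-1] u ∈ P := S.adm _ (symIter_iterate _) u hu
    have e : s3 (s3^[K-1] u) = u := by
      rw [← Function.iterate_succ_apply' s3, Nat.succ_eq_add_one, Nat.sub_add_cancel S.one_le,
        S.per u hu]
    have hlong : 1/3 ≤ gapLen L (s3^[K-1] u) := by
      by_contra! hlt
      have h1 := S.gapLen_s3 hu' hlt
      have h2 := hmin _ hu'
      have h3 := S.gapLen_pos hu'
      rw [e] at h1
      linarith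
    have h := hEV _ hu' hlong
    rw [e] at h
    rcases h with h | h
    · exact ⟨u, hu, hmin, h⟩
    · have := S.sector_antip hu h
      rw [antip_antip] at this
      exact ⟨antip u, S.adm _ SymIter.id.anti u hu,
        fun x hx => (S.gapLen_antip hu).trans_le (hmin x hx), this⟩
  refine ⟨u, hu, ?_⟩
  by_contra! hno
  obtain ⟨v, hv, hno⟩ := hno
  have hno' : ¬ ∃ g, SymIter g ∧ v = g u := fun ⟨g, hg, e⟩ => hno g hg e
  obtain ⟨w, ⟨hw, hwo⟩, hmax⟩ := Set.exists_max_image {w | w ∈ P ∧ Occ L P w} (gapLen L)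
    (S.fin.subset fun x hx => hx.1) ⟨v, hv, S.occ_of_not_orbit hu hmin hω hEV hv hno'⟩
  have hother : ∀ x, ChainJoined L w x → w ≠ x → ∃ g, SymIter g ∧ x = g u := by
    intro x hx hne
    by_contra hn
    have hxP := S.closed w hw x hx
    obtain ⟨y, hy, hyo, hlt⟩ := S.exists_longer hw hx hne
      (S.occ_of_not_orbit hu hmin hω hEV hxP hn)
    exact not_lt.2 (hmax y ⟨hy, hyo⟩) hlt
  have hwno : ¬ ∃ g, SymIter g ∧ w = g u := by
    intro hw'
    obtain ⟨g, hg, hc⟩ := S.trans w hw v hv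
    obtain ⟨h, hh, h1, h2⟩ := S.inv hg
    have hc' : ChainJoined L w (h v) := by
      have := hh.chain S.lam hc.symm
      rwa [h1 w hw] at this
    have : ∃ k, SymIter k ∧ h v = k u := by
      by_cases e : w = h v
      · rwa [← e]
      · exact hother _ hc' e
    obtain ⟨k, hk, e⟩ := this
    exact hno' ⟨g ∘ k, hg.comp hk, by rw [Function.comp_apply, ← e, h2 v hv]⟩
  obtain ⟨x, y, hx, hy, n1, n2, n3⟩ := S.three w hw
  have hxP := S.closed w hw x hx
  obtain ⟨g, hg, ex⟩ := hother x hx n1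
  obtain ⟨k, hk, ey⟩ := hother y hy n2
  obtain ⟨h, hh, h1, -⟩ := S.inv hg
  have hgx : (k ∘ h) x = y := by rw [Function.comp_apply, ex, h1 u hu, ey]
  have hkh := hk.comp hh
  have hcw : ChainJoined L w ((k ∘ h) w) := by
    have := hkh.chain S.lam hx
    rw [hgx] at this
    exact hy.trans this.symm
  have hfix : (k ∘ h) w = w := by
    by_contra hne
    obtain ⟨m, hm, e⟩ := hother _ hcw (Ne.symm hne)
    obtain ⟨i, hi, i1, -⟩ := S.inv hkh
    exact hwno ⟨i ∘ m, hi.comp hm, by rw [Function.comp_apply, ← e, i1 w hw]⟩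
  have := S.eq_self_of_fixed hkh hw hfix hx
  rw [hgx] at this
  exact n3 this.symm

/-- Every point of a class is an iterated successor. -/
lemma exists_iterate_nxt (S : PerSys L P K) {x y : S1} (hx : x ∈ P) (hy : ChainJoined L x y) :
    ∃ m, (nxt L)^[m] x = y := by
  have hc : ∀ m, ChainJoined L x ((nxt L)^[m] x) ∧ (nxt L)^[m] x ∈ P := by
    intro m
    induction m with
    | zero => exact ⟨chain_rfl, hx⟩
    | succ m ih =>
      rw [Function.iterate_succ_apply']
      exact ⟨ih.1.trans (S.isNext ih.2).1, S.nxt_mem ih.2⟩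
  obtain ⟨z, ⟨⟨m, rfl⟩, hz⟩, hm⟩ := Set.exists_max_image
    {z | (∃ m, (nxt L)^[m] x = z) ∧ fd x z ≤ fd x y} (fd x)
    ((S.class_finite hx).subset (by rintro _ ⟨⟨m, rfl⟩, -⟩; exact (hc m).1))
    ⟨x, ⟨0, rfl⟩, by rw [fd_self]; exact fd_nonneg x y⟩
  refine ⟨m, ?_⟩
  by_contra hne
  have hn := S.isNext (hc m).2
  have h1 := hn.2.2 y ((hc m).1.symm.trans hy) hne
  have h2 := fd_sub hz
  have h3 := fd_pos hn.2.1
  have h4 := fd_lt_one x y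
  have h5 := fd_add (x := x) (y := (nxt L)^[m] x) (z := nxt L ((nxt L)^[m] x)) (by linarith)
  have := hm (nxt L ((nxt L)^[m] x)) ⟨⟨m + 1, Function.iterate_succ_apply' _ _ _⟩, by linarith⟩
  linarith

lemma leaf_symIter (S : PerSys L P K) {g : S1 → S1} (hg : SymIter g) {x y : S1}
    (hxy : ChainJoined L x y) (hne : x ≠ y) (h : s(x, y) ∈ L) : s(g x, g y) ∈ L ∧ g x ≠ g y := by
  induction hg with
  | id => exact ⟨h, hne⟩
  | @tri g hg ih =>
    have hne' : s3 (g x) ≠ s3 (g y) := by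
      intro e
      have := S.ord _ _ _ chain_rfl (hg.chain S.lam hxy) (by rw [fd_self]; exact fd_pos ih.2)
      rw [e] at this
      exact lt_irrefl _ this
    exact ⟨(S.lam.forward _ ih.1).resolve_right hne', hne'⟩
  | anti _ ih =>
    refine ⟨S.lam.symm _ ih.1, fun e => ih.2 ?_⟩
    have := congrArg antip e
    simpa only [Function.comp_apply, antip_antip] using this

/-- All leaves inside a class join consecutive points, and all of these are leaves. -/
lemma leaf_iff (S : PerSys L P K) {u : S1} (hu : u ∈ P)
    (horb : ∀ x ∈ P, ∃ g, SymIter g ∧ x = g u) :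
    (∀ x ∈ P, ∀ y, x ≠ y → s(x, y) ∈ L → y = nxt L x ∨ x = nxt L y) ∧
      ∀ x ∈ P, s(x, nxt L x) ∈ L := by
  have rot : ∀ x ∈ P, ∀ y ∈ P, ∃ g, SymIter g ∧ y = g x := by
    intro x hx y hy
    obtain ⟨g, hg, ex⟩ := horb x hx
    obtain ⟨k, hk, ey⟩ := horb y hy
    obtain ⟨h, hh, h1, -⟩ := S.inv hg
    exact ⟨k ∘ h, hk.comp hh, by rw [Function.comp_apply, ex, h1 u hu, ey]⟩
  have chn : ∀ x y, s(x, y) ∈ L → ChainJoined L x y := fun x y h =>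
    Relation.ReflTransGen.single ⟨_, h, Sym2.mem_mk_left _ _, Sym2.mem_mk_right _ _⟩
  have first : ∀ x ∈ P, ∀ y, x ≠ y → s(x, y) ∈ L → y = nxt L x ∨ x = nxt L y := by
    intro x hx y hne h
    by_contra! hn
    have hxy := chn x y h
    have hy := S.closed x hx y hxy
    obtain ⟨g, hg, e⟩ := rot x hx _ (S.nxt_mem hx)
    have hgy : g y = nxt L y := by
      obtain ⟨m, hm⟩ := S.exists_iterate_nxt hx hxy
      have : ∀ m, g ((nxt L)^[m] x) = nxt L ((nxt L)^[m] x) ∧ (nxt L)^[m] x ∈ P := by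
        intro m
        induction m with
        | zero => exact ⟨e.symm, hx⟩
        | succ m ih =>
          rw [Function.iterate_succ_apply', ← S.nxt_symIter hg ih.2, ih.1]
          exact ⟨rfl, S.nxt_mem ih.2⟩
      rw [← hm]
      exact (this m).1
    have h' := S.leaf_symIter hg hxy hne h
    rw [← e, hgy] at h'
    have nx := S.isNext hx
    have ny := S.isNext hy
    obtain ⟨a, rfl⟩ := exists_coe x
    have i1 := nx.2.2 y hxy hne
    have i1' : fd (a : S1) (nxt L a) ≠ fd (a : S1) y := fun e => hn.1 (eq_of_fd_eq e).symm
    have i2 := ny.2.2 _ hxy.symm (Ne.symm hne)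
    have i2' : fd y (nxt L y) ≠ fd y (a : S1) := fun e => hn.2 (eq_of_fd_eq e).symm
    rw [fd_swap hne] at i2 i2'
    have i3 := fd_pos nx.2.1
    have i4 := fd_pos ny.2.1
    have e1 := coe_add_fd a y
    have e2 := coe_add_fd a (nxt L a)
    have e3 : ((a + fd (a : S1) y + fd y (nxt L y) : ℝ) : S1) = nxt L y := by
      rw [AddCircle.coe_add, e1, coe_fd]
      abel
    refine Lf.noX S.lam.toIsLamination (p := a) (q := a + fd (a : S1) y)
      (x := a + fd (a : S1) (nxt L a)) (y := a + fd (a : S1) y + fd y (nxt L y))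
      ⟨by rw [e1]; exact h, by rw [e1]; exact hne⟩
      ⟨by rw [e2, e3]; exact h'.1, by rw [e2, e3]; exact h'.2⟩ (by linarith) ?_ (by linarith) ?_
    · have := lt_of_le_of_ne i1 i1'
      linarith
    · have := lt_of_le_of_ne i2 i2'
      linarith
  refine ⟨first, fun x hx => ?_⟩
  obtain ⟨y, -, hxy, -, hne, -, -⟩ := S.three x hx
  obtain ⟨b, c, hb, hbx, hcx, hl⟩ := hxy.symm.exists_leaf (B := {x}) (by simpa using Ne.symm hne) rfl
  rw [mem_singleton_iff] at hbx hcx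
  subst hcx
  have hbP := S.closed _ hx b (hxy.trans hb)
  have hlf : s(b, c) ∈ L := by
    have := (hl (rep 0 b) (rep 0 c) (coe_rep 0 b) (coe_rep 0 c)).1
    rwa [coe_rep, coe_rep] at this
  have main : ∀ y ∈ P, s(y, nxt L y) ∈ L → s(c, nxt L c) ∈ L := by
    intro y hy h
    obtain ⟨g, hg, e⟩ := rot y hy c hx
    have := (S.leaf_symIter hg (S.isNext hy).1 (S.isNext hy).2.1 h).1
    rwa [← S.nxt_symIter hg hy, ← e] at this
  rcases first b hbP c hbx hlf with e | e
  · exact main b hbP (by rw [← e]; exact hlf)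
  · exact main c hx (by rw [← e, Sym2.eq_swap]; exact hlf)

end PerSys

end

section

variable {L : Set Chord} {U : Set S1} {p : ℕ} {d η : ℝ} {P : Set S1} {K : ℕ}

namespace Core

lemma exists_gate (C : Core L U p d η) (S : PerSys L P K) :
    ∃ w : ℝ, d ≤ w ∧ w ≤ d + η ∧ ((w : S1) ∈ U ∨ ((w + 1/3 : ℝ) : S1) ∈ U) ∧
      ((3 * w : ℝ) : S1) ∉ P := by
  obtain ⟨_, ⟨x, hx, rfl⟩, hxP⟩ := (infinite_s3_image C.inf).exists_notMem_finite S.fin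
  obtain ⟨t, rfl⟩ := exists_coe x
  obtain ⟨n, h | h⟩ := C.exists_strip_lift hx
  · refine ⟨t + n, h.1, h.2, Or.inl (mem_shift hx n rfl), fun k => hxP ?_⟩
    rw [s3_coe]
    exact mem_shift k (-(3 * n)) (by push_cast; ring)
  · refine ⟨t + n - 1/3, by linarith, by linarith, Or.inr (mem_shift hx n (by ring)),
      fun k => hxP ?_⟩
    rw [s3_coe]
    exact mem_shift k (-(3 * n) + 1) (by push_cast; ring)

lemma gate (C : Core L U p d η) {w a b : ℝ}
    (hw : (w : S1) ∈ U ∨ ((w + 1/3 : ℝ) : S1) ∈ U) (h : Lf L a b) (h1 : d < a) (h2 : a < w)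
    (h3 : w < b) (h4 : b < d + η) : False := by
  have p1 := C.pos
  have p2 := C.le
  rcases hw with hw | hw
  · exact C.unl _ _ _ _ h hw C.mem1 h2 h3 h4 (by linarith)
  · rcases h.sib C.isInv (coe_ne_of_lt (by linarith) (by linarith)) with k | k
    · exact C.unl _ _ _ _ k.1 hw C.mem3 (by linarith) (by linarith) (by linarith) (by linarith)
    · exact Lf.noX C.isLam C.leaf k.1 (by linarith) (by linarith) (by linarith) (by linarith)

lemma gate' (C : Core L U p d η) {w a b : ℝ}
    (hw : (w : S1) ∈ U ∨ ((w + 1/3 : ℝ) : S1) ∈ U) (h : Lf L a b) (h1 : d + 1/3 < a)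
    (h2 : a < w + 1/3) (h3 : w + 1/3 < b) (h4 : b < d + 1/3 + η) : False := by
  have p1 := C.pos
  have p2 := C.le
  rcases hw with hw | hw
  · rcases h.sib C.isInv (coe_ne_of_lt (by linarith) (by linarith)) with k | k
    · have k' := k.2.shift (p' := a - 1/3) (q' := b - 1/3) (-1) (-1) (by push_cast; ring)
        (by push_cast; ring)
      exact C.unl _ _ _ _ k' hw C.mem1 (by linarith) (by linarith) (by linarith) (by linarith)
    · have k' := k.1.shift (p' := a + 1/3) (q' := b - 1/3) 0 (-1) (by push_cast; ring)
        (by push_cast; ring)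
      exact Lf.noX C.isLam C.leaf k'.symm (by linarith) (by linarith) (by linarith) (by linarith)
  · exact C.unl _ _ _ _ h hw C.mem3 h2 h3 h4 (by linarith)

/-- A chain passing over a height contains a leaf passing over it. -/
lemma exists_leaf_over {u v : S1} (h : ChainJoined L v u) {w : ℝ} (h1 : rep d v ≤ w)
    (h2 : w < rep d u) : ∃ a b : S1, ChainJoined L u a ∧ ChainJoined L u b ∧
      Lf L (rep d a) (rep d b) ∧ rep d a ≤ w ∧ w < rep d b := by
  obtain ⟨a, b, ha, hna, hb, hl⟩ := h.exists_leaf (B := {x | w < rep d x})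
    (by simpa using h1) h2
  have hl := hl (rep d a) (rep d b) (coe_rep d a) (coe_rep d b)
  have hab := hl.chain
  rw [coe_rep, coe_rep] at hab
  exact ⟨a, b, h.symm.trans ha, (h.symm.trans ha).trans hab, hl, by simpa using hna, hb⟩

lemma long_sector_aux (C : Core L U p d η) (S : PerSys L P K) {w : ℝ} (hw1 : d ≤ w)
    (hw2 : w ≤ d + η) (hw : (w : S1) ∈ U ∨ ((w + 1/3 : ℝ) : S1) ∈ U)
    (hwP : ((3 * w : ℝ) : S1) ∉ P) {u : S1} (hu : u ∈ P) (hlen : 1/3 ≤ gapLen L u)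
    (hX : rep d u ≤ d + 1/2 ∨ d + 5/6 + η ≤ rep d u) :
    ((3 * w : ℝ) : S1) ∈ sector L (s3 u) ∨ antip ((3 * w : ℝ) : S1) ∈ sector L (s3 u) := by
  have p1 := C.pos
  have p2 := C.le
  have hn := S.isNext hu
  have hv := S.nxt_mem hu
  have hs : ∀ x ∈ P, s3 x ∈ P := fun x hx => S.adm _ SymIter.id.tri x hx
  have hsec : ∀ τ : ℝ, triple d η (rep d u) < τ →
      τ < triple d η (rep d u) + fd (s3 u) (s3 (nxt L u)) → (τ : S1) ∈ sector L (s3 u) := by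
    intro τ t1 t2
    have e : fd (s3 u) (τ : S1) = τ - triple d η (rep d u) := by
      have := fd_coe t1.le (by linarith [fd_lt_one (s3 u) (s3 (nxt L u))])
      rwa [coe_triple, coe_rep] at this
    refine ⟨by linarith, ?_⟩
    rw [gapLen, S.nxt_s3 hu]
    linarith
  have hsec1 : triple d η (rep d u) < 3 * w + 1 →
      3 * w + 1 < triple d η (rep d u) + fd (s3 u) (s3 (nxt L u)) →
      ((3 * w : ℝ) : S1) ∈ sector L (s3 u) := by
    intro a b
    rw [← coe_add_one]
    exact hsec _ a b
  have hph : ∀ x ∈ P, triple d η (rep d x) ≠ 3 * w := by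
    intro x hx e
    have := coe_triple (d := d) (η := η) (rep d x)
    rw [e, coe_rep] at this
    exact hwP (by rw [this]; exact hs x hx)
  have hph1 : ∀ x ∈ P, triple d η (rep d x) ≠ 3 * w + 1 := by
    intro x hx e
    have := coe_triple (d := d) (η := η) (rep d x)
    rw [e, coe_rep, coe_add_one] at this
    exact hwP (by rw [this]; exact hs x hx)
  have hph2 : ∀ x ∈ P, triple d η (rep d x) ≠ 3 * w + 1/2 := by
    intro x hx e
    have := coe_triple (d := d) (η := η) (rep d x)
    rw [e, coe_rep, ← antip_coe] at this
    have h2 := S.adm _ SymIter.id.anti _ (hs x hx)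
    rw [← this] at h2
    simp only [Function.comp_apply, id_eq, antip_antip] at h2
    exact hwP h2
  have u1 := hph u hu
  have v1 := hph _ hv
  have u2 := hph1 u hu
  have v2 := hph1 _ hv
  have u3 := hph2 u hu
  have v3 := hph2 _ hv
  have hcl : ∀ x, ChainJoined L u x → x ∈ P := S.closed u hu
  have hreg := C.chain_region hn.1
  have hgl : gapLen L u = fd u (nxt L u) := rfl
  have ru := lt_rep d u
  have ru' := rep_le d u
  have rv := lt_rep d (nxt L u)
  have rv' := rep_le d (nxt L u)
  rcases lt_trichotomy (rep d u) (rep d (nxt L u)) with hlt | heq | hgt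
  · rw [fd_of_rep_le hlt.le] at hgl
    obtain ⟨e, -, -⟩ := C.fd_s3_of_rep_lt hn.1 hlt
    rcases regionIdx_cases hreg with k | k | k | k | k | k | k
    · linarith
    · linarith
    · linarith
    · obtain ⟨k1, k2⟩ := k
      have k1 : rep d u ≤ d + 1/2 := by
        rcases k1 with k1 | k1
        · exact k1.2
        · linarith
      have k1' : d + 1/3 + η ≤ rep d u := by
        rcases ‹(d + 1/3 + η ≤ rep d u ∧ rep d u ≤ d + 1/2) ∨ d + 5/6 + η ≤ rep d u› with k | k
        · exact k.1
        · linarith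
      have k2 : d + 5/6 + η ≤ rep d (nxt L u) := by
        rcases k2 with k2 | k2
        · linarith
        · exact k2
      have f1 : triple d η (rep d u) = 3 * rep d u - 1 := by
        unfold triple
        rw [if_neg (by linarith), if_pos (by linarith)]
      have f2 : triple d η (rep d (nxt L u)) = 3 * rep d (nxt L u) - 2 := by
        unfold triple
        rw [if_neg (by linarith), if_neg (by linarith)]
      right
      rw [antip_coe]
      refine hsec _ (lt_of_le_of_ne (by linarith) u3) ?_
      rw [e]
      have := lt_of_le_of_ne (by linarith : 3 * w + 1/2 ≤ triple d η (rep d (nxt L u))) (Ne.symm v3)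
      linarith
    · rcases hX with h | h <;> linarith
    · rcases hX with h | h <;> linarith
    · rcases hX with h | h <;> linarith
  · rw [fd_of_rep_le heq.le] at hgl
    linarith
  left
  obtain ⟨e, -, -⟩ := C.fd_s3_of_rep_gt hn.1 hgt
  rw [e] at hsec1 hsec
  rcases regionIdx_cases hreg with k | k | k | k | k | k | k
  · have f1 : triple d η (rep d u) = 3 * rep d u - 0 := by
      unfold triple
      rw [if_pos (by linarith)]
    have f2 : triple d η (rep d (nxt L u)) = 3 * rep d (nxt L u) - 0 := by
      unfold triple
      rw [if_pos (by linarith)]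
    rcases lt_or_ge (triple d η (rep d u)) (3 * w) with c | c
    · exact hsec _ c (by linarith)
    rcases lt_or_ge (3 * w) (triple d η (rep d (nxt L u))) with c' | c'
    · exact hsec1 (by linarith) (by linarith)
    exfalso
    have c := lt_of_le_of_ne c (Ne.symm u1)
    obtain ⟨a, b, ha, hb, hl, hwa, hwb⟩ := exists_leaf_over (d := d) hn.1.symm (w := w)
      (by linarith) (by linarith)
    have a1 := hph a (hcl a ha)
    have ra := lt_rep d a
    have f3 : triple d η (rep d a) = 3 * rep d a - 0 := by
      unfold triple
      rw [if_pos (by linarith)]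
    have hb' : rep d b < d + η := by
      rcases regionIdx_cases (C.chain_region hb) with m | m | m | m | m | m | m
      · exact m.2
      all_goals first | linarith | (rcases m.1 with m | m <;> linarith)
    exact C.gate hw hl ra (lt_of_le_of_ne hwa fun e => a1 (by rw [f3, e]; ring)) hwb hb'
  · have f1 : triple d η (rep d u) = 3 * rep d u - 0 := by
      unfold triple
      rw [if_pos (by linarith)]
    have f2 : triple d η (rep d (nxt L u)) = 3 * rep d (nxt L u) - 0 := by
      unfold triple
      rw [if_pos (by linarith)]
    refine hsec1 (lt_of_le_of_ne (by linarith) u2) ?_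
    have := lt_of_le_of_ne (by linarith : 3 * w ≤ triple d η (rep d (nxt L u))) (Ne.symm v1)
    linarith
  · have f1 : triple d η (rep d u) = 3 * rep d u - 1 := by
      unfold triple
      rw [if_neg (by linarith), if_pos (by linarith)]
    have f2 : triple d η (rep d (nxt L u)) = 3 * rep d (nxt L u) - 1 := by
      unfold triple
      rw [if_neg (by linarith), if_pos (by linarith)]
    rcases lt_or_ge (triple d η (rep d u)) (3 * w) with c | c
    · exact hsec _ c (by linarith)
    rcases lt_or_ge (3 * w) (triple d η (rep d (nxt L u))) with c' | c'
    · exact hsec1 (by linarith) (by linarith)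
    exfalso
    have c := lt_of_le_of_ne c (Ne.symm u1)
    obtain ⟨a, b, ha, hb, hl, hwa, hwb⟩ := exists_leaf_over (d := d) hn.1.symm (w := w + 1/3)
      (by linarith) (by linarith)
    have a1 := hph a (hcl a ha)
    have ra : d + 1/3 < rep d a := by
      rcases regionIdx_cases (C.chain_region ha) with m | m | m | m | m | m | m
      all_goals first | linarith | (rcases m.1 with m | m <;> linarith)
    have f3 : triple d η (rep d a) = 3 * rep d a - 1 := by
      unfold triple
      rw [if_neg (by linarith), if_pos (by linarith)]
    have hb' : rep d b < d + 1/3 + η := by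
      rcases regionIdx_cases (C.chain_region hb) with m | m | m | m | m | m | m
      all_goals first | linarith | (rcases m.1 with m | m <;> linarith)
    exact C.gate' hw hl ra (lt_of_le_of_ne hwa fun e => a1 (by rw [f3, e]; ring)) hwb hb'
  · have g1 : triple d η (rep d u) ≤ 3 * d + 1 := by
      unfold triple
      rcases k.1 with m | m
      · rw [if_neg (by linarith), if_pos (by linarith)]
        linarith
      · rw [if_neg (by linarith), if_neg (by linarith)]
        linarith
    have g2 : 3 * d + 3 * η ≤ triple d η (rep d (nxt L u)) := by
      unfold triple
      rcases k.2 with m | m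
      · rw [if_neg (by linarith), if_pos (by linarith)]
        linarith
      · rw [if_neg (by linarith), if_neg (by linarith)]
        linarith
    refine hsec1 (lt_of_le_of_ne (by linarith) u2) ?_
    have := lt_of_le_of_ne (by linarith : 3 * w ≤ triple d η (rep d (nxt L u))) (Ne.symm v1)
    linarith
  · rcases hX with h | h <;> linarith
  · rcases hX with h | h <;> linarith
  · rcases hX with h | h <;> linarith

lemma long_sector (C : Core L U p d η) (S : PerSys L P K) {w : ℝ} (hw1 : d ≤ w)
    (hw2 : w ≤ d + η) (hw : (w : S1) ∈ U ∨ ((w + 1/3 : ℝ) : S1) ∈ U)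
    (hwP : ((3 * w : ℝ) : S1) ∉ P) {u : S1} (hu : u ∈ P) (hlen : 1/3 ≤ gapLen L u) :
    ((3 * w : ℝ) : S1) ∈ sector L (s3 u) ∨ antip ((3 * w : ℝ) : S1) ∈ sector L (s3 u) := by
  have p2 := C.le
  by_cases hX : rep d u ≤ d + 1/2 ∨ d + 5/6 + η ≤ rep d u
  · exact C.long_sector_aux S hw1 hw2 hw hwP hu hlen hX
  push Not at hX
  have hu' : antip u ∈ P := S.adm _ SymIter.id.anti u hu
  have hr : rep d (antip u) = rep d u - 1/2 := by
    have e : ((rep d u - 1/2 : ℝ) : S1) = antip u := by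
      conv_rhs => rw [← coe_rep d u, antip_coe]
      exact coe_eq_iff.2 ⟨-1, by push_cast; ring⟩
    rw [← e, rep_coe (by linarith) (by linarith [rep_le d u])]
  have hsu : s3 u ∈ P := S.adm _ SymIter.id.tri u hu
  have hsu' : antip (s3 u) ∈ P := S.adm _ SymIter.id.anti _ hsu
  have := C.long_sector_aux S hw1 hw2 hw hwP hu' (by rw [S.gapLen_antip hu]; exact hlen)
    (Or.inl (by rw [hr]; linarith))
  rw [s3_antip] at this
  rcases this with h | h
  · right
    have := S.sector_antip hsu' h
    rwa [antip_antip] at this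
  · left
    have := S.sector_antip hsu' h
    rwa [antip_antip, antip_antip] at this

end Core

end

section

variable {L : Set Chord} {U : Set S1} {p : ℕ} {d η : ℝ} {P : Set S1} {K : ℕ}

lemma Unl.false_of_fd {B : Set S1} (hB : Unl L B) {a b x y : S1} (hl : s(a, b) ∈ L) (hx : x ∈ B)
    (hy : y ∈ B) (h1 : 0 < fd a x) (h2 : fd a x < fd a b) (h3 : fd a b < fd a y) : False := by
  have hab : a ≠ b := ne_of_fd_pos (h1.trans h2)
  obtain ⟨r, rfl⟩ := exists_coe a
  refine hB r (r + fd (r : S1) x) (r + fd (r : S1) b) (r + fd (r : S1) y) ⟨?_, ?_⟩ ?_ ?_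
    (by linarith) (by linarith) (by linarith) (by linarith [fd_lt_one (r : S1) y])
  · rwa [coe_add_fd]
  · rwa [coe_add_fd]
  · rwa [coe_add_fd]
  · rwa [coe_add_fd]

/-- A class with exactly two points is a leaf. -/
lemma mem_of_chain_pair {x y : S1} (h : ChainJoined L x y) (hxy : x ≠ y)
    (hz : ∀ z, ChainJoined L x z → z = x ∨ z = y) : s(x, y) ∈ L := by
  obtain ⟨u, v, hu, huB, rfl, hl⟩ := h.exists_leaf (B := {y}) hxy rfl
  obtain rfl := (hz u hu).resolve_right huB
  obtain ⟨r, rfl⟩ := exists_coe u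
  obtain ⟨t, rfl⟩ := exists_coe v
  exact (hl r t rfl rfl).1

namespace PerSys

lemma leaf_iterate (S : PerSys L P K) (n : ℕ) {x y : S1} (h : s(x, y) ∈ L) (hxy : x ≠ y) :
    s(s3^[n] x, s3^[n] y) ∈ L := by
  have hc : ChainJoined L x y :=
    Relation.ReflTransGen.single ⟨_, h, Sym2.mem_mk_left _ _, Sym2.mem_mk_right _ _⟩
  have hI := S.lam.toIsInvLam
  induction n with
  | zero => exact h
  | succ n ih =>
    have h2 := hI.forward _ ih
    rw [cmap_mk, ← Function.iterate_succ_apply' s3, ← Function.iterate_succ_apply' s3,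
      Sym2.mk_isDiag_iff] at h2
    exact h2.resolve_right fun e => hxy (iterate_inj hI S.ord _ hc e)

/-- A class eventually mapped into the system is not separated by leaves. -/
lemma unl_class (S : PerSys L P K)
    (R : ∀ x ∈ P, ∀ y, x ≠ y → s(x, y) ∈ L → y = nxt L x ∨ x = nxt L y)
    {n : ℕ} {x₀ : S1} (hx₀ : s3^[n] x₀ ∈ P) : Unl L {y | ChainJoined L x₀ y} := by
  intro a x b y hl hx hy h1 h2 h3 h4
  have hI := S.lam.toIsInvLam
  have hab := hl.chain
  have hax : ChainJoined L (a : S1) x :=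
    hab.of_cross hI.toIsLamination (hx.symm.trans hy) h1 h2 h3 h4
  have hay := hax.trans (hx.symm.trans hy)
  have fx := fd_coe h1.le (by linarith : x < a + 1)
  have fb := fd_coe (h1.trans h2).le (by linarith : b < a + 1)
  have fy := fd_coe (by linarith : a ≤ y) h4
  have o0 := iterate_ord hI S.ord n chain_rfl hax (by rw [fd_self, fx]; linarith)
  have o1 := iterate_ord hI S.ord n hax hab (by rw [fx, fb]; linarith)
  have o2 := iterate_ord hI S.ord n hab hay (by rw [fb, fy]; linarith)
  rw [fd_self] at o0
  have ha : s3^[n] (a : S1) ∈ P :=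
    S.closed _ hx₀ _ ((ChainJoined.trans hx hax.symm).iterate hI n)
  have hb : s3^[n] (b : S1) ∈ P := S.closed _ ha _ (hab.iterate hI n)
  have hne : s3^[n] (a : S1) ≠ s3^[n] (b : S1) := ne_of_fd_pos (o0.trans o1)
  rcases R _ ha _ hne (S.leaf_iterate n hl.1 hl.2) with e | e
  · have := (S.isNext ha).2.2 _ (hax.iterate hI n) (ne_of_fd_pos o0)
    rw [← e] at this
    linarith
  · have hby : s3^[n] (b : S1) ≠ s3^[n] (y : S1) := by
      intro e
      rw [e] at o2
      exact lt_irrefl _ o2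
    have := (S.isNext hb).2.2 _ ((hab.symm.trans hay).iterate hI n) hby
    rw [← e, fd_swap hne, fd_sub o2.le] at this
    linarith [fd_lt_one (s3^[n] (a : S1)) (s3^[n] (y : S1))]

/-- A set not separated by leaves that contains three points of a class of the system lies in
that class. -/
lemma subset_class (S : PerSys L P K) (R : ∀ x ∈ P, s(x, nxt L x) ∈ L) {W : Set S1}
    (hW : Unl L W) {a b c : S1} (haP : a ∈ P) (ha : a ∈ W) (hb : b ∈ W) (hc : c ∈ W)
    (hab : ChainJoined L a b) (hac : ChainJoined L a c) (h1 : a ≠ b) (h2 : a ≠ c) (h3 : b ≠ c) :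
    W ⊆ {y | ChainJoined L a y} := by
  intro t ht
  by_contra hn
  obtain ⟨y, hy, hty⟩ := S.exists_sector haP hn
  have hyP := S.closed a haP y hy
  have key : ∀ v ∈ W, ChainJoined L a v → v = y ∨ v = nxt L y := by
    intro v hv hav
    by_contra hne
    push Not at hne
    have h5 := (S.isNext hyP).2.2 v (hy.symm.trans hav) hne.1.symm
    have h6 : fd y (nxt L y) < fd y v := lt_of_le_of_ne h5 fun e => hne.2 (eq_of_fd_eq e).symm
    exact hW.false_of_fd (R y hyP) ht hv hty.1 hty.2 h6
  rcases key a ha chain_rfl with ea | ea <;> rcases key b hb hab with eb | eb <;>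
    rcases key c hc hac with ec | ec
  all_goals first
    | exact h1 (ea.trans eb.symm)
    | exact h2 (ea.trans ec.symm)
    | exact h3 (eb.trans ec.symm)

end PerSys

lemma Core.isQLam (C : Core L U p d η) : IsQLam L := by
  intro x y hxy
  by_cases hne : x = y
  · exact Or.inl hne
  right
  have hI := C.isInv
  by_cases hz : ∀ z, ChainJoined L x z → z = x ∨ z = y
  · exact Or.inl ⟨_, mem_of_chain_pair hxy hne hz, Sym2.mem_mk_left _ _, Sym2.mem_mk_right _ _⟩
  right
  push Not at hz
  obtain ⟨z, hxz, hzx, hzy⟩ := hz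
  obtain ⟨P, K, n, S, hn⟩ := C.exists_perSys hxy hxz hne hzx.symm hzy.symm
  obtain ⟨w, hw1, hw2, hw, hwP⟩ := C.exists_gate S
  obtain ⟨u, hu, horb⟩ := S.exists_orbit ⟨_, hn⟩ (ω := ((3 * w : ℝ) : S1)) fun v hv hlen =>
    C.long_sector S hw1 hw2 hw hwP hv hlen
  obtain ⟨R1, R2⟩ := S.leaf_iff hu horb
  obtain ⟨G, hG, hsub⟩ := (S.unl_class R1 hn).exists_gap (a := x) (b := y) (c := z) chain_rfl hxy
    hxz hne hzx.symm hzy.symm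
  have hV := subset_gapVerts hsub
  refine ⟨G, hG, ?_, hV chain_rfl, hV hxy⟩
  by_contra hinf
  have hW := S.subset_class R2 ((unl_gapVerts hG).iterate hI n) hn
    (mem_image_of_mem _ (hV chain_rfl)) (mem_image_of_mem _ (hV hxy)) (mem_image_of_mem _ (hV hxz))
    (hxy.iterate hI n) (hxz.iterate hI n) (fun e => hne (iterate_inj hI S.ord n hxy e))
    (fun e => hzx.symm (iterate_inj hI S.ord n hxz e))
    (fun e => hzy.symm (iterate_inj hI S.ord n (hxy.symm.trans hxz) e))
  exact infinite_iterate_image hinf n ((S.class_finite hn).subset hW)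

end

lemma cmap_iterate_succ (n : ℕ) (ℓ : Chord) :
    cmap (s3^[n + 1]) ℓ = cmap s3 (cmap (s3^[n]) ℓ) := by
  rw [cmap, cmap, cmap, Sym2.map_map, Function.iterate_succ']

lemma cmap_zero (ℓ : Chord) : cmap (s3^[0]) ℓ = ℓ := by
  rw [cmap, Function.iterate_zero, Sym2.map_id, id]

lemma cmap_isDiag (f : S1 → S1) {ℓ : Chord} (h : ℓ.IsDiag) : (cmap f ℓ).IsDiag := by
  induction ℓ using Sym2.inductionOn with
  | hf a b =>
    rw [cmap_mk, Sym2.mk_isDiag_iff]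
    rw [Sym2.mk_isDiag_iff] at h
    rw [h]

lemma not_isDiag_of_le {ℓ : Chord} {n k : ℕ} (hk : k ≤ n) (h : ¬ (cmap (s3^[n]) ℓ).IsDiag) :
    ¬ (cmap (s3^[k]) ℓ).IsDiag := by
  induction n, hk using Nat.le_induction with
  | base => exact h
  | succ n _ ih =>
    rw [cmap_iterate_succ] at h
    exact ih fun e => h (cmap_isDiag s3 e)

lemma cmap_iterate_mem {L : Set Chord} (hL : IsInvLam L) {ℓ : Chord} (hℓ : ℓ ∈ L) {n : ℕ}
    (h : ¬ (cmap (s3^[n]) ℓ).IsDiag) : cmap (s3^[n]) ℓ ∈ L := by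
  induction n with
  | zero => rwa [cmap_zero]
  | succ n ih =>
    have h1 := ih (not_isDiag_of_le n.le_succ h)
    rw [cmap_iterate_succ] at h ⊢
    exact (hL.forward _ h1).resolve_right h

lemma exists_folding {L : Set Chord} (hL : IsInvLam L) {U : Set S1} (hU : Unl L U)
    (hinf : U.Infinite) {ℓ ℓ' : Chord} (hℓ : ℓ ∈ L) (hℓ' : ℓ' ∈ L) (hne : ℓ ≠ ℓ')
    (h : cmap s3 ℓ' = cmap s3 ℓ) (hd : ¬ (cmap s3 ℓ).IsDiag) (hv : ∀ x ∈ ℓ, x ∈ U)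
    (hv' : ∀ x ∈ ℓ', x ∈ U) : ∃ b a b' a' : ℝ, Folding L U b a b' a' := by
  obtain ⟨b, a, -, -, rfl⟩ := exists_lifts_of_not_isDiag fun e => hd (cmap_isDiag s3 e)
  obtain ⟨b', a', rfl, hb, ha⟩ := exists_of_cmap_eq h
  rw [cmap_mk, s3_coe, s3_coe, Sym2.mk_isDiag_iff] at hd
  have hl : Lf L b a := ⟨hℓ, fun e => hd (coe_three_eq_iff.2 (Or.inl e))⟩
  have hl' : Lf L b' a' := ⟨hℓ', fun e => hd (by
    rw [← hb, ← ha]; exact coe_three_eq_iff.2 (Or.inl e))⟩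
  have mb := hv _ (Sym2.mem_mk_left _ _)
  have ma := hv _ (Sym2.mem_mk_right _ _)
  have mb' := hv' _ (Sym2.mem_mk_left _ _)
  have ma' := hv' _ (Sym2.mem_mk_right _ _)
  refine ⟨b, a, b', a', hU, hinf, hl, hl', mb, ma, mb', ma', hd, ?_, ?_⟩
  · refine (coe_three_eq_iff.1 hb).resolve_left fun e => ?_
    exact hU.no_fold hL hinf ma mb ma' hl (hl'.congr e.symm rfl)
      (fun e' => hne (by rw [e, e'])) ha.symm hd
  · refine (coe_three_eq_iff.1 ha).resolve_left fun e => ?_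
    exact hU.no_fold hL hinf mb ma mb' hl.symm (hl'.symm.congr e.symm rfl)
      (fun e' => hne (by rw [e, e'])) hb.symm (Ne.symm hd)

namespace Folding

variable {L : Set Chord} {U : Set S1} {b a b' a' : ℝ}

lemma antip (hL : IsCubicSymLam L) (F : Folding L U b a b' a') :
    Folding L (antip '' U) (b + 1/2) (a + 1/2) (b' + 1/2) (a' + 1/2) := by
  have hm : ∀ {t : ℝ}, (t : S1) ∈ U → ((t + 1/2 : ℝ) : S1) ∈ _root_.antip '' U :=
    fun h => ⟨_, h, antip_coe _⟩
  have hs : ∀ {t t' : ℝ}, ((t' : S1) = ((t + 1/3 : ℝ) : S1) ∨ (t' : S1) = ((t + 2/3 : ℝ) : S1)) →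
      (((t' + 1/2 : ℝ) : S1) = ((t + 1/2 + 1/3 : ℝ) : S1) ∨
        ((t' + 1/2 : ℝ) : S1) = ((t + 1/2 + 2/3 : ℝ) : S1)) := by
    intro t t' h
    rcases h with h | h
    · left
      obtain ⟨n, hn⟩ := coe_eq_iff.1 h
      exact coe_eq_iff.2 ⟨n, by rw [hn]; ring⟩
    · right
      obtain ⟨n, hn⟩ := coe_eq_iff.1 h
      exact coe_eq_iff.2 ⟨n, by rw [hn]; ring⟩
  refine ⟨unl_antip hL F.unl, F.inf.image fun x _ y _ h => ?_, F.leaf.half hL, F.leaf'.half hL,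
    hm F.hb, hm F.ha, hm F.hb', hm F.ha', fun h => F.ne ?_, hs F.hbb, hs F.haa⟩
  · rw [← antip_antip x, h, antip_antip]
  · obtain ⟨n, hn⟩ := coe_eq_iff.1 h
    exact coe_eq_iff.2 ⟨n, by linarith⟩

lemma gapDegreeGE2 (hL : IsInvLam L) (F : Folding L U b a b' a') {G : Set ℂ} (hG : IsGapOf L G)
    (h : convexHull ℝ (toC '' U) ⊆ G) : GapDegreeGE2 G 1 := by
  have hV := subset_gapVerts h
  have tb : ((3 * b' : ℝ) : S1) = ((3 * b : ℝ) : S1) := coe_three_eq_iff.2 (Or.inr F.hbb)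
  have ta : ((3 * a' : ℝ) : S1) = ((3 * a : ℝ) : S1) := coe_three_eq_iff.2 (Or.inr F.haa)
  have key : ∀ (t t' : ℝ), ((t' : S1) = ((t + 1/3 : ℝ) : S1) ∨ (t' : S1) = ((t + 2/3 : ℝ) : S1)) →
      (t : S1) ≠ t' := by
    intro t t' h e
    rw [← e] at h
    rcases h with h | h
    · exact coe_ne_of_lt (by linarith) (by linarith) h
    · exact coe_ne_of_lt (by linarith) (by linarith) h
  have n1 := key _ _ F.hbb
  have n2 := key _ _ F.haa
  have n3 : (b : S1) ≠ a' := fun e => F.ne (by rw [← ta]; exact coe_three_eq_iff.2 (Or.inl e))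
  have n4 : (a : S1) ≠ b' := fun e => F.ne (by
    rw [← tb]; exact coe_three_eq_iff.2 (Or.inl e.symm))
  have hd : ¬ (s((b : S1), (a : S1)) : Chord).IsDiag := by
    rw [Sym2.mk_isDiag_iff]; exact F.leaf.2
  have hd' : ¬ (s((b' : S1), (a' : S1)) : Chord).IsDiag := by
    rw [Sym2.mk_isDiag_iff]; exact F.leaf'.2
  have hdisj : ∀ x ∈ (s((b : S1), (a : S1)) : Chord), x ∉ (s((b' : S1), (a' : S1)) : Chord) := by
    intro x hx hx'
    rcases Sym2.mem_iff.1 hx with rfl | rfl <;> rcases Sym2.mem_iff.1 hx' with e | e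
    exacts [n1 e, n3 e, n4 e, n2 e]
  refine ⟨s(((3 * b : ℝ) : S1), ((3 * a : ℝ) : S1)), s((b : S1), (a : S1)),
    s((b' : S1), (a' : S1)), ?_, ?_, ?_, ?_, ?_, ?_, ?_⟩
  · have hl := F.leaf.three hL F.ne
    refine ((unl_gapVerts hG).image hL).isEdgeOf_hull hl.1 ?_ ?_
    · rw [Sym2.mk_isDiag_iff]
      exact hl.2
    · intro x hx
      rcases Sym2.mem_iff.1 hx with rfl | rfl
      · exact ⟨_, hV F.hb, s3_coe b⟩
      · exact ⟨_, hV F.ha, s3_coe a⟩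
  · intro e
    exact hdisj b (Sym2.mem_mk_left _ _) (by rw [← e]; exact Sym2.mem_mk_left _ _)
  · refine isEdgeOf_gap hG h F.leaf.1 hd fun x hx => ?_
    rcases Sym2.mem_iff.1 hx with rfl | rfl
    exacts [F.hb, F.ha]
  · refine isEdgeOf_gap hG h F.leaf'.1 hd' fun x hx => ?_
    rcases Sym2.mem_iff.1 hx with rfl | rfl
    exacts [F.hb', F.ha']
  · exact disjoint_chordSet hL.toIsLamination F.leaf.1 F.leaf'.1 hd hdisj
  · rw [Function.iterate_one, cmap_mk, s3_coe, s3_coe]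
  · rw [Function.iterate_one, cmap_mk, s3_coe, s3_coe, tb, ta]

end Folding

lemma hull_antip (U : Set S1) :
    convexHull ℝ (toC '' (antip '' U)) = (fun z : ℂ => -z) '' convexHull ℝ (toC '' U) := by
  have h : toC '' (antip '' U) = - (toC '' U) := by
    rw [← Set.image_neg_eq_neg, image_image, image_image]
    exact image_congr fun x _ => toC_antip x
  rw [h, convexHull_neg, ← Set.image_neg_eq_neg]

lemma exists_folding_of_hyperbolic {L : Set Chord} (hL : IsInvLam L) (h : HasHyperbolicGap L) :
    ∃ (U : Set S1) (p : ℕ) (b a b' a' : ℝ), 1 ≤ p ∧ (∀ x ∈ U, s3^[p] x ∈ U) ∧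
      Folding L U b a b' a' := by
  obtain ⟨G, p, hG, hinf, hp, hper, m, e₁, e₂, hm, hne, h1, h2, -, hm1, hm2⟩ := h
  have hnd : ∀ e : Chord, cmap (s3^[p]) e = m → ∀ k ≤ p, ¬ (cmap (s3^[k]) e).IsDiag :=
    fun e he k hk => not_isDiag_of_le hk (by rw [he]; exact hm.1)
  obtain ⟨i, hi, hi1, hi2⟩ : ∃ i < p, cmap (s3^[i]) e₁ ≠ cmap (s3^[i]) e₂ ∧
      cmap (s3^[i + 1]) e₂ = cmap (s3^[i + 1]) e₁ := by
    by_contra! hcon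
    have : ∀ k ≤ p, cmap (s3^[k]) e₁ ≠ cmap (s3^[k]) e₂ := by
      intro k
      induction k with
      | zero => intro _; rwa [cmap_zero, cmap_zero]
      | succ k ih => exact fun hk => (hcon k hk (ih (by omega))).symm
    exact this p le_rfl (hm1.trans hm2.symm)
  obtain ⟨l1, v1⟩ := mem_of_isEdgeOf hL.toIsLamination hG h1
  obtain ⟨l2, v2⟩ := mem_of_isEdgeOf hL.toIsLamination hG h2
  have hv : ∀ e : Chord, (∀ x ∈ e, x ∈ gapVerts G) →
      ∀ x ∈ cmap (s3^[i]) e, x ∈ s3^[i] '' gapVerts G := by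
    intro e he x hx
    obtain ⟨y, hy, rfl⟩ := Sym2.mem_map.1 hx
    exact ⟨y, he y hy, rfl⟩
  rw [cmap_iterate_succ, cmap_iterate_succ] at hi2
  obtain ⟨b, a, b', a', F⟩ := exists_folding hL ((unl_gapVerts hG).iterate hL i)
    (infinite_iterate_image hinf i) (cmap_iterate_mem hL l1 (hnd e₁ hm1 i hi.le))
    (cmap_iterate_mem hL l2 (hnd e₂ hm2 i hi.le)) hi1 hi2
    (by rw [← cmap_iterate_succ]; exact hnd e₁ hm1 _ hi) (hv e₁ v1) (hv e₂ v2)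
  refine ⟨_, p, b, a, b', a', hp, ?_, F⟩
  rintro _ ⟨x, hx, rfl⟩
  refine ⟨s3^[p] x, ?_, ?_⟩
  · have := iterate_mem_gapVerts p hx
    rwa [hper] at this
  · rw [← Function.iterate_add_apply, add_comm, Function.iterate_add_apply]

theorem hyperbolic_lamination_structure :
    ∀ L : Set Chord, IsCubicSymLam L → HasHyperbolicGap L →
      (∃ G : Set ℂ, IsGapOf L G ∧ (gapVerts G).Infinite ∧ GapDegreeGE2 G 1 ∧
        IsGapOf L ((fun z : ℂ => -z) '' G) ∧
        (gapVerts ((fun z : ℂ => -z) '' G)).Infinite ∧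
        GapDegreeGE2 ((fun z : ℂ => -z) '' G) 1 ∧
        (fun z : ℂ => -z) '' G ≠ G) ∧
      IsQLam L := by
  intro L hL hH
  obtain ⟨U, p, b, a, b', a', hp, hinv, F⟩ := exists_folding_of_hyperbolic hL.toIsInvLam hH
  constructor
  · have hinf := F.inf
    obtain ⟨x, hx⟩ := hinf.nonempty
    obtain ⟨y, hy, hyn⟩ := hinf.exists_notMem_finite (toFinite {x})
    obtain ⟨z, hz, hzn⟩ := hinf.exists_notMem_finite (toFinite {x, y})
    simp only [mem_singleton_iff, mem_insert_iff, not_or] at hyn hzn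
    obtain ⟨G, hG, hsub⟩ := F.unl.exists_gap hx hy hz (Ne.symm hyn) (Ne.symm hzn.1)
      (Ne.symm hzn.2)
    have hG' := isGapOf_neg hL hG
    have hsub' : convexHull ℝ (toC '' (antip '' U)) ⊆ (fun z : ℂ => -z) '' G := by
      rw [hull_antip]
      exact image_mono hsub
    refine ⟨G, hG, hinf.mono (subset_gapVerts hsub), F.gapDegreeGE2 hL.toIsInvLam hG hsub, hG',
      (F.antip hL).inf.mono (subset_gapVerts hsub'),
      (F.antip hL).gapDegreeGE2 hL.toIsInvLam hG' hsub', fun e => ?_⟩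
    rw [e] at hsub'
    exact F.not_unl_union hL.toIsInvLam
      ((unl_gapVerts hG).mono (union_subset (subset_gapVerts hsub) (subset_gapVerts hsub')))
  · obtain ⟨d, η, C⟩ := F.hull.exists_core hL (fun z hz => unlHull_max F.unl hz) hp
      (unlHull_inv hL.toIsInvLam F.unl F.inf hinv)
    exact C.isQLam

end
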